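/- Let 1 < q < 2, λ, μ > 0, let φ ∈ L¹(ℝ) be nonnegative, and let u = u^μ_λ be the (nonnegative) classical solution of the rescaled regularized problem. Then there exists a constant C = C(‖φ‖_{L¹(ℝ)}, q) > 0, independent of λ and μ, such that for every t > 0, R > 0 and h ∈ (0,1): ∫_{−R}^{R} |u(t,x+h) − u(t,x)| dx ≤ C·( R·h·t^{−2/q} + h·t^{−1/q} ). -/

import Mathlib

open MeasureTheory Filter ENNReal

/-- `u` is a classical solution of the rescaled regularized problem
`u_t + |u|^{q-1} u_x = λ^q (J_λ ∗ u - u) + μ u_xx` with initial datum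
`φ_λ(x) = λ φ(λ x)`, where `J_λ(x) = λ J(λ x)`. -/
def IsRescaledSol (J : ℝ → ℝ) (q lam μ : ℝ) (φ : ℝ → ℝ) (u : ℝ → ℝ → ℝ) : Prop :=
  (∀ t : ℝ, 0 ≤ t → Integrable (u t)) ∧
  (∀ t₀ : ℝ, 0 ≤ t₀ →
    Tendsto (fun t => ∫ x, |u t x - u t₀ x|) (nhdsWithin t₀ (Set.Ici 0)) (nhds 0)) ∧
  (∀ t : ℝ, 0 < t → ContDiff ℝ 2 (u t)) ∧
  (∀ x : ℝ, ContDiffOn ℝ 1 (fun s => u s x) (Set.Ioi 0)) ∧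
  (∀ t : ℝ, 0 < t → ∀ x : ℝ,
    deriv (fun s => u s x) t + |u t x| ^ (q - 1) * deriv (u t) x
      = lam ^ q * ((∫ y, lam * J (lam * (x - y)) * u t y) - u t x)
        + μ * deriv (deriv (u t)) x) ∧
  (u 0 =ᵐ[volume] fun x => lam * φ (lam * x))

namespace KS
open Set Topology

/-- smoothed Heaviside -/
noncomputable def chi (e r : ℝ) : ℝ := (max r 0)^2 / ((max r 0)^2 + e^2)
noncomputable def chi' (e r : ℝ) : ℝ := 2 * (max r 0) * e^2 / ((max r 0)^2 + e^2)^2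
noncomputable def Phi (e r : ℝ) : ℝ := max r 0 - e * Real.arctan (max r 0 / e)

theorem hasDerivAt_max_comp (h h' : ℝ → ℝ) (hh : ∀ x, HasDerivAt h (h' x) x) (h0 : h' 0 = 0) (r : ℝ) :
    HasDerivAt (fun r => h (max r 0)) (h' (max r 0)) r := by
  rcases lt_trichotomy r 0 with hr | hr | hr
  · have : (fun r => h (max r 0)) =ᶠ[𝓝 r] fun _ => h 0 := by
      filter_upwards [Iio_mem_nhds hr] with s hs
      rw [max_eq_right (le_of_lt hs)]
    rw [max_eq_right hr.le, h0]
    exact (hasDerivAt_const r (h 0)).congr_of_eventuallyEq this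
  · subst hr
    simp only [max_self, h0]
    rw [← hasDerivWithinAt_univ, ← Iic_union_Ici (a := (0:ℝ))]
    apply HasDerivWithinAt.union
    · apply (hasDerivWithinAt_const (0:ℝ) (Iic 0) (h 0)).congr
      · intro x hx; rw [max_eq_right hx]
      · simp
    · have := (hh 0).hasDerivWithinAt (s := Ici 0)
      rw [h0] at this
      apply this.congr
      · intro x hx; rw [max_eq_left hx]
      · simp
  · have : (fun r => h (max r 0)) =ᶠ[𝓝 r] h := by
      filter_upwards [Ioi_mem_nhds hr] with s hs
      rw [max_eq_left (le_of_lt hs)]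
    rw [max_eq_left hr.le]
    exact (hh r).congr_of_eventuallyEq this

theorem chi_hasDerivAt {e : ℝ} (he : 0 < e) (r : ℝ) : HasDerivAt (chi e) (chi' e r) r := by
  have := hasDerivAt_max_comp (fun x => x^2/(x^2+e^2)) (fun x => 2 * x * e^2/(x^2+e^2)^2) ?_ (by simp) r
  · exact this
  · intro x
    have hp : x^2+e^2 ≠ 0 := by positivity
    have h1 : HasDerivAt (fun x : ℝ => x^2) (2*x) x := by simpa using hasDerivAt_pow 2 x
    have h2 := h1.fun_div (h1.add_const (e^2)) hp
    refine h2.congr_deriv ?_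
    congr 1
    ring

theorem Phi_hasDerivAt {e : ℝ} (he : 0 < e) (r : ℝ) : HasDerivAt (Phi e) (chi e r) r := by
  have := hasDerivAt_max_comp (fun x => x - e * Real.arctan (x/e)) (fun x => x^2/(x^2+e^2)) ?_ (by simp) r
  · exact this
  · intro x
    have hp : x^2+e^2 ≠ 0 := by positivity
    have h1 := (hasDerivAt_id' x).fun_sub ((((hasDerivAt_id' x).div_const e).arctan).const_mul e)
    refine h1.congr_deriv ?_
    have : 1 + (x/e)^2 ≠ 0 := by positivity
    field_simp
    ring

theorem chi'_continuous {e : ℝ} (he : 0 < e) : Continuous (chi' e) := by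
  unfold chi'
  apply Continuous.div (by fun_prop) (by fun_prop)
  intro x; positivity

theorem chi_continuous {e : ℝ} (he : 0 < e) : Continuous (chi e) :=
  continuous_iff_continuousAt.2 fun x => (chi_hasDerivAt he x).continuousAt
theorem Phi_continuous {e : ℝ} (he : 0 < e) : Continuous (Phi e) :=
  continuous_iff_continuousAt.2 fun x => (Phi_hasDerivAt he x).continuousAt

theorem chi_nonneg (e r : ℝ) : 0 ≤ chi e r := by unfold chi; positivity
theorem chi_le_one (e r : ℝ) : chi e r ≤ 1 := by
  unfold chi; apply div_le_one_of_le₀ <;> nlinarith [sq_nonneg e, sq_nonneg (max r 0)]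
theorem chi_of_nonpos (e : ℝ) {r : ℝ} (h : r ≤ 0) : chi e r = 0 := by
  unfold chi; rw [max_eq_right h]; simp
theorem Phi_of_nonpos (e : ℝ) {r : ℝ} (h : r ≤ 0) : Phi e r = 0 := by
  unfold Phi; rw [max_eq_right h]; simp
theorem abs_chi_le (e r : ℝ) : |chi e r| ≤ 1 := by
  rw [abs_of_nonneg (chi_nonneg e r)]; exact chi_le_one e r
theorem chi'_nonneg (e r : ℝ) : 0 ≤ chi' e r := by unfold chi'; positivity
theorem chi'_le {e : ℝ} (he : 0 < e) (r : ℝ) : chi' e r ≤ 1/e := by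
  unfold chi'
  rw [div_le_div_iff₀ (by positivity) he]
  set m := max r 0
  have hm : 0 ≤ m := le_max_right _ _
  nlinarith [mul_nonneg (sq_nonneg e) (sq_nonneg (m-e)), sq_nonneg (m^2), mul_nonneg (sq_nonneg m) (sq_nonneg e)]
theorem sq_mul_chi'_le {e : ℝ} (he : 0 < e) (r : ℝ) : r^2 * chi' e r ≤ e := by
  unfold chi'
  by_cases hr : r ≤ 0
  · rw [max_eq_right hr]; simp; exact he.le
  push Not at hr
  rw [max_eq_left hr.le, ← mul_div_assoc, div_le_iff₀ (by positivity)]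
  have h1 : 2 * r * e ≤ r^2 + e^2 := by nlinarith [sq_nonneg (r-e)]
  have h2 : r^2 * e * (2*r*e) ≤ r^2 * e * (r^2+e^2) := by gcongr
  have h3 : 0 ≤ e * (e^2 * (r^2 + e^2)) := by positivity
  nlinarith

theorem Phi_nonneg {e : ℝ} (he : 0 < e) (r : ℝ) : 0 ≤ Phi e r := by
  have hm : Monotone (Phi e) := monotone_of_deriv_nonneg
    (fun x => (Phi_hasDerivAt he x).differentiableAt)
    (fun x => by rw [(Phi_hasDerivAt he x).deriv]; exact chi_nonneg _ _)
  by_cases hr : r ≤ 0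
  · rw [Phi_of_nonpos e hr]
  · rw [← Phi_of_nonpos e le_rfl]; exact hm (le_of_not_ge hr)

theorem Phi_le {e : ℝ} (he : 0 < e) (r : ℝ) : Phi e r ≤ max r 0 := by
  unfold Phi
  have : 0 ≤ Real.arctan (max r 0/e) := Real.arctan_nonneg.2 (by positivity)
  nlinarith [mul_nonneg he.le this]

theorem le_Phi {e : ℝ} (he : 0 < e) (r : ℝ) : max r 0 ≤ Phi e r + 2 * e := by
  unfold Phi
  have h1 : Real.arctan (max r 0/e) ≤ 2 := by
    have := Real.arctan_lt_pi_div_two (max r 0/e)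
    linarith [Real.pi_le_four]
  nlinarith

theorem pos_mul_one_sub_chi {e : ℝ} (he : 0 < e) (r : ℝ) : max r 0 * (1 - chi e r) ≤ e := by
  unfold chi
  set m := max r 0
  have hm : 0 ≤ m := le_max_right _ _
  have hp : 0 < m^2+e^2 := by positivity
  have : m * (1 - m^2/(m^2+e^2)) = m*e^2/(m^2+e^2) := by field_simp; ring
  rw [this, div_le_iff₀ hp]
  nlinarith [sq_nonneg (m-e), mul_nonneg he.le (sq_nonneg (m-e)), mul_nonneg he.le (sq_nonneg m), pow_pos he 3, mul_nonneg hm (sq_nonneg e)]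

theorem chi_tendsto {e : ℕ → ℝ} (he : Tendsto e atTop (𝓝 0)) (r : ℝ) :
    Tendsto (fun n => chi (e n) r) atTop (𝓝 (if 0 < r then 1 else 0)) := by
  split_ifs with h
  · unfold chi
    rw [max_eq_left h.le]
    have h1 : Tendsto (fun n => r^2 / (r^2 + (e n)^2)) atTop (𝓝 (r^2/(r^2+0^2))) :=
      Tendsto.div tendsto_const_nhds (tendsto_const_nhds.add (he.pow 2)) (by positivity)
    convert h1 using 2
    field_simp; simp
  · simp [chi_of_nonpos _ (not_lt.1 h)]

theorem Phi_tendsto {e : ℕ → ℝ} (he : Tendsto e atTop (𝓝 0)) (he0 : ∀ n, 0 < e n) (r : ℝ) :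
    Tendsto (fun n => Phi (e n) r) atTop (𝓝 (max r 0)) := by
  apply tendsto_of_tendsto_of_tendsto_of_le_of_le (g := fun n => max r 0 - 2 * e n) (h := fun _ => max r 0)
  · simpa using (tendsto_const_nhds (x := max r 0)).sub (he.const_mul 2)
  · exact tendsto_const_nhds
  · intro n; have := le_Phi (he0 n) r; simp only; linarith
  · intro n; exact Phi_le (he0 n) r

/-- the flux -/
noncomputable def Hf (q v : ℝ) : ℝ := ∫ s in (0:ℝ)..v, |s|^(q-1)

theorem F_continuous {q : ℝ} (hq : 1 < q) : Continuous (fun s : ℝ => |s|^(q-1)) :=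
  continuous_abs.rpow_const (fun _ => Or.inr (by linarith))

theorem Hf_hasDerivAt {q : ℝ} (hq : 1 < q) (v : ℝ) : HasDerivAt (Hf q) (|v|^(q-1)) v :=
  intervalIntegral.integral_hasDerivAt_right ((F_continuous hq).intervalIntegrable _ _)
    ((F_continuous hq).stronglyMeasurableAtFilter _ _) (F_continuous hq).continuousAt

theorem Hf_lip {q : ℝ} (hq : 1 < q) {M a b : ℝ} (ha : |a| ≤ M) (hb : |b| ≤ M) :
    |Hf q a - Hf q b| ≤ M^(q-1) * |a - b| := by
  have hc : Convex ℝ (Icc (-M) M) := convex_Icc _ _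
  have := hc.norm_image_sub_le_of_norm_hasDerivWithin_le (f := Hf q) (f' := fun v => |v|^(q-1)) (C := M^(q-1))
    (fun x _ => (Hf_hasDerivAt hq x).hasDerivWithinAt) ?_ (abs_le.1 hb) (abs_le.1 ha)
  · simpa [Real.norm_eq_abs] using this
  · intro x hx
    rw [Real.norm_eq_abs, abs_of_nonneg (by positivity)]
    exact Real.rpow_le_rpow (abs_nonneg _) (abs_le.2 hx) (by linarith)

/-- single time estimate -/
theorem ST {a b : ℝ} (hab : a ≤ b) {μ e L η : ℝ} (hμ : 0 < μ) (he : 0 < e)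
    {z z' D D' D'' G G' : ℝ → ℝ}
    (hz : ∀ x, HasDerivAt z (z' x) x) (hz'c : Continuous z') (hz0 : ∀ x, 0 ≤ z x)
    (hD : ∀ x, HasDerivAt D (D' x) x) (hD' : ∀ x, HasDerivAt D' (D'' x) x) (hD''c : Continuous D'')
    (hG : ∀ x, HasDerivAt G (G' x) x) (hG'c : Continuous G')
    (hGb : ∀ x ∈ Icc a b, 0 < D x → |G x| ≤ L * |D x| + η)
    (ha : z a * chi e (D a) = 0) (hb : z b * chi e (D b) = 0) :
    ∫ x in a..b, z x * chi e (D x) * (μ * D'' x - G' x) ≤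
      (∫ x in a..b, (- μ * (z' x * (chi e (D x) * D' x)) + z' x * chi e (D x) * G x))
        + (2 * L^2 * e + 2 * η^2 / e) / (4*μ) * ∫ x in a..b, z x := by
  have hzc : Continuous z := continuous_iff_continuousAt.2 fun x => (hz x).continuousAt
  have hDc : Continuous D := continuous_iff_continuousAt.2 fun x => (hD x).continuousAt
  have hD'c : Continuous D' := continuous_iff_continuousAt.2 fun x => (hD' x).continuousAt
  have hGc : Continuous G := continuous_iff_continuousAt.2 fun x => (hG x).continuousAt
  have hcc : Continuous fun x => chi e (D x) := (chi_continuous he).comp hDc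
  have hcc' : Continuous fun x => chi' e (D x) := (chi'_continuous he).comp hDc
  have hder : ∀ x ∈ uIcc a b, HasDerivAt (fun x => z x * chi e (D x) * (μ * D' x - G x))
      ((z' x * chi e (D x) + z x * (chi' e (D x) * D' x)) * (μ * D' x - G x)
        + z x * chi e (D x) * (μ * D'' x - G' x)) x := by
    intro x _
    exact ((hz x).mul ((chi_hasDerivAt he (D x)).comp x (hD x))).mul (((hD' x).const_mul μ).sub (hG x))
  have h1 := intervalIntegral.integral_eq_sub_of_hasDerivAt hder (by
    apply Continuous.intervalIntegrable; fun_prop)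
  rw [ha, hb] at h1
  rw [intervalIntegral.integral_add (by apply Continuous.intervalIntegrable; fun_prop)
    (by apply Continuous.intervalIntegrable; fun_prop)] at h1
  have h2 : ∫ x in a..b, z x * chi e (D x) * (μ * D'' x - G' x) =
     ∫ x in a..b, - ((z' x * chi e (D x) + z x * (chi' e (D x) * D' x)) * (μ * D' x - G x)) := by
    rw [intervalIntegral.integral_neg]; linarith
  rw [h2, ← intervalIntegral.integral_const_mul, ← intervalIntegral.integral_add
    (by apply Continuous.intervalIntegrable; fun_prop) (by apply Continuous.intervalIntegrable; fun_prop)]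
  apply intervalIntegral.integral_mono_on hab (by apply Continuous.intervalIntegrable; fun_prop)
    (by apply Continuous.intervalIntegrable; fun_prop)
  intro x hx
  have key : - (chi' e (D x) * D' x * (μ * D' x - G x)) ≤ (2 * L^2 * e + 2 * η^2 / e) / (4*μ) := by
    rw [le_div_iff₀ (by positivity)]
    have hn := chi'_nonneg e (D x)
    have k1 : - (chi' e (D x) * D' x * (μ * D' x - G x)) * (4*μ) ≤ chi' e (D x) * (G x)^2 := by
      nlinarith [mul_nonneg hn (sq_nonneg (2*μ*D' x - G x))]
    refine k1.trans ?_
    by_cases hDx : 0 < D x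
    · have g1 := hGb x hx hDx
      have g2 : (G x)^2 ≤ 2 * L^2 * (D x)^2 + 2 * η^2 := by
        have : (G x)^2 ≤ (L * |D x| + η)^2 := by
          rw [← sq_abs (G x)]; exact pow_le_pow_left₀ (abs_nonneg _) g1 2
        have h3 : |D x|^2 = (D x)^2 := sq_abs _
        nlinarith [sq_nonneg (L * |D x| - η)]
      calc chi' e (D x) * (G x)^2 ≤ chi' e (D x) * (2 * L^2 * (D x)^2 + 2 * η^2) := by gcongr
        _ = 2*L^2 * ((D x)^2 * chi' e (D x)) + 2 * η^2 * chi' e (D x) := by ring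
        _ ≤ 2*L^2 * e + 2 * η^2 * (1/e) := by
          gcongr
          · exact sq_mul_chi'_le he _
          · exact chi'_le he _
        _ = _ := by ring
    · have : chi' e (D x) = 0 := by unfold chi'; rw [max_eq_right (not_lt.1 hDx)]; simp
      rw [this]; simp only [zero_mul]; positivity
  have := mul_le_mul_of_nonneg_left key (hz0 x)
  nlinarith

theorem c2_deriv {U : ℝ → ℝ} (hU : ContDiff ℝ 2 U) : ContDiff ℝ 1 (deriv U) := by
  rw [← one_add_one_eq_two] at hU
  exact (contDiff_succ_iff_deriv.1 hU).2.2
theorem c2_hd {U : ℝ → ℝ} (hU : ContDiff ℝ 2 U) (x : ℝ) : HasDerivAt U (deriv U x) x :=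
  (hU.differentiable (by norm_num) x).hasDerivAt
theorem c2_hd2 {U : ℝ → ℝ} (hU : ContDiff ℝ 2 U) (x : ℝ) : HasDerivAt (deriv U) (deriv (deriv U) x) x :=
  ((c2_deriv hU).differentiable (by norm_num) x).hasDerivAt
theorem c2_cont2 {U : ℝ → ℝ} (hU : ContDiff ℝ 2 U) : Continuous (deriv (deriv U)) :=
  (c2_deriv hU).continuous_deriv le_rfl
theorem c2_cont1 {U : ℝ → ℝ} (hU : ContDiff ℝ 2 U) : Continuous (deriv U) := (c2_deriv hU).continuous

theorem ST0 {q : ℝ} (hq : 1 < q) {a b : ℝ} (hab : a ≤ b) {μ : ℝ} (hμ : 0 < μ) {U W : ℝ → ℝ}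
    (hU : ContDiff ℝ 2 U) (hW : ContDiff ℝ 2 W) (ha : U a ≤ W a) (hb : U b ≤ W b) :
    ∫ x in a..b, (if 0 < U x - W x then (1:ℝ) else 0) *
      (μ * (deriv (deriv U) x - deriv (deriv W) x)
        - (|U x|^(q-1) * deriv U x - |W x|^(q-1) * deriv W x)) ≤ 0 := by
  have hU1 : ∀ x, HasDerivAt U (deriv U x) x := fun x => (hU.differentiable (by norm_num) x).hasDerivAt
  have hW1 : ∀ x, HasDerivAt W (deriv W x) x := fun x => (hW.differentiable (by norm_num) x).hasDerivAt
  have hU' : ContDiff ℝ 1 (deriv U) := c2_deriv hU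
  have hW' : ContDiff ℝ 1 (deriv W) := c2_deriv hW
  have hU2 : ∀ x, HasDerivAt (deriv U) (deriv (deriv U) x) x :=
    fun x => (hU'.differentiable (by norm_num) x).hasDerivAt
  have hW2 : ∀ x, HasDerivAt (deriv W) (deriv (deriv W) x) x :=
    fun x => (hW'.differentiable (by norm_num) x).hasDerivAt
  have cU2 : Continuous (deriv (deriv U)) := hU'.continuous_deriv le_rfl
  have cW2 : Continuous (deriv (deriv W)) := hW'.continuous_deriv le_rfl
  have cU := hU.continuous
  have cW := hW.continuous
  have cU1 := hU'.continuous
  have cW1 := hW'.continuous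
  have cF := F_continuous hq
  have cFU : Continuous fun x => |U x|^(q-1) := cF.comp cU
  have cFW : Continuous fun x => |W x|^(q-1) := cF.comp cW
  obtain ⟨M1, hM1⟩ := isCompact_Icc (a := a) (b := b) |>.exists_bound_of_continuousOn cU.continuousOn
  obtain ⟨M2, hM2⟩ := isCompact_Icc (a := a) (b := b) |>.exists_bound_of_continuousOn cW.continuousOn
  set M := max M1 M2
  set L := M^(q-1)
  let e : ℕ → ℝ := fun n => 1/((n:ℝ)+1)
  have he0 : ∀ n, 0 < e n := fun n => by positivity
  have het : Tendsto e atTop (𝓝 0) := tendsto_one_div_add_atTop_nhds_zero_nat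
  have hb1 : ∀ n, ∫ x in a..b, chi (e n) (U x - W x) *
      (μ * (deriv (deriv U) x - deriv (deriv W) x)
        - (|U x|^(q-1) * deriv U x - |W x|^(q-1) * deriv W x)) ≤ (2*L^2*e n)/(4*μ) * (b-a) := by
    intro n
    have := ST (z := fun _ => 1) (z' := fun _ => 0) (D := fun x => U x - W x)
      (D' := fun x => deriv U x - deriv W x)
      (D'' := fun x => deriv (deriv U) x - deriv (deriv W) x)
      (G := fun x => Hf q (U x) - Hf q (W x))
      (G' := fun x => |U x|^(q-1) * deriv U x - |W x|^(q-1) * deriv W x)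
      hab hμ (he0 n) (L := L) (η := 0) (fun x => hasDerivAt_const x _) (by fun_prop) (by intro x; norm_num)
      (fun x => (hU1 x).sub (hW1 x)) (fun x => (hU2 x).sub (hW2 x)) (by fun_prop)
      (fun x => ((Hf_hasDerivAt hq (U x)).comp x (hU1 x)).sub ((Hf_hasDerivAt hq (W x)).comp x (hW1 x)))
      (by fun_prop) ?_ ?_ ?_
    · simpa using this
    · intro x hx _
      have := Hf_lip hq (M := M) ((hM1 x hx).trans (le_max_left _ _)) ((hM2 x hx).trans (le_max_right _ _))
      simpa using this
    · simp [chi_of_nonpos _ (sub_nonpos.2 ha)]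
    · simp [chi_of_nonpos _ (sub_nonpos.2 hb)]
  have hR : Tendsto (fun n => (2*L^2*e n)/(4*μ) * (b-a)) atTop (𝓝 0) := by
    have := ((het.const_mul (2*L^2)).div_const (4*μ)).mul_const (b-a)
    simpa using this
  refine le_of_tendsto_of_tendsto' (intervalIntegral.tendsto_integral_filter_of_dominated_convergence
    (fun x => |μ * (deriv (deriv U) x - deriv (deriv W) x)
        - (|U x|^(q-1) * deriv U x - |W x|^(q-1) * deriv W x)|) ?_ ?_ ?_ ?_) hR hb1
  · refine Eventually.of_forall fun n => ?_
    apply Continuous.aestronglyMeasurable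
    have := (chi_continuous (he0 n)).comp (cU.sub cW)
    simp only [Function.comp_def, Pi.sub_apply] at this
    fun_prop
  · refine Eventually.of_forall fun n => Eventually.of_forall fun x _ => ?_
    rw [Real.norm_eq_abs, abs_mul]
    exact mul_le_of_le_one_left (abs_nonneg _) (abs_chi_le _ _)
  · apply Continuous.intervalIntegrable; fun_prop
  · refine Eventually.of_forall fun x _ => ?_
    exact (chi_tendsto het _).mul_const _

end KS

namespace KS
open Set Topology

/-- Gaps of a closed subset of an interval. -/
abbrev Gap (K : Set ℝ) := {p : ℝ × ℝ // p.1 < p.2 ∧ p.1 ∈ K ∧ p.2 ∈ K ∧ Disjoint (Ioo p.1 p.2) K}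

theorem gap_disjoint (K : Set ℝ) : Pairwise (Function.onFun Disjoint fun p : Gap K => Ioo p.1.1 p.1.2) := by
  rintro ⟨⟨a, b⟩, h1, h2, h3, h4⟩ ⟨⟨a', b'⟩, h1', h2', h3', h4'⟩ hne
  rw [Function.onFun, Set.disjoint_left]
  rintro x ⟨hx1, hx2⟩ ⟨hx3, hx4⟩
  simp only at *
  apply hne
  rw [Set.disjoint_left] at h4 h4'
  have e1 : a = a' := by
    apply le_antisymm
    · by_contra h; push Not at h; exact h4' ⟨h, by linarith⟩ h2
    · by_contra h; push Not at h; exact h4 ⟨h, by linarith⟩ h2'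
  have e2 : b = b' := by
    apply le_antisymm
    · by_contra h; push Not at h; exact h4 ⟨by linarith, h⟩ h3'
    · by_contra h; push Not at h; exact h4' ⟨by linarith, h⟩ h3
  subst e1; subst e2; rfl

instance gap_countable (K : Set ℝ) : Countable (Gap K) := by
  apply Pairwise.countable_of_isOpen_disjoint (gap_disjoint K) (fun _ => isOpen_Ioo)
  intro p; exact nonempty_Ioo.2 p.2.1

theorem gap_iUnion {K : Set ℝ} (hK : IsClosed K) {t t' : ℝ} (hKs : K ⊆ Icc t t') (ht : t ∈ K) (ht' : t' ∈ K) :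
    (⋃ p : Gap K, Ioo p.1.1 p.1.2) = Ioc t t' \ K := by
  ext x
  simp only [mem_iUnion, Set.mem_sdiff]
  constructor
  · rintro ⟨⟨⟨a, b⟩, h1, h2, h3, h4⟩, hx⟩
    simp only at *
    exact ⟨⟨(hKs h2).1.trans_lt hx.1, hx.2.le.trans (hKs h3).2⟩, fun h => Set.disjoint_left.1 h4 hx h⟩
  · rintro ⟨hx, hxK⟩
    have c1 : IsClosed (K ∩ Iic x) := hK.inter isClosed_Iic
    have c2 : IsClosed (K ∩ Ici x) := hK.inter isClosed_Ici
    have n1 : (K ∩ Iic x).Nonempty := ⟨t, ht, hx.1.le⟩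
    have n2 : (K ∩ Ici x).Nonempty := ⟨t', ht', hx.2⟩
    have b1 : BddAbove (K ∩ Iic x) := ⟨x, fun y hy => hy.2⟩
    have b2 : BddBelow (K ∩ Ici x) := ⟨x, fun y hy => hy.2⟩
    have m1 := c1.csSup_mem n1 b1
    have m2 := c2.csInf_mem n2 b2
    have l1 : sSup (K ∩ Iic x) < x := lt_of_le_of_ne m1.2 (fun h => hxK (h ▸ m1.1))
    have l2 : x < sInf (K ∩ Ici x) := lt_of_le_of_ne m2.2 (fun h => hxK (h ▸ m2.1))
    refine ⟨⟨⟨sSup (K ∩ Iic x), sInf (K ∩ Ici x)⟩, l1.trans l2, m1.1, m2.1, ?_⟩, l1, l2⟩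
    rw [Set.disjoint_left]
    rintro y ⟨hy1, hy2⟩ hyK
    rcases le_total y x with h | h
    · exact absurd (le_csSup b1 ⟨hyK, h⟩) (not_le.2 hy1)
    · exact absurd (csInf_le b2 ⟨hyK, h⟩) (not_le.2 hy2)

theorem gap_len_summable {K : Set ℝ} (hK : IsClosed K) {t t' : ℝ} (hKs : K ⊆ Icc t t') (ht : t ∈ K) (ht' : t' ∈ K) :
    Summable (fun p : Gap K => p.1.2 - p.1.1) := by
  have := hasSum_integral_iUnion (μ := volume) (f := fun _ : ℝ => (1:ℝ)) (fun p : Gap K => measurableSet_Ioo) (gap_disjoint K)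
    (by rw [gap_iUnion hK hKs ht ht']
        apply IntegrableOn.mono_set (t := Ioc t t') _ sdiff_subset
        simp)
  refine this.summable.congr fun p => ?_
  have := p.2.1
  simp [this.le]

/-- FTC for the positive part -/
theorem ftc_pos {s s' : ℝ} (hs : s ≤ s') {d d' : ℝ → ℝ} (hd : ∀ τ ∈ Icc s s', HasDerivAt d (d' τ) τ)
    (hd' : ContinuousOn d' (Icc s s')) :
    IntervalIntegrable (fun τ => (if 0 < d τ then (1:ℝ) else 0) * d' τ) volume s s' ∧
    ∫ τ in s..s', (if 0 < d τ then (1:ℝ) else 0) * d' τ = max (d s') 0 - max (d s) 0 := by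
  have hdc : ContinuousOn d (Icc s s') := fun x hx => (hd x hx).continuousAt.continuousWithinAt
  let e : ℕ → ℝ := fun n => 1/((n:ℝ)+1)
  have he0 : ∀ n, 0 < e n := fun n => by positivity
  have het : Tendsto e atTop (𝓝 0) := tendsto_one_div_add_atTop_nhds_zero_nat
  have ii : IntervalIntegrable d' volume s s' := by
    apply ContinuousOn.intervalIntegrable; rwa [uIcc_of_le hs]
  have hcc : ∀ n, ContinuousOn (fun τ => chi (e n) (d τ) * d' τ) (Icc s s') := fun n =>
    ((chi_continuous (he0 n)).comp_continuousOn hdc).mul hd'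
  have hn : ∀ n, ∫ τ in s..s', chi (e n) (d τ) * d' τ = Phi (e n) (d s') - Phi (e n) (d s) := by
    intro n
    apply intervalIntegral.integral_eq_sub_of_hasDerivAt (f := fun τ => Phi (e n) (d τ))
    · intro x hx
      rw [uIcc_of_le hs] at hx
      exact (Phi_hasDerivAt (he0 n) (d x)).comp x (hd x hx)
    · apply ContinuousOn.intervalIntegrable; rw [uIcc_of_le hs]; exact hcc n
  have ms : ∀ n, AEStronglyMeasurable (fun τ => chi (e n) (d τ) * d' τ) (volume.restrict (uIoc s s')) := by
    intro n
    rw [uIoc_of_le hs]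
    exact ((hcc n).mono Ioc_subset_Icc_self).aestronglyMeasurable measurableSet_Ioc
  have lim : ∀ τ, Tendsto (fun n => chi (e n) (d τ) * d' τ) atTop (𝓝 ((if 0 < d τ then (1:ℝ) else 0) * d' τ)) :=
    fun τ => (chi_tendsto het _).mul_const _
  have h1 := intervalIntegral.tendsto_integral_filter_of_dominated_convergence (μ := volume) (a := s) (b := s')
    (F := fun n τ => chi (e n) (d τ) * d' τ) (f := fun τ => (if 0 < d τ then (1:ℝ) else 0) * d' τ) (l := atTop)
    (fun τ => |d' τ|) (Eventually.of_forall ms)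
    (Eventually.of_forall fun n => Eventually.of_forall fun x _ => by
      rw [Real.norm_eq_abs, abs_mul]
      exact mul_le_of_le_one_left (abs_nonneg _) (abs_chi_le _ _)) ii.abs
    (Eventually.of_forall fun x _ => lim x)
  constructor
  · apply ii.mono_fun
    · exact aestronglyMeasurable_of_tendsto_ae _ ms (Eventually.of_forall lim)
    · refine Eventually.of_forall fun x => ?_
      simp only [norm_mul]
      apply mul_le_of_le_one_left (norm_nonneg _)
      split_ifs <;> simp
  · refine tendsto_nhds_unique h1 ?_
    simp_rw [hn]
    exact (Phi_tendsto het he0 _).sub (Phi_tendsto het he0 _)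

structure Sol (q μ : ℝ) (u f : ℝ → ℝ → ℝ) : Prop where
  hq : 1 < q
  hμ : 0 < μ
  ui : ∀ t : ℝ, 0 < t → Integrable (u t)
  uc : ∀ t₀ : ℝ, 0 < t₀ → Tendsto (fun t => ∫ x, |u t x - u t₀ x|) (𝓝 t₀) (𝓝 0)
  fi : ∀ t : ℝ, 0 < t → Integrable (f t)
  fc : ∀ t₀ : ℝ, 0 < t₀ → Tendsto (fun t => ∫ x, |f t x - f t₀ x|) (𝓝 t₀) (𝓝 0)
  ux : ∀ t : ℝ, 0 < t → ContDiff ℝ 2 (u t)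
  ut : ∀ x : ℝ, ContDiffOn ℝ 1 (fun s => u s x) (Set.Ioi 0)
  pde : ∀ t : ℝ, 0 < t → ∀ x : ℝ, deriv (fun s => u s x) t =
    - (|u t x| ^ (q - 1) * deriv (u t) x) + μ * deriv (deriv (u t)) x + f t x

noncomputable def gt (u : ℝ → ℝ → ℝ) (t x : ℝ) : ℝ := deriv (fun s => u s x) t

theorem Sol.neg {q μ : ℝ} {u f : ℝ → ℝ → ℝ} (h : Sol q μ u f) :
    Sol q μ (fun t x => - u t x) (fun t x => - f t x) where
  hq := h.hq
  hμ := h.hμ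
  ui t ht := (h.ui t ht).neg
  uc t ht := by
    have := h.uc t ht
    refine this.congr fun s => integral_congr_ae (Eventually.of_forall fun x => ?_)
    simp only; rw [← abs_neg]; ring_nf
  fi t ht := (h.fi t ht).neg
  fc t ht := by
    have := h.fc t ht
    refine this.congr fun s => integral_congr_ae (Eventually.of_forall fun x => ?_)
    simp only; rw [← abs_neg]; ring_nf
  ux t ht := (h.ux t ht).neg
  ut x := (h.ut x).neg
  pde t ht x := by
    have := h.pde t ht x
    have e1 : deriv (fun x => - u t x) = fun x => - deriv (u t) x := by
      ext y; exact deriv.fun_neg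
    rw [e1, deriv.fun_neg, deriv.fun_neg, this, abs_neg]; ring

section
variable {q μ : ℝ} {u f : ℝ → ℝ → ℝ} 

theorem Sol.hd (h : Sol q μ u f) {t : ℝ} (ht : 0 < t) (x : ℝ) : HasDerivAt (fun s => u s x) (gt u t x) t := by
  have := ((h.ut x).differentiableOn (by norm_num)).differentiableAt (Ioi_mem_nhds ht)
  exact this.hasDerivAt

theorem Sol.gc (h : Sol q μ u f) (x : ℝ) : ContinuousOn (fun t => gt u t x) (Ioi 0) :=
  (h.ut x).continuousOn_deriv_of_isOpen isOpen_Ioi (by norm_num)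

theorem Sol.uct (h : Sol q μ u f) (x : ℝ) : ContinuousOn (fun t => u t x) (Ioi 0) := (h.ut x).continuousOn

theorem Sol.gmeas (h : Sol q μ u f) {t : ℝ} (ht : 0 < t) : Measurable (gt u t) := by
  have := measurable_of_tendsto_metrizable (f := fun (n : ℕ) x => ((1:ℝ)/((n:ℝ)+1))⁻¹ * (u (t + 1/((n:ℝ)+1)) x - u t x))
    (g := gt u t) ?_ ?_
  · exact this
  · intro n
    have h1 := (h.ux (t+1/((n:ℝ)+1)) (by positivity)).continuous.measurable
    have h2 := (h.ux t ht).continuous.measurable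
    fun_prop
  · rw [tendsto_pi_nhds]
    intro x
    have h1 := (h.hd ht x).tendsto_slope_zero
    have h2 : Tendsto (fun n : ℕ => (1:ℝ)/((n:ℝ)+1)) atTop (𝓝[≠] 0) := by
      apply tendsto_nhdsWithin_of_tendsto_nhds_of_eventually_within _ tendsto_one_div_add_atTop_nhds_zero_nat
      refine Eventually.of_forall fun n => ?_
      have : (0:ℝ) < 1/((n:ℝ)+1) := by positivity
      exact this.ne'
    have := h1.comp h2
    simpa [Function.comp_def] using this

theorem Sol.umeas2 (h : Sol q μ u f) {t : ℝ} (ht : 0 < t) :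
    Measurable (Function.uncurry fun τ x => u (max τ t) x) := by
  apply measurable_uncurry_of_continuous_of_measurable
  · intro x
    exact (h.uct x).comp_continuous (by fun_prop) (fun τ => lt_of_lt_of_le ht (le_max_right _ _))
  · intro τ; exact (h.ux _ (lt_of_lt_of_le ht (le_max_right _ _))).continuous.measurable

theorem Sol.gmeas2 (h : Sol q μ u f) {t : ℝ} (ht : 0 < t) :
    Measurable (Function.uncurry fun τ x => gt u (max τ t) x) := by
  apply measurable_uncurry_of_continuous_of_measurable
  · intro x
    exact (h.gc x).comp_continuous (by fun_prop) (fun τ => lt_of_lt_of_le ht (le_max_right _ _))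
  · intro τ; exact h.gmeas (lt_of_lt_of_le ht (le_max_right _ _))

theorem Sol.gint (h : Sol q μ u f) {t : ℝ} (ht : 0 < t) (R : ℝ) :
    IntegrableOn (gt u t) (Ioc (-R) R) := by
  have e : gt u t = fun x => (- (|u t x| ^ (q - 1) * deriv (u t) x) + μ * deriv (deriv (u t)) x) + f t x := by
    ext x; exact h.pde t ht x
  rw [e]
  apply Integrable.add _ (h.fi t ht).integrableOn
  have c0 := (h.ux t ht).continuous
  have c1 := c2_cont1 (h.ux t ht)
  have c2 := c2_cont2 (h.ux t ht)
  have cF : Continuous fun x => |u t x|^(q-1) := (F_continuous h.hq).comp c0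
  have : Continuous (fun x => - (|u t x| ^ (q - 1) * deriv (u t) x) + μ * deriv (deriv (u t)) x) := by fun_prop
  exact (this.integrableOn_Icc (a := -R) (b := R)).mono_set Ioc_subset_Icc_self

end

end KS

namespace KS
open Set Topology

/-- local L1 continuity of a family -/
structure LC (R : ℝ) (v : ℝ → ℝ → ℝ) : Prop where
  i : ∀ t : ℝ, 0 < t → IntegrableOn (v t) (Ioc (-R) R)
  c : ∀ t₀ : ℝ, 0 < t₀ → Tendsto (fun t => ∫ x in Ioc (-R) R, |v t x - v t₀ x|) (𝓝 t₀) (𝓝 0)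

theorem LC.of_global {R : ℝ} {v : ℝ → ℝ → ℝ} (hi : ∀ t : ℝ, 0 < t → Integrable (v t))
    (hc : ∀ t₀ : ℝ, 0 < t₀ → Tendsto (fun t => ∫ x, |v t x - v t₀ x|) (𝓝 t₀) (𝓝 0)) : LC R v where
  i t ht := (hi t ht).integrableOn
  c t₀ ht := by
    refine tendsto_of_tendsto_of_tendsto_of_le_of_le' tendsto_const_nhds (hc t₀ ht) ?_ ?_
    · exact Eventually.of_forall fun t => integral_nonneg fun x => abs_nonneg _
    · filter_upwards [Ioi_mem_nhds ht] with t ht'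
      exact setIntegral_le_integral ((hi t ht').sub (hi t₀ ht)).abs (Eventually.of_forall fun x => abs_nonneg _)

theorem LC.of_cont {R : ℝ} (hR : 0 < R) {v : ℝ → ℝ → ℝ} (hv : Continuous (Function.uncurry v)) : LC R v where
  i t ht := by
    have : Continuous (v t) := hv.comp (by fun_prop : Continuous fun x => (t, x))
    exact (this.integrableOn_Icc (a := -R) (b := R)).mono_set Ioc_subset_Icc_self
  c t₀ ht := by
    have h1 : Continuous (Function.uncurry fun t x => |v t x - v t₀ x|) := by
      have a1 : Continuous fun p : ℝ × ℝ => v p.1 p.2 := hv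
      have a2 : Continuous fun p : ℝ × ℝ => v t₀ p.2 := hv.comp (by fun_prop : Continuous fun p : ℝ × ℝ => (t₀, p.2))
      exact (a1.sub a2).abs
    have h2 := (intervalIntegral.continuous_parametric_intervalIntegral_of_continuous' (μ := volume) h1 (-R) R).tendsto t₀
    simp only [intervalIntegral.integral_of_le (by linarith : -R ≤ R)] at h2
    simpa using h2

theorem LC.add {R : ℝ} {v w : ℝ → ℝ → ℝ} (hv : LC R v) (hw : LC R w) : LC R (fun t x => v t x + w t x) where
  i t ht := (hv.i t ht).add (hw.i t ht)
  c t₀ ht := by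
    have := (hv.c t₀ ht).add (hw.c t₀ ht)
    rw [add_zero] at this
    refine tendsto_of_tendsto_of_tendsto_of_le_of_le' tendsto_const_nhds this ?_ ?_
    · exact Eventually.of_forall fun t => integral_nonneg fun x => abs_nonneg _
    · filter_upwards [Ioi_mem_nhds ht] with t ht'
      have i1 : Integrable (fun x => |v t x - v t₀ x|) (volume.restrict (Ioc (-R) R)) := ((hv.i t ht').sub (hv.i t₀ ht)).abs
      have i2 : Integrable (fun x => |w t x - w t₀ x|) (volume.restrict (Ioc (-R) R)) := ((hw.i t ht').sub (hw.i t₀ ht)).abs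
      rw [← integral_add i1 i2]
      apply integral_mono_of_nonneg (Eventually.of_forall fun x => abs_nonneg _) (i1.add i2)
      refine Eventually.of_forall fun x => ?_
      simp only [Pi.add_apply, Pi.sub_apply]
      have : v t x + w t x - (v t₀ x + w t₀ x) = (v t x - v t₀ x) + (w t x - w t₀ x) := by ring
      rw [this]; exact abs_add_le _ _

theorem lip_int {ν : Measure ℝ} {P : ℝ → ℝ} (hP : ∀ a b, |P a - P b| ≤ |a - b|) (hP0 : P 0 = 0)
    {v : ℝ → ℝ} (hv : Integrable v ν) : Integrable (fun x => P (v x)) ν := by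
  have hc : Continuous P := by
    have : LipschitzWith 1 P := LipschitzWith.of_dist_le_mul fun a b => by
      simpa [Real.dist_eq] using hP a b
    exact this.continuous
  refine hv.mono (hc.comp_aestronglyMeasurable hv.1) (Eventually.of_forall fun x => ?_)
  have := hP (v x) 0
  simpa [hP0] using this

theorem LC.tendsto {R : ℝ} {v : ℝ → ℝ → ℝ} (hv : LC R v) {P : ℝ → ℝ} (hP : ∀ a b, |P a - P b| ≤ |a - b|)
    (hP0 : P 0 = 0) : ContinuousOn (fun t => ∫ x in Ioc (-R) R, P (v t x)) (Ioi 0) := by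
  intro t₀ ht
  apply ContinuousAt.continuousWithinAt
  rw [ContinuousAt, tendsto_iff_dist_tendsto_zero]
  refine tendsto_of_tendsto_of_tendsto_of_le_of_le' tendsto_const_nhds (hv.c t₀ ht) ?_ ?_
  · exact Eventually.of_forall fun t => dist_nonneg
  · filter_upwards [Ioi_mem_nhds ht] with t ht'
    rw [Real.dist_eq, ← integral_sub (lip_int hP hP0 (hv.i t ht')) (lip_int hP hP0 (hv.i t₀ ht))]
    refine (abs_integral_le_integral_abs).trans ?_
    apply integral_mono_of_nonneg (Eventually.of_forall fun x => abs_nonneg _) ((hv.i t ht').sub (hv.i t₀ ht)).abs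
    exact Eventually.of_forall fun x => hP _ _

theorem max_lip (a b : ℝ) : |max a 0 - max b 0| ≤ |a - b| := abs_max_sub_max_le_abs a b 0

noncomputable def dd (u : ℝ → ℝ → ℝ) (w0 w1 : ℝ → ℝ) (τ x : ℝ) : ℝ := u τ x + (- w0 x - τ * w1 x)
noncomputable def NN (R : ℝ) (u : ℝ → ℝ → ℝ) (w0 w1 : ℝ → ℝ) (τ : ℝ) : ℝ :=
  ∫ x in Ioc (-R) R, max (dd u w0 w1 τ x) 0
noncomputable def mm (q μ : ℝ) (w0 w1 : ℝ → ℝ) (τ x : ℝ) : ℝ :=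
  - w1 x + μ * (deriv (deriv w0) x + τ * deriv (deriv w1) x)
    - |w0 x + τ * w1 x|^(q-1) * (deriv w0 x + τ * deriv w1 x)
noncomputable def rho (q μ R : ℝ) (f : ℝ → ℝ → ℝ) (w0 w1 : ℝ → ℝ) (τ : ℝ) : ℝ :=
  ∫ x in Ioc (-R) R, |f τ x + mm q μ w0 w1 τ x|

section
variable {q μ R : ℝ} {u f : ℝ → ℝ → ℝ}

theorem mm_cont (hq : 1 < q) {w0 w1 : ℝ → ℝ} (h0 : ContDiff ℝ 2 w0) (h1 : ContDiff ℝ 2 w1) :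
    Continuous (Function.uncurry (mm q μ w0 w1)) := by
  have a0 := h0.continuous
  have a1 := c2_cont1 h0
  have a2 := c2_cont2 h0
  have b0 := h1.continuous
  have b1 := c2_cont1 h1
  have b2 := c2_cont2 h1
  have : Continuous fun p : ℝ × ℝ => |w0 p.2 + p.1 * w1 p.2|^(q-1) :=
    (F_continuous hq).comp (by fun_prop : Continuous fun p : ℝ × ℝ => w0 p.2 + p.1 * w1 p.2)
  unfold mm Function.uncurry
  fun_prop

theorem Sol.LCd (h : Sol q μ u f) (hR : 0 < R) {w0 w1 : ℝ → ℝ} (h0 : ContDiff ℝ 2 w0) (h1 : ContDiff ℝ 2 w1) :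
    LC R (dd u w0 w1) := by
  have a0 := h0.continuous
  have b0 := h1.continuous
  exact (LC.of_global h.ui h.uc).add (LC.of_cont hR (v := fun τ x => - w0 x - τ * w1 x)
    (by unfold Function.uncurry; fun_prop))

theorem Sol.LCr (h : Sol q μ u f) (hR : 0 < R) {w0 w1 : ℝ → ℝ} (h0 : ContDiff ℝ 2 w0) (h1 : ContDiff ℝ 2 w1) :
    LC R (fun τ x => f τ x + mm q μ w0 w1 τ x) :=
  (LC.of_global h.fi h.fc).add (LC.of_cont hR (mm_cont h.hq h0 h1))

theorem Sol.NN_cont (h : Sol q μ u f) (hR : 0 < R) {w0 w1 : ℝ → ℝ} (h0 : ContDiff ℝ 2 w0) (h1 : ContDiff ℝ 2 w1) :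
    ContinuousOn (NN R u w0 w1) (Ioi 0) :=
  (h.LCd hR h0 h1).tendsto (P := fun r => max r 0) max_lip (by simp)

theorem Sol.rho_cont (h : Sol q μ u f) (hR : 0 < R) {w0 w1 : ℝ → ℝ} (h0 : ContDiff ℝ 2 w0) (h1 : ContDiff ℝ 2 w1) :
    ContinuousOn (rho q μ R f w0 w1) (Ioi 0) :=
  (h.LCr hR h0 h1).tendsto (P := fun r => |r|) abs_abs_sub_abs_le_abs_sub (by simp)

theorem Sol.rho_ii (h : Sol q μ u f) (hR : 0 < R) {w0 w1 : ℝ → ℝ} (h0 : ContDiff ℝ 2 w0) (h1 : ContDiff ℝ 2 w1)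
    {a b : ℝ} (ha : 0 < a) (hb : 0 < b) : IntervalIntegrable (rho q μ R f w0 w1) volume a b := by
  apply ContinuousOn.intervalIntegrable
  apply (h.rho_cont hR h0 h1).mono
  intro x hx
  exact lt_of_lt_of_le (lt_min ha hb) hx.1

/-- boundary condition -/
def BC (R : ℝ) (u : ℝ → ℝ → ℝ) (w0 w1 : ℝ → ℝ) (s s' : ℝ) : Prop :=
  ∀ τ ∈ Icc s s', u τ R ≤ w0 R + τ * w1 R ∧ u τ (-R) ≤ w0 (-R) + τ * w1 (-R)

/-- comparison inequality with time-affine functions -/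
def Cmp (q μ R : ℝ) (u f : ℝ → ℝ → ℝ) (s s' : ℝ) : Prop :=
  ∀ w0 w1 : ℝ → ℝ, ContDiff ℝ 2 w0 → ContDiff ℝ 2 w1 → BC R u w0 w1 s s' →
    NN R u w0 w1 s' - NN R u w0 w1 s ≤ ∫ τ in s..s', rho q μ R f w0 w1 τ

theorem Cmp.refl (s : ℝ) : Cmp q μ R u f s s := by
  intro w0 w1 _ _ _; simp

theorem Cmp.trans (h : Sol q μ u f) (hR : 0 < R) {a b c : ℝ} (ha : 0 < a) (hab : a ≤ b) (hbc : b ≤ c)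
    (h1 : Cmp q μ R u f a b) (h2 : Cmp q μ R u f b c) : Cmp q μ R u f a c := by
  intro w0 w1 hw0 hw1 hb
  have e1 := h1 w0 w1 hw0 hw1 (fun τ hτ => hb τ ⟨hτ.1, hτ.2.trans hbc⟩)
  have e2 := h2 w0 w1 hw0 hw1 (fun τ hτ => hb τ ⟨hab.trans hτ.1, hτ.2⟩)
  rw [← intervalIntegral.integral_add_adjacent_intervals (h.rho_ii hR hw0 hw1 ha (ha.trans_le hab))
    (h.rho_ii hR hw0 hw1 (ha.trans_le hab) (ha.trans_le (hab.trans hbc)))]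
  linarith

theorem Sol.psi_cont (h : Sol q μ u f) (hR : 0 < R) {w0 w1 : ℝ → ℝ} (h0 : ContDiff ℝ 2 w0) (h1 : ContDiff ℝ 2 w1)
    {s s' : ℝ} (hs : 0 < s) (hss : s ≤ s') :
    ContinuousOn (fun τ => NN R u w0 w1 τ - ∫ r in s..τ, rho q μ R f w0 w1 r) (Icc s s') := by
  have sub : Icc s s' ⊆ Ioi 0 := fun x hx => hs.trans_le hx.1
  apply ((h.NN_cont hR h0 h1).mono sub).sub
  have := intervalIntegral.continuousOn_primitive_interval (μ := volume) (f := rho q μ R f w0 w1) (a := s) (b := s')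
    (by rw [uIcc_of_le hss]; exact ((h.rho_cont hR h0 h1).mono sub).integrableOn_Icc)
  rwa [uIcc_of_le hss] at this

theorem Cmp.of_local (h : Sol q μ u f) (hR : 0 < R) {s s' : ℝ} (hs : 0 < s) (hss : s ≤ s')
    (hl : ∀ τ ∈ Icc s s', ∃ δ > 0, ∀ a b, a ≤ b → τ ≤ a → b < τ + δ → b ≤ s' → Cmp q μ R u f a b) :
    Cmp q μ R u f s s' := by
  intro w0 w1 hw0 hw1 hbc
  set ψ : ℝ → ℝ := fun τ => NN R u w0 w1 τ - ∫ r in s..τ, rho q μ R f w0 w1 r with hψ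
  have hc : ContinuousOn ψ (Icc s s') := h.psi_cont hR hw0 hw1 hs hss
  have key : Icc s s' ⊆ {τ | s' < τ ∨ ψ τ ≤ ψ s} := by
    apply IsClosed.Icc_subset_of_forall_mem_nhdsWithin
    · have : {τ | s' < τ ∨ ψ τ ≤ ψ s} ∩ Icc s s' = {τ ∈ Icc s s' | ψ τ ≤ ψ s} := by
        ext x; simp only [mem_inter_iff, mem_ofPred_eq, mem_Icc]
        constructor
        · rintro ⟨h1 | h1, h2⟩
          · exact absurd h2.2 (not_le.2 h1)
          · exact ⟨h2, h1⟩
        · rintro ⟨h1, h2⟩; exact ⟨Or.inr h2, h1⟩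
      rw [this]
      exact hc.preimage_isClosed_of_isClosed isClosed_Icc isClosed_Iic
    · right; exact le_rfl
    · rintro x ⟨hx, hx2⟩
      obtain ⟨δ, hδ, H⟩ := hl x ⟨hx2.1, hx2.2.le⟩
      have hx1 : ψ x ≤ ψ s := hx.resolve_left (not_lt.2 hx2.2.le)
      have : Ioo x (x+δ) ∈ 𝓝[>] x := Ioo_mem_nhdsGT (by linarith)
      filter_upwards [this] with y hy
      rcases lt_or_ge s' y with hy' | hy'
      · left; exact hy'
      right
      have e := H x y hy.1.le le_rfl hy.2 hy' w0 w1 hw0 hw1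
        (fun τ hτ => hbc τ ⟨hx2.1.trans hτ.1, hτ.2.trans hy'⟩)
      have hx0 : 0 < x := hs.trans_le hx2.1
      have e2 := intervalIntegral.integral_add_adjacent_intervals (h.rho_ii hR hw0 hw1 hs hx0)
        (h.rho_ii hR hw0 hw1 hx0 (hx0.trans hy.1))
      have : ψ y ≤ ψ x := by simp only [hψ]; linarith
      exact this.trans hx1
  have := (key (right_mem_Icc.2 hss)).resolve_left (lt_irrefl _)
  simp only [hψ, intervalIntegral.integral_same] at this
  linarith

theorem Cmp.of_Ioo (h : Sol q μ u f) (hR : 0 < R) {s s' : ℝ} (hs : 0 < s) (hss : s < s')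
    (hl : ∀ a b, s < a → a ≤ b → b < s' → Cmp q μ R u f a b) :
    Cmp q μ R u f s s' := by
  intro w0 w1 hw0 hw1 hbc
  set ψ : ℝ → ℝ := fun τ => NN R u w0 w1 τ - ∫ r in s..τ, rho q μ R f w0 w1 r with hψ
  have hc : ContinuousOn ψ (Icc s s') := h.psi_cont hR hw0 hw1 hs hss.le
  have mono : ∀ a b, s < a → a ≤ b → b < s' → ψ b ≤ ψ a := by
    intro a b ha hab hb
    have e := hl a b ha hab hb w0 w1 hw0 hw1 (fun τ hτ => hbc τ ⟨ha.le.trans hτ.1, hτ.2.trans hb.le⟩)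
    have e2 := intervalIntegral.integral_add_adjacent_intervals (h.rho_ii hR hw0 hw1 hs (hs.trans ha))
        (h.rho_ii hR hw0 hw1 (hs.trans ha) ((hs.trans ha).trans_le hab))
    simp only [hψ]; linarith
  have m : (s+s')/2 ∈ Ioo s s' := by constructor <;> linarith
  have k1 : ψ s' ≤ ψ ((s+s')/2) := by
    have t1 : Tendsto ψ (𝓝[<] s') (𝓝 (ψ s')) :=
      ((hc s' (right_mem_Icc.2 hss.le)).mono_left (nhdsWithin_le_of_mem (Icc_mem_nhdsLT hss)))
    refine le_of_tendsto t1 ?_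
    filter_upwards [Ioo_mem_nhdsLT m.2] with b hb
    exact mono _ _ m.1 hb.1.le hb.2
  have k2 : ψ ((s+s')/2) ≤ ψ s := by
    have t1 : Tendsto ψ (𝓝[>] s) (𝓝 (ψ s)) :=
      ((hc s (left_mem_Icc.2 hss.le)).mono_left (nhdsWithin_le_of_mem (Icc_mem_nhdsGT hss)))
    refine ge_of_tendsto t1 ?_
    filter_upwards [Ioo_mem_nhdsGT m.1] with b hb
    exact mono _ _ hb.1 hb.2.le m.2
  have := k1.trans k2
  simp only [hψ, intervalIntegral.integral_same] at this
  linarith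

/-- the pointwise-in-time inequality -/
theorem Sol.step (h : Sol q μ u f) (hR : 0 < R) {w0 w1 : ℝ → ℝ} (h0 : ContDiff ℝ 2 w0) (h1 : ContDiff ℝ 2 w1)
    {τ : ℝ} (hτ : 0 < τ) (hb : u τ R ≤ w0 R + τ * w1 R ∧ u τ (-R) ≤ w0 (-R) + τ * w1 (-R)) :
    IntegrableOn (fun x => (if 0 < dd u w0 w1 τ x then (1:ℝ) else 0) * (gt u τ x - w1 x)) (Ioc (-R) R) ∧
    ∫ x in Ioc (-R) R, (if 0 < dd u w0 w1 τ x then (1:ℝ) else 0) * (gt u τ x - w1 x) ≤ rho q μ R f w0 w1 τ := by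
  set W : ℝ → ℝ := fun x => w0 x + τ * w1 x with hW
  have hW2 : ContDiff ℝ 2 W := h0.add (contDiff_const.mul h1)
  have hU := h.ux τ hτ
  have d1 : deriv W = fun x => deriv w0 x + τ * deriv w1 x := by
    ext x; exact ((c2_hd h0 x).add ((c2_hd h1 x).const_mul τ)).deriv
  have d2 : deriv (deriv W) = fun x => deriv (deriv w0) x + τ * deriv (deriv w1) x := by
    rw [d1]; ext x; exact ((c2_hd2 h0 x).add ((c2_hd2 h1 x).const_mul τ)).deriv
  have s0 := ST0 h.hq (by linarith : -R ≤ R) h.hμ hU hW2 hb.2 hb.1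
  rw [intervalIntegral.integral_of_le (by linarith : -R ≤ R)] at s0
  have ind : ∀ x, (if 0 < dd u w0 w1 τ x then (1:ℝ) else 0) = if 0 < u τ x - W x then (1:ℝ) else 0 := by
    intro x; unfold dd; simp only [hW]; congr 2; ring
  have cU := hU.continuous
  have cU1 := c2_cont1 hU
  have cU2 := c2_cont2 hU
  have cW := hW2.continuous
  have cW1 := c2_cont1 hW2
  have cW2 := c2_cont2 hW2
  have cFU : Continuous fun x => |u τ x|^(q-1) := (F_continuous h.hq).comp cU
  have cFW : Continuous fun x => |W x|^(q-1) := (F_continuous h.hq).comp cW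
  have mi : Measurable fun x => (if 0 < u τ x - W x then (1:ℝ) else 0) := by
    apply Measurable.ite _ measurable_const measurable_const
    exact measurableSet_lt measurable_const (cU.sub cW).measurable
  have bi : ∀ x, ‖(if 0 < u τ x - W x then (1:ℝ) else 0)‖ ≤ 1 := by intro x; split_ifs <;> simp
  have iA : IntegrableOn (fun x => (if 0 < u τ x - W x then (1:ℝ) else 0) *
      (μ * (deriv (deriv (u τ)) x - deriv (deriv W) x)
        - (|u τ x|^(q-1) * deriv (u τ) x - |W x|^(q-1) * deriv W x))) (Ioc (-R) R) := by
    apply Integrable.bdd_mul (c := 1) _ mi.aestronglyMeasurable (Eventually.of_forall bi)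
    refine IntegrableOn.mono_set (t := Icc (-R) R) ?_ Ioc_subset_Icc_self
    apply Continuous.integrableOn_Icc; fun_prop
  have iB0 := (h.LCr hR h0 h1).i τ hτ
  have iB : IntegrableOn (fun x => (if 0 < u τ x - W x then (1:ℝ) else 0) * (f τ x + mm q μ w0 w1 τ x)) (Ioc (-R) R) :=
    Integrable.bdd_mul (c := 1) iB0 mi.aestronglyMeasurable (Eventually.of_forall bi)
  have e : (fun x => (if 0 < dd u w0 w1 τ x then (1:ℝ) else 0) * (gt u τ x - w1 x)) =
     fun x => ((if 0 < u τ x - W x then (1:ℝ) else 0) *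
      (μ * (deriv (deriv (u τ)) x - deriv (deriv W) x)
        - (|u τ x|^(q-1) * deriv (u τ) x - |W x|^(q-1) * deriv W x)))
      + (if 0 < u τ x - W x then (1:ℝ) else 0) * (f τ x + mm q μ w0 w1 τ x) := by
    ext x
    have p : gt u τ x = _ := h.pde τ hτ x
    rw [ind, ← mul_add, p, d2, d1]
    unfold mm
    simp only [hW]
    ring
  rw [e]
  refine ⟨iA.add iB, ?_⟩
  rw [integral_add iA iB]
  have : ∫ x in Ioc (-R) R, (if 0 < u τ x - W x then (1:ℝ) else 0) * (f τ x + mm q μ w0 w1 τ x) ≤ rho q μ R f w0 w1 τ := by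
    apply integral_mono iB iB0.abs
    intro x
    simp only
    split_ifs
    · simpa using le_abs_self _
    · simp
  linarith

end
end KS

namespace KS
open Set Topology

section
variable {q μ R : ℝ} {u f : ℝ → ℝ → ℝ}

/-- crossing a closed set of times on which we have uniform bounds -/
theorem Cmp.cross (h : Sol q μ u f) (hR : 0 < R) {K : Set ℝ} (hK : IsClosed K) {t t' : ℝ} (ht0 : 0 < t) (htt : t < t')
    (hKs : K ⊆ Icc t t') (ht : t ∈ K) (ht' : t' ∈ K) {M n : ℝ}
    (hM : ∀ p : Gap K, ∫ x in Ioc (-R) R, |u p.1.2 x - u p.1.1 x| ≤ M * (p.1.2 - p.1.1))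
    (hn : ∀ τ ∈ K, ∫ x in Ioc (-R) R, |gt u τ x| ≤ n)
    (hC : ∀ p : Gap K, Cmp q μ R u f p.1.1 p.1.2) : Cmp q μ R u f t t' := by
  intro w0 w1 hw0 hw1 hbc
  set ν := volume.restrict (Ioc (-R) R) with hν
  set K' := Ioc t t' ∩ K with hK'
  have mK' : MeasurableSet K' := measurableSet_Ioc.inter hK.measurableSet
  have K'pos : ∀ τ ∈ K', 0 < τ := fun τ hτ => ht0.trans hτ.1.1
  have gpos : ∀ p : Gap K, 0 < p.1.1 := fun p => ht0.trans_le (hKs p.2.2.1).1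
  have gpos2 : ∀ p : Gap K, 0 < p.1.2 := fun p => (gpos p).trans p.2.1
  have cw0 := hw0.continuous
  have cw1 := hw1.continuous
  set m : ℝ → ℝ → ℝ := fun τ x => (if 0 < dd u w0 w1 τ x then (1:ℝ) else 0) * (gt u τ x - w1 x) with hm
  -- joint measurability
  have hmeas : Measurable (Function.uncurry fun τ x => m (max τ t) x) := by
    have a1 := h.umeas2 ht0
    have a2 := h.gmeas2 ht0
    have mw0 := cw0.measurable
    have mw1 := cw1.measurable
    have a3 : Measurable (fun p : ℝ × ℝ => dd u w0 w1 (max p.1 t) p.2) := by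
      unfold dd
      have b1 : Measurable fun p : ℝ × ℝ => u (max p.1 t) p.2 := a1
      have b2 : Measurable fun p : ℝ × ℝ => - w0 p.2 - max p.1 t * w1 p.2 := by fun_prop
      exact b1.add b2
    have a4 : Measurable (fun p : ℝ × ℝ => gt u (max p.1 t) p.2 - w1 p.2) := by
      have b1 : Measurable fun p : ℝ × ℝ => gt u (max p.1 t) p.2 := a2
      exact b1.sub (mw1.comp measurable_snd)
    have a5 : Measurable (fun p : ℝ × ℝ => if 0 < dd u w0 w1 (max p.1 t) p.2 then (1:ℝ) else 0) :=
      Measurable.ite (measurableSet_lt measurable_const a3) measurable_const measurable_const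
    exact a5.mul a4
  have iw1 : Integrable w1 ν := (cw1.integrableOn_Icc (a := -R) (b := R)).mono_set Ioc_subset_Icc_self
  have mx : ∀ τ ∈ K', max τ t = τ := fun τ hτ => max_eq_left hτ.1.1.le
  -- integrability on the product
  have hintg : Integrable (Function.uncurry fun τ x => m (max τ t) x) ((volume.restrict K').prod ν) := by
    rw [integrable_prod_iff hmeas.aestronglyMeasurable]
    constructor
    · filter_upwards [ae_restrict_mem mK'] with τ hτ
      simp only [Function.uncurry, mx τ hτ]
      exact (h.step hR hw0 hw1 (K'pos τ hτ) (hbc τ ⟨hτ.1.1.le, hτ.1.2⟩)).1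
    · have : IsFiniteMeasure (volume.restrict K') := ⟨by
        rw [Measure.restrict_apply_univ]
        exact (measure_mono inter_subset_left).trans_lt (by simp)⟩
      refine Integrable.of_bound (C := n + ∫ x, |w1 x| ∂ν)
        (hmeas.aestronglyMeasurable.norm.integral_prod_right') ?_
      filter_upwards [ae_restrict_mem mK'] with τ hτ
      have ig : Integrable (gt u τ) ν := h.gint (K'pos τ hτ) R
      rw [Real.norm_eq_abs, abs_of_nonneg (integral_nonneg fun x => norm_nonneg _)]
      have h1 : ∫ x, ‖Function.uncurry (fun τ x => m (max τ t) x) (τ, x)‖ ∂ν ≤ ∫ x, (|gt u τ x| + |w1 x|) ∂ν := by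
        apply integral_mono_of_nonneg (Eventually.of_forall fun x => norm_nonneg _) (ig.abs.add iw1.abs)
        refine Eventually.of_forall fun x => ?_
        simp only [Function.uncurry, mx τ hτ, hm, norm_mul, Real.norm_eq_abs]
        have : |(if 0 < dd u w0 w1 τ x then (1:ℝ) else 0)| ≤ 1 := by split_ifs <;> simp
        exact (mul_le_of_le_one_left (abs_nonneg _) this).trans (abs_sub _ _)
      rw [integral_add ig.abs iw1.abs] at h1
      linarith [hn τ hτ.2]
  -- pointwise identity
  have ftc : ∀ x, ∀ a b, 0 < a → a ≤ b → IntegrableOn (fun τ => m τ x) (Ioc a b) ∧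
      ∫ τ in Ioc a b, m τ x = max (dd u w0 w1 b x) 0 - max (dd u w0 w1 a x) 0 := by
    intro x a b ha hab
    have := ftc_pos (s := a) (s' := b) hab (d := fun τ => dd u w0 w1 τ x) (d' := fun τ => gt u τ x - w1 x) ?_ ?_
    · rw [intervalIntegral.integral_of_le hab, intervalIntegrable_iff_integrableOn_Ioc_of_le hab] at this
      exact this
    · intro τ hτ
      have h1 := h.hd (ha.trans_le hτ.1) x
      have h2 : HasDerivAt (fun τ : ℝ => - w0 x - τ * w1 x) (- w1 x) τ := by
        simpa using ((hasDerivAt_id τ).mul_const (w1 x)).const_sub (- w0 x)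
      exact (h1.add h2).congr_deriv (by ring)
    · exact ((h.gc x).mono fun τ hτ => ha.trans_le hτ.1).sub continuousOn_const
  have hsum : ∀ x, HasSum (fun p : Gap K => max (dd u w0 w1 p.1.2 x) 0 - max (dd u w0 w1 p.1.1 x) 0)
      (max (dd u w0 w1 t' x) 0 - max (dd u w0 w1 t x) 0 - ∫ τ in K', m τ x) := by
    intro x
    have i0 := ftc x t t' ht0 htt.le
    have h1 := hasSum_integral_iUnion (μ := volume) (f := fun τ => m τ x) (fun p : Gap K => measurableSet_Ioo)
      (gap_disjoint K) (by
        rw [gap_iUnion hK hKs ht ht']; exact i0.1.mono_set sdiff_subset)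
    rw [gap_iUnion hK hKs ht ht'] at h1
    have h2 := integral_inter_add_sdiff (μ := volume) hK.measurableSet i0.1
    rw [i0.2] at h2
    have h3 : max (dd u w0 w1 t' x) 0 - max (dd u w0 w1 t x) 0 - ∫ τ in K', m τ x = ∫ τ in Ioc t t' \ K, m τ x := by
      rw [← h2]; ring
    rw [h3]
    refine h1.congr_fun ?_
    intro p
    rw [← integral_Ioc_eq_integral_Ioo]
    exact (ftc x p.1.1 p.1.2 (gpos p) p.2.1.le).2.symm
  -- integrate in x
  have id : ∀ τ, 0 < τ → Integrable (dd u w0 w1 τ) ν := (h.LCd hR hw0 hw1).i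
  have idp : ∀ τ, 0 < τ → Integrable (fun x => max (dd u w0 w1 τ x) 0) ν := fun τ hτ =>
    lip_int (P := fun r => max r 0) max_lip (by simp) (id τ hτ)
  have iu : ∀ τ, 0 < τ → Integrable (u τ) ν := fun τ hτ => (h.ui τ hτ).integrableOn
  have hbound : ∀ p : Gap K, ∫ x, ‖max (dd u w0 w1 p.1.2 x) 0 - max (dd u w0 w1 p.1.1 x) 0‖ ∂ν ≤
      (M + ∫ x, |w1 x| ∂ν) * (p.1.2 - p.1.1) := by
    intro p
    have i1 : Integrable (fun x => |u p.1.2 x - u p.1.1 x|) ν := ((iu _ (gpos2 p)).sub (iu _ (gpos p))).abs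
    have i2 : Integrable (fun x => |w1 x| * (p.1.2 - p.1.1)) ν := iw1.abs.mul_const _
    have : ∫ x, ‖max (dd u w0 w1 p.1.2 x) 0 - max (dd u w0 w1 p.1.1 x) 0‖ ∂ν ≤
       ∫ x, (|u p.1.2 x - u p.1.1 x| + |w1 x| * (p.1.2 - p.1.1)) ∂ν := by
      apply integral_mono_of_nonneg (Eventually.of_forall fun x => norm_nonneg _) (i1.add i2)
      refine Eventually.of_forall fun x => ?_
      simp only [Real.norm_eq_abs]
      refine (max_lip _ _).trans ?_
      unfold dd
      have e : u p.1.2 x + (- w0 x - p.1.2 * w1 x) - (u p.1.1 x + (- w0 x - p.1.1 * w1 x)) =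
        (u p.1.2 x - u p.1.1 x) - w1 x * (p.1.2 - p.1.1) := by ring
      rw [e]
      refine (abs_sub _ _).trans ?_
      rw [abs_mul, abs_of_nonneg (sub_nonneg.2 p.2.1.le)]; exact le_rfl
    refine this.trans ?_
    rw [integral_add i1 i2, integral_mul_const, add_mul]
    have := hM p
    linarith
  have hS : Summable fun p : Gap K => ∫ x, ‖max (dd u w0 w1 p.1.2 x) 0 - max (dd u w0 w1 p.1.1 x) 0‖ ∂ν :=
    Summable.of_nonneg_of_le (fun p => integral_nonneg fun x => norm_nonneg _) hbound
      ((gap_len_summable hK hKs ht ht').mul_left _)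
  have HS := hasSum_integral_of_summable_integral_norm (μ := ν)
    (F := fun (p : Gap K) x => max (dd u w0 w1 p.1.2 x) 0 - max (dd u w0 w1 p.1.1 x) 0)
    (fun p => (idp _ (gpos2 p)).sub (idp _ (gpos p))) hS
  have e1 : ∫ x, ∑' p : Gap K, (max (dd u w0 w1 p.1.2 x) 0 - max (dd u w0 w1 p.1.1 x) 0) ∂ν =
      NN R u w0 w1 t' - NN R u w0 w1 t - ∫ x, (∫ τ in K', m τ x) ∂ν := by
    have : ∀ x, ∑' p : Gap K, (max (dd u w0 w1 p.1.2 x) 0 - max (dd u w0 w1 p.1.1 x) 0) = _ := fun x => (hsum x).tsum_eq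
    simp_rw [this]
    rw [integral_sub, integral_sub (idp t' (ht0.trans htt)) (idp t ht0)]
    · rfl
    · exact (idp t' (ht0.trans htt)).sub (idp t ht0)
    · have := hintg.integral_prod_right
      refine this.congr (Eventually.of_forall fun x => ?_)
      apply setIntegral_congr_fun mK'
      intro τ hτ
      simp only [Function.uncurry, mx τ hτ]
  have e2 : ∫ x, (∫ τ in K', m τ x) ∂ν = ∫ τ in K', (∫ x, m τ x ∂ν) := by
    have := integral_integral_swap (f := fun τ x => m (max τ t) x) hintg
    have l : ∫ τ in K', (∫ x, m τ x ∂ν) = ∫ τ in K', (∫ x, m (max τ t) x ∂ν) := by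
      apply setIntegral_congr_fun mK'
      intro τ hτ
      simp only [mx τ hτ]
    rw [l, this]
    apply integral_congr_ae
    refine Eventually.of_forall fun x => ?_
    apply setIntegral_congr_fun mK'
    intro τ hτ
    simp only [mx τ hτ]
  have irho : IntegrableOn (rho q μ R f w0 w1) (Ioc t t') := by
    have := h.rho_ii hR hw0 hw1 ht0 (ht0.trans htt)
    rwa [intervalIntegrable_iff_integrableOn_Ioc_of_le htt.le] at this
  have e3 : ∫ τ in K', (∫ x, m τ x ∂ν) ≤ ∫ τ in K', rho q μ R f w0 w1 τ := by
    apply setIntegral_mono_on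
    · have := hintg.integral_prod_left
      refine this.congr ?_
      filter_upwards [ae_restrict_mem mK'] with τ hτ
      simp only [Function.uncurry, mx τ hτ]
    · exact irho.mono_set inter_subset_left
    · exact mK'
    · intro τ hτ
      exact (h.step hR hw0 hw1 (K'pos τ hτ) (hbc τ ⟨hτ.1.1.le, hτ.1.2⟩)).2
  have e4 : ∑' p : Gap K, ∫ x, (max (dd u w0 w1 p.1.2 x) 0 - max (dd u w0 w1 p.1.1 x) 0) ∂ν ≤
      ∫ τ in Ioc t t' \ K, rho q μ R f w0 w1 τ := by
    have h1 := hasSum_integral_iUnion (μ := volume) (f := rho q μ R f w0 w1) (fun p : Gap K => measurableSet_Ioo)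
      (gap_disjoint K) (by
        rw [gap_iUnion hK hKs ht ht']; exact irho.mono_set sdiff_subset)
    rw [gap_iUnion hK hKs ht ht'] at h1
    refine hasSum_le ?_ HS.summable.hasSum h1
    intro p
    rw [integral_sub (idp _ (gpos2 p)) (idp _ (gpos p)), ← integral_Ioc_eq_integral_Ioo,
      ← intervalIntegral.integral_of_le p.2.1.le]
    exact hC p w0 w1 hw0 hw1 (fun τ hτ => hbc τ ⟨(hKs p.2.2.1).1.trans hτ.1, hτ.2.trans (hKs p.2.2.2.1).2⟩)
  have e5 := integral_inter_add_sdiff (μ := volume) hK.measurableSet irho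
  rw [intervalIntegral.integral_of_le htt.le, ← e5]
  have e6 := HS.tsum_eq
  rw [e6, e1, e2] at e4
  linarith

end
end KS

namespace KS
open Set Topology

section
variable {q μ R : ℝ} {u f : ℝ → ℝ → ℝ}

def Cmp2 (q μ R : ℝ) (u f : ℝ → ℝ → ℝ) (a b : ℝ) : Prop :=
  Cmp q μ R u f a b ∧ Cmp q μ R (fun t x => - u t x) (fun t x => - f t x) a b

def Good (q μ R : ℝ) (u f : ℝ → ℝ → ℝ) (t : ℝ) : Prop :=
  ∃ δ > 0, ∀ a b, a ≤ b → t - δ < a → b < t + δ → 0 < a → Cmp2 q μ R u f a b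

theorem Cmp2.neg {a b : ℝ} (h : Cmp2 q μ R u f a b) :
    Cmp2 q μ R (fun t x => - u t x) (fun t x => - f t x) a b := by
  refine ⟨h.2, ?_⟩
  simpa using h.1

theorem gt_neg (t x : ℝ) : gt (fun t x => - u t x) t x = - gt u t x := by
  unfold gt; exact deriv.fun_neg

theorem good_isOpen : IsOpen {t | Good q μ R u f t} := by
  rw [Metric.isOpen_iff]
  rintro t ⟨δ, hδ, H⟩
  refine ⟨δ/2, by linarith, fun s hs => ⟨δ/2, by linarith, fun a b hab ha hb h0 => ?_⟩⟩
  rw [Metric.mem_ball, Real.dist_eq, abs_lt] at hs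
  exact H a b hab (by linarith) (by linarith) h0

/-- patching over an interval of good times -/
theorem patch (h : Sol q μ u f) (hR : 0 < R) {a b : ℝ} (ha : 0 < a) (hab : a ≤ b)
    (hg : ∀ τ ∈ Ioo a b, Good q μ R u f τ) : Cmp q μ R u f a b := by
  rcases hab.eq_or_lt with rfl | hab
  · exact Cmp.refl _
  apply Cmp.of_Ioo h hR ha hab
  intro s s' hs hss hs'
  apply Cmp.of_local h hR (ha.trans hs) hss
  intro τ hτ
  obtain ⟨δ, hδ, H⟩ := hg τ ⟨hs.trans_le hτ.1, hτ.2.trans_lt hs'⟩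
  refine ⟨δ, hδ, fun x y hxy hx hy _ => (H x y hxy (by linarith) hy ?_).1⟩
  linarith [hτ.1]

theorem good_neg {t : ℝ} (h : Good q μ R u f t) : Good q μ R (fun t x => - u t x) (fun t x => - f t x) t := by
  obtain ⟨δ, hδ, H⟩ := h
  exact ⟨δ, hδ, fun a b h1 h2 h3 h4 => (H a b h1 h2 h3 h4).neg⟩

theorem main1 (h : Sol q μ u f) (hR : 0 < R) {α β M n : ℝ} (hα : 0 < α)
    (hn : ∀ τ ∈ Icc α β, ¬ Good q μ R u f τ → ∫ x in Ioc (-R) R, |gt u τ x| ≤ n)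
    (hM : ∀ a b, α ≤ a → a < b → b ≤ β → ¬ Good q μ R u f a → Cmp2 q μ R u f a b →
      ∫ x in Ioc (-R) R, |u b x - u a x| ≤ M * (b - a))
    {s s' : ℝ} (hs : α ≤ s) (hss : s ≤ s') (hs' : s' ≤ β) : Cmp q μ R u f s s' := by
  set K := {τ | ¬ Good q μ R u f τ} ∩ Icc s s' with hK
  have hs0 : 0 < s := hα.trans_le hs
  have cK : IsClosed K := (good_isOpen.isClosed_compl).inter isClosed_Icc
  rcases K.eq_empty_or_nonempty with hE | hne
  · apply patch h hR hs0 hss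
    intro τ hτ
    by_contra hc
    have : τ ∈ K := ⟨hc, hτ.1.le, hτ.2.le⟩
    rw [hE] at this; exact this
  have bA : BddAbove K := ⟨s', fun y hy => hy.2.2⟩
  have bB : BddBelow K := ⟨s, fun y hy => hy.2.1⟩
  have mt := cK.csInf_mem hne bB
  have mt' := cK.csSup_mem hne bA
  set t := sInf K
  set t' := sSup K
  have htt : t ≤ t' := csInf_le bB mt'
  have c1 : Cmp q μ R u f s t := by
    apply patch h hR hs0 mt.2.1
    intro τ hτ
    by_contra hc
    have : τ ∈ K := ⟨hc, hτ.1.le, hτ.2.le.trans mt.2.2⟩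
    exact absurd (csInf_le bB this) (not_le.2 hτ.2)
  have c3 : Cmp q μ R u f t' s' := by
    apply patch h hR (hs0.trans_le mt'.2.1) mt'.2.2
    intro τ hτ
    by_contra hc
    have : τ ∈ K := ⟨hc, mt'.2.1.trans hτ.1.le, hτ.2.le⟩
    exact absurd (le_csSup bA this) (not_le.2 hτ.1)
  have c2 : Cmp q μ R u f t t' := by
    rcases htt.eq_or_lt with he | hlt
    · rw [← he]; exact Cmp.refl _
    have gg : ∀ p : Gap K, Cmp2 q μ R u f p.1.1 p.1.2 := by
      intro p
      have hp0 : 0 < p.1.1 := hs0.trans_le p.2.2.1.2.1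
      have hg : ∀ τ ∈ Ioo p.1.1 p.1.2, Good q μ R u f τ := by
        intro τ hτ
        by_contra hc
        exact Set.disjoint_left.1 p.2.2.2.2 hτ ⟨hc, p.2.2.1.2.1.trans hτ.1.le, hτ.2.le.trans p.2.2.2.1.2.2⟩
      exact ⟨patch h hR hp0 p.2.1.le hg, patch h.neg hR hp0 p.2.1.le fun τ hτ => good_neg (hg τ hτ)⟩
    refine Cmp.cross h hR cK (hs0.trans_le mt.2.1) hlt (fun y hy => ⟨csInf_le bB hy, le_csSup bA hy⟩) mt mt'
      (M := M) (n := n) ?_ ?_ (fun p => (gg p).1)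
    · intro p
      exact hM _ _ (hs.trans p.2.2.1.2.1) p.2.1 (p.2.2.2.1.2.2.trans hs') p.2.2.1.1 (gg p)
    · intro τ hτ
      exact hn τ ⟨hs.trans hτ.2.1, hτ.2.2.trans hs'⟩ hτ.1
  have hs0t : 0 < t := hs0.trans_le mt.2.1
  exact (c1.trans h hR hs0 mt.2.1 htt c2).trans h hR hs0 (mt.2.1.trans htt) mt'.2.2 c3

theorem gapbound (h : Sol q μ u f) (hR : 0 < R) {a b k n B : ℝ} (ha : 0 < a) (hab : a < b) (hb1 : b ≤ a + 1)
    (hk0 : 0 ≤ k) (hn0 : 0 ≤ n)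
    (hC : Cmp q μ R u f a b)
    (hkR : ∀ τ ∈ Icc a b, u τ R - u a R ≤ k * (τ - a)) (hkR' : ∀ τ ∈ Icc a b, u τ (-R) - u a (-R) ≤ k * (τ - a))
    (hu : ∀ x ∈ Icc (-R) R, |u a x| ≤ n) (hux : ∀ x ∈ Icc (-R) R, |deriv (u a) x| ≤ n)
    (hg : ∫ x in Ioc (-R) R, |gt u a x| ≤ n)
    (hB : ∀ τ ∈ Icc a b, ∫ x in Ioc (-R) R, |f τ x - f a x| ≤ B) :
    ∫ x in Ioc (-R) R, max (u b x - u a x) 0 ≤ (B + n + (k + 2 * ((n+k)^(q-1) * n)) * (2*R) + k * (2*R)) * (b - a) := by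
  set ν := volume.restrict (Ioc (-R) R) with hν
  have hUa := h.ux a ha
  set w0 : ℝ → ℝ := fun x => u a x + (- (k * a)) with hw0d
  set w1 : ℝ → ℝ := fun _ => k with hw1d
  have hw0 : ContDiff ℝ 2 w0 := hUa.add contDiff_const
  have hw1 : ContDiff ℝ 2 w1 := contDiff_const
  have d0 : deriv w0 = deriv (u a) := by ext x; simp [hw0d]
  have d1 : deriv w1 = fun _ => 0 := by ext x; simp [hw1d]
  have vol : ∀ c : ℝ, ∫ _x, c ∂ν = c * (2*R) := by
    intro c; simp [hν]; rw [max_eq_left (by linarith)]; ring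
  have hc := hC w0 w1 hw0 hw1 (fun τ hτ => by
    have := hkR τ hτ; have := hkR' τ hτ; simp only [hw0d, hw1d]; constructor <;> linarith)
  have hNa : NN R u w0 w1 a = 0 := by
    unfold NN dd
    simp only [hw0d, hw1d]
    have : ∀ x, u a x + (-(u a x + -(k * a)) - a * k) = 0 := fun x => by ring
    simp only [this, max_self, integral_zero]
  have hrho : ∀ τ ∈ Icc a b, rho q μ R f w0 w1 τ ≤ B + n + (k + 2 * ((n+k)^(q-1) * n)) * (2*R) := by
    intro τ hτ
    have hτ0 : 0 < τ := ha.trans_le hτ.1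
    have i1 : Integrable (fun x => |f τ x - f a x|) ν := ((h.fi τ hτ0).sub (h.fi a ha)).abs.integrableOn
    have i2 : Integrable (fun x => |gt u a x|) ν := (h.gint ha R).abs
    have i3 : Integrable (fun _ : ℝ => k + 2 * ((n+k)^(q-1) * n)) ν := integrable_const _
    have i12 : Integrable (fun x => |f τ x - f a x| + |gt u a x|) ν := i1.add i2
    have : rho q μ R f w0 w1 τ ≤ ∫ x, ((|f τ x - f a x| + |gt u a x|) + (k + 2 * ((n+k)^(q-1) * n))) ∂ν := by
      unfold rho
      apply integral_mono_of_nonneg (Eventually.of_forall fun x => abs_nonneg _) (i12.add i3)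
      filter_upwards [ae_restrict_mem measurableSet_Ioc] with x hx
      have hxI : x ∈ Icc (-R) R := Ioc_subset_Icc_self hx
      simp only [mm, d0, d1, deriv_const, mul_zero, add_zero]
      set P := |u a x|^(q-1) * deriv (u a) x with hP
      set Q := |w0 x + τ * w1 x|^(q-1) * deriv (u a) x with hQ
      have p := h.pde a ha x
      have e : f τ x + (- w1 x + μ * deriv (deriv (u a)) x - Q) = (f τ x - f a x) + gt u a x + (- k + (P - Q)) := by
        have : gt u a x = _ := p
        rw [this]; simp only [hw1d, hP]; ring
      have bP : |P| ≤ (n+k)^(q-1) * n := by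
        rw [hP, abs_mul, abs_of_nonneg (by positivity : 0 ≤ |u a x|^(q-1))]
        apply mul_le_mul _ (hux x hxI) (abs_nonneg _) (by positivity)
        exact Real.rpow_le_rpow (abs_nonneg _) (by linarith [hu x hxI]) (by linarith [h.hq])
      have bQ : |Q| ≤ (n+k)^(q-1) * n := by
        rw [hQ, abs_mul, abs_of_nonneg (by positivity : 0 ≤ |w0 x + τ * w1 x|^(q-1))]
        apply mul_le_mul _ (hux x hxI) (abs_nonneg _) (by positivity)
        apply Real.rpow_le_rpow (abs_nonneg _) _ (by linarith [h.hq])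
        have e2 : w0 x + τ * w1 x = u a x + k * (τ - a) := by simp only [hw0d, hw1d]; ring
        rw [e2]
        refine (abs_add_le _ _).trans ?_
        have : |k * (τ - a)| ≤ k := by
          rw [abs_of_nonneg (mul_nonneg hk0 (by linarith [hτ.1]))]
          have : τ - a ≤ 1 := by linarith [hτ.2]
          nlinarith
        linarith [hu x hxI]
      rw [e]
      have t1 := abs_add_le ((f τ x - f a x) + gt u a x) (-k + (P-Q))
      have t2 := abs_add_le (f τ x - f a x) (gt u a x)
      have t3 := abs_add_le (-k) (P-Q)
      have t4 := abs_sub P Q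
      rw [abs_neg, abs_of_nonneg hk0] at t3
      simp only [Pi.add_apply]
      linarith
    rw [integral_add i12 i3, integral_add i1 i2, vol] at this
    linarith [hB τ hτ]
  have hI : ∫ τ in a..b, rho q μ R f w0 w1 τ ≤ (B + n + (k + 2 * ((n+k)^(q-1) * n)) * (2*R)) * (b - a) := by
    have := intervalIntegral.integral_mono_on hab.le (h.rho_ii hR hw0 hw1 ha (ha.trans hab))
      (intervalIntegrable_const (c := B + n + (k + 2 * ((n+k)^(q-1) * n)) * (2*R))) hrho
    rw [intervalIntegral.integral_const, smul_eq_mul] at this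
    linarith
  have hN : ∫ x, max (u b x - u a x) 0 ∂ν ≤ NN R u w0 w1 b + k * (b-a) * (2*R) := by
    have j1 : Integrable (fun x => max (dd u w0 w1 b x) 0) ν :=
      lip_int (P := fun r => max r 0) max_lip (by simp) ((h.LCd hR hw0 hw1).i b (ha.trans hab))
    have j2 : Integrable (fun _ : ℝ => k * (b-a)) ν := integrable_const _
    have : ∫ x, max (u b x - u a x) 0 ∂ν ≤ ∫ x, (max (dd u w0 w1 b x) 0 + k * (b-a)) ∂ν := by
      apply integral_mono_of_nonneg (Eventually.of_forall fun x => le_max_right _ _) (j1.add j2)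
      refine Eventually.of_forall fun x => ?_
      have hkb : 0 ≤ k * (b-a) := mul_nonneg hk0 (by linarith)
      simp only [dd, hw0d, hw1d, Pi.add_apply]
      show max (u b x - u a x) (0:ℝ) ≤ _
      have hm1 := le_max_left (u b x + (-(u a x + -(k * a)) - b * k)) 0
      have hm2 := le_max_right (u b x + (-(u a x + -(k * a)) - b * k)) 0
      apply max_le <;> linarith
    rw [integral_add j1 j2, vol] at this
    exact this
  rw [hNa] at hc
  linarith

/-- Baire argument: every positive time is good -/
theorem all_good (h : Sol q μ u f) (hR : 0 < R) {t : ℝ} (ht : 0 < t) : Good q μ R u f t := by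
  by_contra hcon
  set ν := volume.restrict (Ioc (-R) R) with hν
  set C : Set ℝ := Ioi 0 ∩ {τ | Good q μ R u f τ}ᶜ with hC
  have lc : IsLocallyClosed C := isOpen_Ioi.isLocallyClosed.inter good_isOpen.isClosed_compl.isLocallyClosed
  have : LocallyCompactSpace C := lc.locallyCompactSpace
  have : Nonempty C := ⟨⟨t, ht, hcon⟩⟩
  let E : ℕ → Set C := fun n => {τ | (∀ x ∈ Icc (-R) R, |u τ x| ≤ n) ∧
    (∀ x ∈ Icc (-R) R, ∀ y ∈ Icc (-R) R, |u τ x - u τ y| ≤ n * |x - y|) ∧ ∫⁻ x, ‖gt u τ x‖ₑ ∂ν ≤ n}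
  have cu : ∀ x, Continuous fun τ : C => u τ x := fun x =>
    (h.uct x).comp_continuous continuous_subtype_val (fun τ => τ.2.1)
  have cg : ∀ x, Continuous fun τ : C => gt u τ x := fun x =>
    (h.gc x).comp_continuous continuous_subtype_val (fun τ => τ.2.1)
  have hEc : ∀ n, IsClosed (E n) := by
    intro n
    have c1 : IsClosed {τ : C | ∀ x ∈ Icc (-R) R, |u τ x| ≤ n} := by
      simp only [Set.ofPred_forall]
      exact isClosed_iInter fun x => isClosed_iInter fun _ => isClosed_le (cu x).abs continuous_const
    have c2 : IsClosed {τ : C | ∀ x ∈ Icc (-R) R, ∀ y ∈ Icc (-R) R, |u τ x - u τ y| ≤ n * |x - y|} := by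
      simp only [Set.ofPred_forall]
      exact isClosed_iInter fun x => isClosed_iInter fun _ => isClosed_iInter fun y => isClosed_iInter fun _ =>
        isClosed_le ((cu x).sub (cu y)).abs continuous_const
    have c3 : IsClosed {τ : C | ∫⁻ x, ‖gt u τ x‖ₑ ∂ν ≤ n} := by
      apply IsSeqClosed.isClosed
      intro s a hs hsa
      have l1 : ∀ x, liminf (fun k => ‖gt u (s k) x‖ₑ) atTop = ‖gt u a x‖ₑ := by
        intro x
        apply Tendsto.liminf_eq
        exact (continuous_enorm.tendsto _).comp (((cg x).tendsto a).comp hsa)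
      have l2 := lintegral_liminf_le (u := atTop) (μ := ν) (f := fun k x => ‖gt u (s k) x‖ₑ)
        (fun k => (h.gmeas (s k).2.1).enorm)
      simp only [l1] at l2
      refine l2.trans ?_
      apply liminf_le_of_le (by isBoundedDefault)
      intro b hb
      obtain ⟨k, hk⟩ := hb.exists
      exact hk.trans (hs k)
    exact c1.inter (c2.inter c3)
  have hEU : ⋃ n, E n = univ := by
    rw [eq_univ_iff_forall]
    intro τ
    have hτ : 0 < (τ:ℝ) := τ.2.1
    have hU := h.ux τ hτ
    obtain ⟨M1, hM1⟩ := isCompact_Icc (a := -R) (b := R) |>.exists_bound_of_continuousOn hU.continuous.continuousOn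
    obtain ⟨M2, hM2⟩ := isCompact_Icc (a := -R) (b := R) |>.exists_bound_of_continuousOn (c2_cont1 hU).continuousOn
    have hfin : ∫⁻ x, ‖gt u τ x‖ₑ ∂ν < ∞ := (h.gint hτ R).2
    obtain ⟨n1, hn1⟩ := exists_nat_ge M1
    obtain ⟨n2, hn2⟩ := exists_nat_ge M2
    obtain ⟨n3, hn3⟩ := ENNReal.exists_nat_gt hfin.ne
    set n := max n1 (max n2 n3)
    have k1 : (n1:ℝ) ≤ n := by exact_mod_cast le_max_left _ _
    have k2 : (n2:ℝ) ≤ n := by exact_mod_cast (le_max_left _ _).trans (le_max_right _ _)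
    have k3 : (n3:ℝ≥0∞) ≤ n := by exact_mod_cast (le_max_right _ _).trans (le_max_right _ _)
    rw [mem_iUnion]
    refine ⟨n, ?_, ?_, ?_⟩
    · intro x hx; exact (hM1 x hx).trans (hn1.trans k1)
    · intro x hx y hy
      have := (convex_Icc (-R) R).norm_image_sub_le_of_norm_hasDerivWithin_le (f := u τ) (f' := deriv (u τ)) (C := n)
        (fun z _ => (c2_hd hU z).hasDerivWithinAt) (fun z hz => (hM2 z hz).trans (hn2.trans k2)) hy hx
      simpa [Real.norm_eq_abs] using this
    · exact hn3.le.trans k3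
  obtain ⟨n, ⟨t₁, ht₁⟩⟩ := nonempty_interior_of_iUnion_of_closed hEc hEU
  rw [mem_interior_iff_mem_nhds, nhds_subtype_eq_comap, mem_comap] at ht₁
  obtain ⟨V, hV, hVE⟩ := ht₁
  obtain ⟨δ0, hδ0, hball⟩ := Metric.mem_nhds_iff.1 hV
  obtain ⟨s, hs⟩ : ∃ s : ℝ, s = (t₁ : ℝ) := ⟨_, rfl⟩
  have hs0 : 0 < s := hs ▸ t₁.2.1
  rw [← hs] at hball
  set δ : ℝ := min (δ0/2) (min (s/2) (1/2)) with hδ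
  have hδp : 0 < δ := by positivity
  have hδ1 : δ < δ0 := (min_le_left _ _).trans_lt (by linarith)
  have hδ2 : δ ≤ s/2 := (min_le_right _ _).trans (min_le_left _ _)
  have hδ3 : δ ≤ 1/2 := (min_le_right _ _).trans (min_le_right _ _)
  have hbad : ∀ τ ∈ Icc (s-δ) (s+δ), ¬ Good q μ R u f τ → (∀ x ∈ Icc (-R) R, |u τ x| ≤ n) ∧
    (∀ x ∈ Icc (-R) R, ∀ y ∈ Icc (-R) R, |u τ x - u τ y| ≤ n * |x - y|) ∧ ∫⁻ x, ‖gt u τ x‖ₑ ∂ν ≤ n := by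
    intro τ hτ hb
    have hτ0 : 0 < τ := by linarith [hτ.1]
    have hm : (⟨τ, hτ0, hb⟩ : C) ∈ E n := by
      apply hVE
      apply hball
      rw [Metric.mem_ball, Real.dist_eq, abs_lt]
      constructor <;> simp only <;> linarith [hτ.1, hτ.2]
    exact hm
  have hα : 0 < s - δ := by linarith
  have sub : Icc (s-δ) (s+δ) ⊆ Ioi 0 := fun τ hτ => hα.trans_le hτ.1
  have hgn : ∀ τ ∈ Icc (s-δ) (s+δ), ¬ Good q μ R u f τ → ∫ x, |gt u τ x| ∂ν ≤ n := by
    intro τ hτ hb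
    have h3 := (hbad τ hτ hb).2.2
    have e := ofReal_integral_norm_eq_lintegral_enorm (h.gint (sub hτ) R)
    have : ENNReal.ofReal (∫ x, ‖gt u τ x‖ ∂ν) ≤ ENNReal.ofReal n := by
      rw [e]; simpa using h3
    exact (ENNReal.ofReal_le_ofReal_iff (Nat.cast_nonneg n)).1 this
  obtain ⟨k1, hk1⟩ := isCompact_Icc.exists_bound_of_continuousOn ((h.gc R).mono sub)
  obtain ⟨k2, hk2⟩ := isCompact_Icc.exists_bound_of_continuousOn ((h.gc (-R)).mono sub)
  have lf : LC R f := LC.of_global h.fi h.fc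
  obtain ⟨B0, hB0⟩ := isCompact_Icc.exists_bound_of_continuousOn
    ((lf.tendsto (P := fun r => |r|) abs_abs_sub_abs_le_abs_sub (by simp)).mono sub)
  set k := max (max k1 k2) 0 with hk
  have hk0 : 0 ≤ k := le_max_right _ _
  have hkk1 : k1 ≤ k := (le_max_left _ _).trans (le_max_left _ _)
  have hkk2 : k2 ≤ k := (le_max_right _ _).trans (le_max_left _ _)
  have hlip : ∀ y, (∀ τ ∈ Icc (s-δ) (s+δ), ‖gt u τ y‖ ≤ k) → ∀ a ∈ Icc (s-δ) (s+δ), ∀ τ ∈ Icc (s-δ) (s+δ), a ≤ τ →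
      |u τ y - u a y| ≤ k * (τ - a) := by
    intro y hy a ha τ hτ haτ
    have := (convex_Icc (s-δ) (s+δ)).norm_image_sub_le_of_norm_hasDerivWithin_le (f := fun τ => u τ y) (f' := fun τ => gt u τ y)
      (C := k) (fun z hz => (h.hd (sub hz) y).hasDerivWithinAt) hy ha hτ
    rw [Real.norm_eq_abs, Real.norm_eq_abs, abs_of_nonneg (sub_nonneg.2 haτ)] at this
    exact this
  have lR := hlip R (fun τ hτ => (hk1 τ hτ).trans hkk1)
  have lR' := hlip (-R) (fun τ hτ => (hk2 τ hτ).trans hkk2)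
  set A := (2*B0 + n + (k + 2 * ((n+k)^(q-1) * n)) * (2*R) + k * (2*R)) with hA
  have hM : ∀ a b, s-δ ≤ a → a < b → b ≤ s+δ → ¬ Good q μ R u f a → Cmp2 q μ R u f a b →
      ∫ x, |u b x - u a x| ∂ν ≤ (2*A) * (b - a) := by
    intro a b ha hab hb hga hc
    have haI : a ∈ Icc (s-δ) (s+δ) := ⟨ha, hab.le.trans hb⟩
    have ha0 : 0 < a := sub haI
    have hb0 : 0 < b := ha0.trans hab
    obtain ⟨p1, p2, p3⟩ := hbad a haI hga
    have hux : ∀ x ∈ Icc (-R) R, |deriv (u a) x| ≤ n := by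
      have hU := h.ux a ha0
      have : ∀ x ∈ Ioo (-R) R, |deriv (u a) x| ≤ n := by
        intro x hx
        have := (c2_hd hU x).le_of_lip' (C := n) (Nat.cast_nonneg n) ?_
        · simpa [Real.norm_eq_abs] using this
        · filter_upwards [Icc_mem_nhds hx.1 hx.2] with y hy
          simpa [Real.norm_eq_abs] using p2 y hy x (Ioo_subset_Icc_self hx)
      have cl : Icc (-R) R ⊆ {x | |deriv (u a) x| ≤ n} := by
        rw [← closure_Ioo (by linarith : (-R) ≠ R)]
        exact closure_minimal this (isClosed_le (c2_cont1 hU).abs continuous_const)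
      exact cl
    have hBB : ∀ τ ∈ Icc a b, ∫ x, |f τ x - f a x| ∂ν ≤ 2 * B0 := by
      intro τ hτ
      have hτI : τ ∈ Icc (s-δ) (s+δ) := ⟨ha.trans hτ.1, hτ.2.trans hb⟩
      have j1 : Integrable (fun x => |f τ x|) ν := (lf.i τ (sub hτI)).abs
      have j2 : Integrable (fun x => |f a x|) ν := (lf.i a ha0).abs
      have : ∫ x, |f τ x - f a x| ∂ν ≤ ∫ x, (|f τ x| + |f a x|) ∂ν := by
        apply integral_mono_of_nonneg (Eventually.of_forall fun x => abs_nonneg _) (j1.add j2)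
        exact Eventually.of_forall fun x => abs_sub _ _
      rw [integral_add j1 j2] at this
      have b1 := (le_abs_self _).trans (hB0 τ hτI)
      have b2 := (le_abs_self _).trans (hB0 a haI)
      linarith
    have g1 := gapbound h hR ha0 hab (by linarith) hk0 (Nat.cast_nonneg n) hc.1
      (fun τ hτ => (le_abs_self _).trans (lR a haI τ ⟨ha.trans hτ.1, hτ.2.trans hb⟩ hτ.1))
      (fun τ hτ => (le_abs_self _).trans (lR' a haI τ ⟨ha.trans hτ.1, hτ.2.trans hb⟩ hτ.1)) p1 hux (hgn a haI hga) hBB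
    have g2 := gapbound h.neg hR ha0 hab (by linarith) hk0 (Nat.cast_nonneg n) hc.2
      (fun τ hτ => by
        have := (neg_abs_le _).trans' (neg_le_neg (lR a haI τ ⟨ha.trans hτ.1, hτ.2.trans hb⟩ hτ.1)); linarith)
      (fun τ hτ => by
        have := (neg_abs_le _).trans' (neg_le_neg (lR' a haI τ ⟨ha.trans hτ.1, hτ.2.trans hb⟩ hτ.1)); linarith)
      (by simpa using p1) (by intro x hx; rw [deriv.fun_neg, abs_neg]; exact hux x hx)
      (by simpa [gt_neg] using hgn a haI hga)
      (by
        intro τ hτ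
        have := hBB τ hτ
        refine le_trans (le_of_eq ?_) this
        apply integral_congr_ae
        refine Eventually.of_forall fun x => ?_
        simp only; rw [← abs_neg]; ring_nf)
    have iu : Integrable (fun x => u b x - u a x) ν := ((h.ui b hb0).sub (h.ui a ha0)).integrableOn
    have j1 : Integrable (fun x => max (u b x - u a x) 0) ν := iu.pos_part
    have j2 : Integrable (fun x => max (-u b x - -u a x) 0) ν := by
      have := iu.neg_part
      refine this.congr (Eventually.of_forall fun x => ?_)
      simp only; ring_nf
    have : ∫ x, |u b x - u a x| ∂ν = ∫ x, max (u b x - u a x) 0 ∂ν + ∫ x, max (-u b x - -u a x) 0 ∂ν := by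
      rw [← integral_add j1 j2]
      apply integral_congr_ae
      refine Eventually.of_forall fun x => ?_
      simp only
      rcases le_total 0 (u b x - u a x) with hh | hh
      · rw [abs_of_nonneg hh, max_eq_left hh, max_eq_right (by linarith)]; ring
      · rw [abs_of_nonpos hh, max_eq_right hh, max_eq_left (by linarith)]; ring
    rw [this]
    linarith
  have good : Good q μ R u f s := by
    refine ⟨δ, hδp, fun a b hab ha hb h0 => ⟨?_, ?_⟩⟩
    · exact main1 h hR hα hgn hM ha.le hab hb.le
    · refine main1 h.neg hR (n := n) (M := 2*A) hα ?_ ?_ ha.le hab hb.le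
      · intro τ hτ hb
        simp only [gt_neg, abs_neg]
        exact hgn τ hτ (fun hg => hb (good_neg hg))
      · intro a b ha hab hb hga hc
        have := hM a b ha hab hb (fun hg => hga (good_neg hg)) (by simpa using hc.neg)
        refine le_trans (le_of_eq ?_) this
        apply integral_congr_ae
        refine Eventually.of_forall fun x => ?_
        simp only; rw [← abs_neg]; ring_nf
  exact t₁.2.2 (hs ▸ good)

theorem Sol.cmp (h : Sol q μ u f) (hR : 0 < R) {a b : ℝ} (ha : 0 < a) (hab : a ≤ b) : Cmp q μ R u f a b :=
  patch h hR ha hab fun _ hτ => all_good h hR (ha.trans hτ.1)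

end
end KS

namespace KS
open Set Topology

section
variable {q μ R : ℝ} {u f : ℝ → ℝ → ℝ}

theorem smooth_approx {R : ℝ} {g : ℝ → ℝ} (hg : IntegrableOn g (Ioc (-R) R)) {ε : ℝ} (hε : 0 < ε) :
    ∃ w : ℝ → ℝ, ContDiff ℝ 2 w ∧ ∫ x in Ioc (-R) R, |g x - w x| ≤ ε := by
  have hm : MemLp g 1 (volume.restrict (Ioc (-R) R)) := memLp_one_iff_integrable.2 hg
  obtain ⟨w, hw1, hw2, hw3⟩ := hm.exist_eLpNorm_sub_le (by norm_num) le_rfl hε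
  refine ⟨w, by exact_mod_cast contDiff_infty.1 hw2 2, ?_⟩
  have hwi : Integrable w (volume.restrict (Ioc (-R) R)) :=
    (hw2.continuous.integrable_of_hasCompactSupport hw1).integrableOn
  have e := ofReal_integral_norm_eq_lintegral_enorm (hg.sub hwi)
  rw [← eLpNorm_one_eq_lintegral_enorm] at e
  rw [← e] at hw3
  exact (ENNReal.ofReal_le_ofReal_iff hε.le).1 hw3

theorem bump_int (hR : 0 < R) {A ε : ℝ} (hε : 0 < ε) :
    ∃ m : ℕ, ∫ x in Ioc (-R) R, A * (x / R)^(2*m) ≤ ε := by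
  obtain ⟨m, hm⟩ := exists_nat_ge (2 * A * R / ε)
  refine ⟨m, ?_⟩
  rw [← intervalIntegral.integral_of_le (by linarith)]
  have e : ∀ x : ℝ, A * (x/R)^(2*m) = (A / R^(2*m)) * x^(2*m) := fun x => by rw [div_pow]; ring
  simp_rw [e]
  rw [intervalIntegral.integral_const_mul, integral_pow]
  have o : (-R)^(2*m+1) = - R^(2*m+1) := Odd.neg_pow ⟨m, rfl⟩ R
  rw [o, pow_succ]
  have : A / R^(2*m) * ((R^(2*m)*R - -(R^(2*m)*R)) / (((2*m : ℕ):ℝ)+1)) = 2*A*R / (2*m+1) := by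
    have : R^(2*m) ≠ 0 := by positivity
    push_cast
    field_simp
    ring
  rw [this, div_le_iff₀ (by positivity)]
  rw [div_le_iff₀ hε] at hm
  nlinarith

theorem Sol.right1 (h : Sol q μ u f) (hR : 0 < R) {t : ℝ} (ht : 0 < t) {ε : ℝ} (hε : 0 < ε) :
    ∀ᶠ d in 𝓝[>] (0:ℝ), ∫ x in Ioc (-R) R, max (u (t+d) x - u t x - d * gt u t x) 0 ≤ 5 * ε * d := by
  set ν := volume.restrict (Ioc (-R) R) with hν
  obtain ⟨w, hw, hwε⟩ := smooth_approx (h.gint ht R) hε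
  -- bounds of the time derivative at the boundary
  have hb : ∀ x, ∃ B, ∀ᶠ τ in 𝓝 t, |gt u τ x| ≤ B := by
    intro x
    have := ((h.gc x).continuousAt (Ioi_mem_nhds ht)).abs
    refine ⟨|gt u t x| + 1, ?_⟩
    exact (this.eventually (gt_mem_nhds (by linarith : |gt u t x| < |gt u t x| + 1))).mono fun _ h => h.le
  obtain ⟨B1, hB1⟩ := hb R
  obtain ⟨B2, hB2⟩ := hb (-R)
  set A : ℝ := |B1| + |B2| + |w R| + |w (-R)| with hA
  have hA0 : 0 ≤ A := by positivity
  obtain ⟨m, hm⟩ := bump_int (A := A) hR hε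
  set w1 : ℝ → ℝ := fun x => w x + A * (x/R)^(2*m) with hw1d
  set w0 : ℝ → ℝ := fun x => u t x - t * w1 x with hw0d
  have hw1 : ContDiff ℝ 2 w1 := hw.add (by fun_prop)
  have hw0 : ContDiff ℝ 2 w0 := (h.ux t ht).sub (contDiff_const.mul hw1)
  have hrt : rho q μ R f w0 w1 t ≤ 2 * ε := by
    have ib : Integrable (fun x => A * (x/R)^(2*m)) ν :=
      ((by fun_prop : Continuous fun x => A * (x/R)^(2*m)).integrableOn_Icc (a := -R) (b := R)).mono_set Ioc_subset_Icc_self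
    have iw : Integrable w ν := (hw.continuous.integrableOn_Icc (a := -R) (b := R)).mono_set Ioc_subset_Icc_self
    have ia : Integrable (fun x => |gt u t x - w x|) ν := ((h.gint ht R).sub iw).abs
    have : rho q μ R f w0 w1 t ≤ ∫ x, (|gt u t x - w x| + A * (x/R)^(2*m)) ∂ν := by
      unfold rho
      apply integral_mono_of_nonneg (Eventually.of_forall fun x => abs_nonneg _) (ia.add ib)
      refine Eventually.of_forall fun x => ?_
      simp only [mm]
      have d0 : deriv w0 = fun x => deriv (u t) x - t * deriv w1 x := by
        ext x
        exact ((c2_hd (h.ux t ht) x).sub ((c2_hd hw1 x).const_mul t)).deriv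
      have d00 : deriv (deriv w0) x = deriv (deriv (u t)) x - t * deriv (deriv w1) x := by
        rw [d0]
        exact ((c2_hd2 (h.ux t ht) x).sub ((c2_hd2 hw1 x).const_mul t)).deriv
      have e1 : w0 x + t * w1 x = u t x := by simp only [hw0d]; ring
      rw [d00, d0, e1]
      have p : gt u t x = _ := h.pde t ht x
      have e2 : f t x + (-w1 x + μ * (deriv (deriv (u t)) x - t * deriv (deriv w1) x + t * deriv (deriv w1) x) -
          |u t x| ^ (q - 1) * ((fun x => deriv (u t) x - t * deriv w1 x) x + t * deriv w1 x))
          = (gt u t x - w x) - A * (x/R)^(2*m) := by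
        rw [p]; simp only [hw1d]; ring
      rw [e2]
      have := abs_sub (gt u t x - w x) (A * (x/R)^(2*m))
      rwa [abs_of_nonneg (a := A * (x/R)^(2*m))] at this
      exact mul_nonneg hA0 (by rw [pow_mul]; positivity)
    rw [integral_add ia ib] at this
    linarith
  have hr : ∀ᶠ τ in 𝓝 t, rho q μ R f w0 w1 τ < 3 * ε :=
    ((h.rho_cont hR hw0 hw1).continuousAt (Ioi_mem_nhds ht)).eventually (gt_mem_nhds (by linarith))
  obtain ⟨δ, hδ, hall⟩ := Metric.eventually_nhds_iff.1 (hB1.and (hB2.and hr))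
  have hmem : Ioo (0:ℝ) δ ∈ 𝓝[>] (0:ℝ) := Ioo_mem_nhdsGT hδ
  filter_upwards [hmem] with d hd
  have hall' : ∀ τ ∈ Icc t (t+d), |gt u τ R| ≤ B1 ∧ |gt u τ (-R)| ≤ B2 ∧ rho q μ R f w0 w1 τ < 3*ε := by
    intro τ hτ
    apply hall
    rw [Real.dist_eq, abs_of_nonneg (by linarith [hτ.1])]
    linarith [hτ.2, hd.2]
  have mv : ∀ x B, (∀ τ ∈ Icc t (t+d), |gt u τ x| ≤ B) → ∀ τ ∈ Icc t (t+d), u τ x - u t x ≤ B * (τ - t) := by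
    intro x B hB τ hτ
    have := (convex_Icc t (t+d)).norm_image_sub_le_of_norm_hasDerivWithin_le (f := fun s => u s x) (f' := fun s => gt u s x) (C := B)
      (fun z hz => (h.hd (ht.trans_le hz.1) x).hasDerivWithinAt) (fun z hz => hB z hz) (left_mem_Icc.2 (by linarith [hd.1])) hτ
    simp only [Real.norm_eq_abs] at this
    rw [abs_of_nonneg (by linarith [hτ.1] : 0 ≤ τ - t)] at this
    exact (le_abs_self _).trans this
  have hbc : BC R u w0 w1 t (t+d) := by
    intro τ hτ
    have m1 := mv R B1 (fun τ hτ => (hall' τ hτ).1) τ hτ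
    have m2 := mv (-R) B2 (fun τ hτ => (hall' τ hτ).2.1) τ hτ
    have p1 : w1 R ≥ B1 := by
      simp only [hw1d]
      rw [div_self hR.ne', one_pow]
      linarith [neg_abs_le (w R), le_abs_self B1, abs_nonneg B2, abs_nonneg (w (-R))]
    have p2 : w1 (-R) ≥ B2 := by
      simp only [hw1d]
      rw [neg_div, div_self hR.ne', pow_mul]
      norm_num
      linarith [neg_abs_le (w (-R)), le_abs_self B2, abs_nonneg B1, abs_nonneg (w R)]
    simp only [hw0d]
    have hτ0 : 0 ≤ τ - t := by linarith [hτ.1]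
    constructor <;> nlinarith
  have hc := h.cmp hR ht (by linarith [hd.1] : t ≤ t + d) w0 w1 hw0 hw1 hbc
  have hNa : NN R u w0 w1 t = 0 := by
    unfold NN dd
    have : ∀ x, u t x + (- w0 x - t * w1 x) = 0 := fun x => by simp only [hw0d]; ring
    simp only [this, max_self, integral_zero]
  have htd : 0 < t + d := by linarith [hd.1]
  have hI : ∫ τ in t..(t+d), rho q μ R f w0 w1 τ ≤ 3 * ε * d := by
    have := intervalIntegral.integral_mono_on (by linarith [hd.1]) (h.rho_ii hR hw0 hw1 ht htd)
      (intervalIntegrable_const (c := 3 * ε)) (fun τ hτ => (hall' τ hτ).2.2.le)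
    rw [intervalIntegral.integral_const, smul_eq_mul] at this
    linarith
  -- final comparison
  have j1 : Integrable (fun x => max (dd u w0 w1 (t+d) x) 0) ν :=
    lip_int (P := fun r => max r 0) max_lip (by simp) ((h.LCd hR hw0 hw1).i (t+d) htd)
  have iw1 : Integrable w1 ν := (hw1.continuous.integrableOn_Icc (a := -R) (b := R)).mono_set Ioc_subset_Icc_self
  have j2 : Integrable (fun x => d * |gt u t x - w1 x|) ν := ((h.gint ht R).sub iw1).abs.const_mul d
  have hrt' : ∫ x, |gt u t x - w1 x| ∂ν = rho q μ R f w0 w1 t := by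
    unfold rho
    congr 1
    ext x
    simp only [mm]
    have d0 : deriv w0 = fun x => deriv (u t) x - t * deriv w1 x := by
      ext x
      exact ((c2_hd (h.ux t ht) x).sub ((c2_hd hw1 x).const_mul t)).deriv
    have d00 : deriv (deriv w0) x = deriv (deriv (u t)) x - t * deriv (deriv w1) x := by
      rw [d0]
      exact ((c2_hd2 (h.ux t ht) x).sub ((c2_hd2 hw1 x).const_mul t)).deriv
    have e1 : w0 x + t * w1 x = u t x := by simp only [hw0d]; ring
    rw [d00, d0, e1]
    have p : gt u t x = _ := h.pde t ht x
    rw [p]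
    congr 1
    ring
  have : ∫ x, max (u (t+d) x - u t x - d * gt u t x) 0 ∂ν ≤ ∫ x, (max (dd u w0 w1 (t+d) x) 0 + d * |gt u t x - w1 x|) ∂ν := by
    apply integral_mono_of_nonneg (Eventually.of_forall fun x => le_max_right _ _) (j1.add j2)
    refine Eventually.of_forall fun x => ?_
    show max (u (t+d) x - u t x - d * gt u t x) (0:ℝ) ≤ max (dd u w0 w1 (t+d) x) 0 + d * |gt u t x - w1 x|
    have k1 := le_max_left (dd u w0 w1 (t+d) x) 0
    have k2 := le_max_right (dd u w0 w1 (t+d) x) 0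
    have k3 := neg_abs_le (gt u t x - w1 x)
    have k4 := abs_nonneg (gt u t x - w1 x)
    have hd0 := hd.1
    have e : dd u w0 w1 (t+d) x = u (t+d) x - u t x - d * w1 x := by simp only [dd, hw0d]; ring
    apply max_le
    · nlinarith
    · have := mul_nonneg hd0.le k4
      linarith
  rw [integral_add j1 j2, integral_const_mul, hrt'] at this
  have hN : NN R u w0 w1 (t+d) = ∫ x, max (dd u w0 w1 (t+d) x) 0 ∂ν := rfl
  rw [hNa] at hc
  have hd0 := hd.1
  nlinarith

theorem Sol.right (h : Sol q μ u f) (hR : 0 < R) {t : ℝ} (ht : 0 < t) {ε : ℝ} (hε : 0 < ε) :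
    ∀ᶠ d in 𝓝[>] (0:ℝ), ∫ x in Ioc (-R) R, |u (t+d) x - u t x - d * gt u t x| ≤ ε * d := by
  have h1 := h.right1 hR ht (by positivity : 0 < ε/10)
  have h2 := h.neg.right1 hR ht (by positivity : 0 < ε/10)
  filter_upwards [h1, h2, self_mem_nhdsWithin] with d e1 e2 hd
  have hd : 0 < d := hd
  have htd : 0 < t + d := by linarith
  have i0 : IntegrableOn (fun x => u (t+d) x - u t x - d * gt u t x) (Ioc (-R) R) :=
    (((h.ui _ htd).integrableOn.sub (h.ui _ ht).integrableOn)).sub ((h.gint ht R).const_mul d)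
  have gn : ∀ x, gt (fun t x => - u t x) t x = - gt u t x := fun x => (h.hd ht x).neg.deriv
  simp only [gn] at e2
  have i1 := lip_int (P := fun r => max r 0) max_lip (by simp) i0
  have i2 := lip_int (P := fun r => max r 0) max_lip (by simp) i0.neg
  have : ∫ x in Ioc (-R) R, |u (t+d) x - u t x - d * gt u t x| =
      (∫ x in Ioc (-R) R, max (u (t+d) x - u t x - d * gt u t x) 0) +
      ∫ x in Ioc (-R) R, max (-u (t+d) x - -u t x - d * -gt u t x) 0 := by
    rw [← integral_add i1]
    · congr 1
      ext x
      have : -u (t+d) x - -u t x - d * -gt u t x = -(u (t+d) x - u t x - d * gt u t x) := by ring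
      rw [this]
      generalize u (t+d) x - u t x - d * gt u t x = r
      rcases le_total 0 r with hr | hr
      · rw [abs_of_nonneg hr, max_eq_left hr, max_eq_right (by linarith)]; ring
      · rw [abs_of_nonpos hr, max_eq_right hr, max_eq_left (by linarith)]; ring
    · refine i2.congr (Eventually.of_forall fun x => ?_)
      simp only [Pi.neg_apply]
      congr 1; ring
  rw [this]
  linarith

end
end KS

namespace KS
open Set Topology

theorem cpt_forall {X Y : Type*} [TopologicalSpace X] {l : Filter Y} {K : Set X} (hK : IsCompact K) {p : Y → X → Prop}
    (h : ∀ x ∈ K, ∀ᶠ z in l ×ˢ 𝓝 x, p z.1 z.2) : ∀ᶠ y in l, ∀ x ∈ K, p y x := by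
  have := hK.mem_prod_nhdsSet_of_forall (l := l) (s := {z : Y × X | p z.1 z.2}) h
  rw [mem_prod_iff] at this
  obtain ⟨s, hs, t, ht, hst⟩ := this
  filter_upwards [hs] with y hy x hx
  exact hst (show (y, x) ∈ s ×ˢ t from ⟨hy, subset_of_mem_nhdsSet ht hx⟩)

theorem bar {X : Type*} [TopologicalSpace X] {a b : ℝ} {P K : Set X} {Z : ℝ → X → ℝ} (hK : IsCompact K)
    (hc : ContinuousOn (Function.uncurry Z) (Icc a b ×ˢ univ))
    (h0 : ∀ p ∈ P, Z a p ≤ 0)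
    (hout : ∀ t ∈ Icc a b, ∀ p ∈ P, p ∉ K → Z t p ≤ 0)
    (hKP : K ⊆ P)
    (hstep : ∀ t ∈ Ico a b, (∀ p ∈ P, Z t p ≤ 0) → ∀ p ∈ K, Z t p = 0 →
      ∀ᶠ z in 𝓝[>] (0:ℝ) ×ˢ 𝓝 p, Z (t + z.1) z.2 ≤ 0) :
    ∀ t ∈ Icc a b, ∀ p ∈ P, Z t p ≤ 0 := by
  have cs : ∀ t ∈ Icc a b, ∀ p, Tendsto (Function.uncurry Z) (𝓝[Icc a b] t ×ˢ 𝓝 p) (𝓝 (Z t p)) := by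
    intro t ht p
    have := hc (t, p) ⟨ht, mem_univ _⟩
    rw [ContinuousWithinAt, nhdsWithin_prod_eq, nhdsWithin_univ] at this
    exact this
  have key : Icc a b ⊆ {t | ∀ p ∈ P, Z t p ≤ 0} := by
    apply IsClosed.Icc_subset_of_forall_exists_gt
    · have : {t | ∀ p ∈ P, Z t p ≤ 0} ∩ Icc a b = Icc a b ∩ ⋂ p ∈ P, (Icc a b ∩ (fun t => Z t p) ⁻¹' Iic 0) := by
        ext t; simp only [mem_inter_iff, Set.mem_ofPred_eq, mem_iInter, mem_preimage, mem_Iic]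
        exact ⟨fun h => ⟨h.2, fun p hp => ⟨h.2, h.1 p hp⟩⟩, fun h => ⟨fun p hp => (h.2 p hp).2, h.1⟩⟩
      rw [this]
      apply isClosed_Icc.inter
      refine isClosed_iInter fun p => isClosed_iInter fun _ => ?_
      apply ContinuousOn.preimage_isClosed_of_isClosed _ isClosed_Icc isClosed_Iic
      exact hc.comp (f := fun t => (t, p)) (by fun_prop) (fun t ht => ⟨ht, mem_univ _⟩)
    · exact h0
    · intro t ht y hy
      have hy : t < y := hy
      have htI : t ∈ Icc a b := ⟨ht.2.1, ht.2.2.le⟩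
      have ev : ∀ᶠ d in 𝓝[>] (0:ℝ), ∀ p ∈ K, Z (t+d) p ≤ 0 := by
        apply cpt_forall hK
        intro p hp
        rcases (ht.1 p (hKP hp)).lt_or_eq with h | h
        · have e := (cs t htI p).eventually (gt_mem_nhds h)
          have tt : Tendsto (fun d : ℝ => t + d) (𝓝[>] 0) (𝓝[Icc a b] t) := by
            apply tendsto_nhdsWithin_of_tendsto_nhds_of_eventually_within
            · have : Tendsto (fun d : ℝ => t + d) (𝓝 0) (𝓝 (t + 0)) := (by fun_prop : Continuous fun d : ℝ => t + d).tendsto 0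
              rw [add_zero] at this
              exact this.mono_left nhdsWithin_le_nhds
            · filter_upwards [Ioo_mem_nhdsGT (sub_pos.2 ht.2.2)] with d hd
              exact ⟨by linarith [hd.1, ht.2.1], by linarith [hd.2]⟩
          have := (tt.prodMap (tendsto_id (x := 𝓝 p))).eventually e
          exact this.mono fun z hz => hz.le
        · exact hstep t ht.2 ht.1 p hp h
      have m := Ioo_mem_nhdsGT (lt_min (sub_pos.2 hy) (sub_pos.2 ht.2.2))
      obtain ⟨d, hd, hd2⟩ := (ev.and m).exists
      have l1 := hd2.2.trans_le (min_le_left _ _)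
      have l2 := hd2.2.trans_le (min_le_right _ _)
      refine ⟨t + d, ?_, by linarith [hd2.1], by linarith⟩
      intro p hp
      by_cases hpK : p ∈ K
      · exact hd p hpK
      · exact hout _ ⟨by linarith [hd2.1, ht.2.1], by linarith⟩ p hp hpK
  exact key

structure Lin (μ B M a b : ℝ) (v g fl : ℝ → ℝ → ℝ) : Prop where
  vi : ∀ t ∈ Icc a b, Integrable (v t)
  vc : ∀ t₀ ∈ Icc a b, Tendsto (fun t => ∫ x, |v t x - v t₀ x|) (𝓝[Icc a b] t₀) (𝓝 0)
  vd : ∀ t ∈ Icc a b, ContDiff ℝ 1 (v t)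
  gi : ∀ t ∈ Icc a b, ∀ R, IntegrableOn (g t) (Ioc (-R) R)
  gr : ∀ t ∈ Ico a b, ∀ R > 0, ∀ ε > 0, ∀ᶠ d in 𝓝[>] (0:ℝ),
    ∫ x in Ioc (-R) R, |v (t+d) x - v t x - d * g t x| ≤ ε * d
  eq : ∀ t ∈ Icc a b, ∀ y x, y ≤ x → (∀ z, ∫ w in (y-z)..(x-z), v t w ≤ ∫ w in y..x, v t w) →
    ∫ w in y..x, g t w ≤ -(fl t x - fl t y) + μ * (deriv (v t) x - deriv (v t) y)
  flx : ∀ t ∈ Icc a b, ∀ x y, v t x = v t y → |fl t x - fl t y| ≤ 2 * B * |v t x|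
  bd : ∀ t ∈ Icc a b, ∀ y x, y ≤ x → ∫ w in y..x, v t w ≤ M

section
variable {μ B M a b : ℝ} {v g fl : ℝ → ℝ → ℝ}

theorem ii_abs_le {w : ℝ → ℝ} (hw : Integrable w) (y x : ℝ) : |∫ z in y..x, w z| ≤ ∫ z, |w z| := by
  refine (intervalIntegral.norm_integral_le_integral_norm_uIoc (f := w) (a := y) (b := x)).trans ?_
  exact setIntegral_le_integral hw.abs (Eventually.of_forall fun _ => abs_nonneg _)

theorem prim_cont {w : ℝ → ℝ} (hw : Integrable w) : Continuous fun p : ℝ × ℝ => ∫ z in p.1..p.2, w z := by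
  have c : Continuous fun x => ∫ z in (0:ℝ)..x, w z :=
    intervalIntegral.continuous_primitive (fun _ _ => hw.intervalIntegrable) 0
  have : (fun p : ℝ × ℝ => ∫ z in p.1..p.2, w z) = fun p => (∫ z in (0:ℝ)..p.2, w z) - ∫ z in (0:ℝ)..p.1, w z := by
    ext p
    rw [intervalIntegral.integral_interval_sub_left] <;> exact hw.intervalIntegrable
  rw [this]
  exact (c.comp continuous_snd).sub (c.comp continuous_fst)

theorem Lin.cont (h : Lin μ B M a b v g fl) :
    ContinuousOn (Function.uncurry fun t (p : ℝ × ℝ) => ∫ z in p.1..p.2, v t z) (Icc a b ×ˢ univ) := by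
  rintro ⟨t, p⟩ ⟨ht, -⟩
  rw [ContinuousWithinAt, nhdsWithin_prod_eq, nhdsWithin_univ, tendsto_iff_dist_tendsto_zero]
  have t1 := (h.vc t ht).comp (tendsto_fst (f := 𝓝[Icc a b] t) (g := 𝓝 p))
  have t2 := (((prim_cont (h.vi t ht)).tendsto p).sub_const (∫ z in p.1..p.2, v t z)).abs.comp (tendsto_snd (f := 𝓝[Icc a b] t) (g := 𝓝 p))
  rw [sub_self, abs_zero] at t2
  have t3 := t1.add t2
  rw [add_zero] at t3
  refine tendsto_of_tendsto_of_tendsto_of_le_of_le' tendsto_const_nhds t3 (Eventually.of_forall fun _ => dist_nonneg) ?_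
  have : ∀ᶠ z in 𝓝[Icc a b] t ×ˢ 𝓝 p, z.1 ∈ Icc a b := (tendsto_fst (f := 𝓝[Icc a b] t) (g := 𝓝 p)).eventually self_mem_nhdsWithin
  filter_upwards [this] with z hz
  rw [Real.dist_eq]
  simp only [Function.uncurry, Function.comp]
  have e : ∫ w in z.2.1..z.2.2, v z.1 w = (∫ w in z.2.1..z.2.2, (v z.1 w - v t w)) + ∫ w in z.2.1..z.2.2, v t w := by
    rw [intervalIntegral.integral_sub (h.vi _ hz).intervalIntegrable (h.vi _ ht).intervalIntegrable]; ring
  rw [e, add_sub_assoc]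
  refine (abs_add_le _ _).trans ?_
  gcongr
  exact ii_abs_le ((h.vi _ hz).sub (h.vi _ ht)) _ _

theorem tail_small {w : ℝ → ℝ} (hw : Integrable w) {ε : ℝ} (hε : 0 < ε) :
    ∀ᶠ R in atTop, ∀ y x, y ≤ x → (R ≤ y ∨ x ≤ -R) → |∫ z in y..x, w z| ≤ ε := by
  have h1 := intervalIntegral_tendsto_integral_Ioi (μ := volume) (l := atTop) (b := fun R : ℝ => R) 0 hw.abs.integrableOn tendsto_id
  have h2 := intervalIntegral_tendsto_integral_Iic (μ := volume) (l := atTop) (a := fun R : ℝ => -R) 0 hw.abs.integrableOn tendsto_neg_atTop_atBot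
  have e1 := h1.eventually (lt_mem_nhds (by linarith : (∫ x in Ioi 0, |w x|) - ε < ∫ x in Ioi 0, |w x|))
  have e2 := h2.eventually (lt_mem_nhds (by linarith : (∫ x in Iic 0, |w x|) - ε < ∫ x in Iic 0, |w x|))
  filter_upwards [e1, e2, eventually_ge_atTop 0] with R k1 k2 hR y x hyx hc
  have ia : ∀ s t, IntervalIntegrable (fun z => |w z|) volume s t := fun s t => hw.abs.intervalIntegrable
  have nn : 0 ≤ᵐ[volume] fun z => |w z| := Eventually.of_forall fun _ => abs_nonneg _
  refine (intervalIntegral.abs_integral_le_integral_abs hyx).trans ?_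
  rcases hc with hc | hc
  · have a1 := intervalIntegral.integral_add_adjacent_intervals (ia 0 R) (ia R y)
    have a2 := intervalIntegral.integral_add_adjacent_intervals (ia 0 y) (ia y x)
    have a3 : 0 ≤ ∫ z in R..y, |w z| := intervalIntegral.integral_nonneg hc fun _ _ => abs_nonneg _
    have a4 : ∫ z in (0:ℝ)..x, |w z| ≤ ∫ z in Ioi 0, |w z| := by
      rw [intervalIntegral.integral_of_le (by linarith)]
      exact setIntegral_mono_set hw.abs.integrableOn (ae_restrict_of_ae nn) Ioc_subset_Ioi_self.eventuallyLE
    linarith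
  · have a1 := intervalIntegral.integral_add_adjacent_intervals (ia x (-R)) (ia (-R) 0)
    have a2 := intervalIntegral.integral_add_adjacent_intervals (ia y x) (ia x 0)
    have a3 : 0 ≤ ∫ z in x..(-R), |w z| := intervalIntegral.integral_nonneg hc fun _ _ => abs_nonneg _
    have a4 : ∫ z in y..0, |w z| ≤ ∫ z in Iic 0, |w z| := by
      rw [intervalIntegral.integral_of_le (by linarith)]
      exact setIntegral_mono_set hw.abs.integrableOn (ae_restrict_of_ae nn) Ioc_subset_Iic_self.eventuallyLE
    linarith

theorem Lin.tight (h : Lin μ B M a b v g fl) {ε : ℝ} (hε : 0 < ε) :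
    ∃ R > 0, ∀ t ∈ Icc a b, ∀ y x, y ≤ x → (R ≤ y ∨ x ≤ -R) → ∫ z in y..x, v t z ≤ ε := by
  have : ∀ᶠ R in (atTop : Filter ℝ), ∀ t ∈ Icc a b, t ∈ Icc a b → ∀ y x, y ≤ x → (R ≤ y ∨ x ≤ -R) → ∫ z in y..x, v t z ≤ ε := by
    apply cpt_forall isCompact_Icc
    intro t ht
    have e1 := tail_small (h.vi t ht) (half_pos hε)
    have e2 := (h.vc t ht).eventually (gt_mem_nhds (half_pos hε))
    rw [eventually_nhdsWithin_iff] at e2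
    filter_upwards [e1.prod_mk e2] with z hz hzI y x hyx hc
    have k1 := hz.1 y x hyx hc
    have k2 := hz.2 hzI
    have e : ∫ w in y..x, v z.2 w = (∫ w in y..x, (v z.2 w - v t w)) + ∫ w in y..x, v t w := by
      rw [intervalIntegral.integral_sub (h.vi _ hzI).intervalIntegrable (h.vi _ ht).intervalIntegrable]; ring
    have k3 := ii_abs_le ((h.vi _ hzI).sub (h.vi _ ht)) y x
    have k4 := le_abs_self (∫ w in y..x, (v z.2 w - v t w))
    have k5 := le_abs_self (∫ w in y..x, v t w)
    simp only [Pi.sub_apply] at k3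
    linarith
  obtain ⟨R, hR, hR0⟩ := (this.and (eventually_gt_atTop 0)).exists
  exact ⟨R, hR0, fun t ht => hR t ht ht⟩

end
end KS

namespace KS
open Set Topology

theorem snd_max {φ φ' : ℝ → ℝ} {c x0 : ℝ} (hm : IsLocalMax φ x0) (h1 : ∀ᶠ z in 𝓝 x0, HasDerivAt φ (φ' z) z)
    (h2 : HasDerivAt φ' c x0) : φ' x0 = 0 ∧ c ≤ 0 := by
  have h10 := h1.self_of_nhds
  have z0 : φ' x0 = 0 := hm.hasDerivAt_eq_zero h10
  refine ⟨z0, ?_⟩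
  by_contra hc
  push Not at hc
  have ed : deriv φ =ᶠ[𝓝 x0] φ' := h1.mono fun z hz => hz.deriv
  have dd2 : deriv (deriv φ) x0 = c := by rw [ed.deriv_eq]; exact h2.deriv
  have hmin : IsLocalMin φ x0 := isLocalMin_of_deriv_deriv_pos (by rw [dd2]; exact hc) (by rw [h10.deriv]; exact z0) h10.continuousAt
  have ec : φ =ᶠ[𝓝 x0] fun _ => φ x0 := by
    filter_upwards [hm, hmin] with z k1 k2
    exact le_antisymm k1 k2
  have e2 : deriv φ =ᶠ[𝓝 x0] fun _ => 0 := by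
    have := ec.deriv
    simpa using this
  have : deriv (deriv φ) x0 = 0 := by rw [e2.deriv_eq]; simp
  linarith

section
variable {μ B M a b : ℝ} {v g fl : ℝ → ℝ → ℝ}

theorem Lin.barrier (h : Lin μ B M a b v g fl) (hμ : 0 < μ) {Ω Ωr Ωrr Ωt : ℝ → ℝ → ℝ} {ε0 r1 : ℝ}
    (hΩc : ContinuousOn (Function.uncurry Ω) (Icc a b ×ˢ univ))
    (hε0 : 0 < ε0) (hr1 : 0 < r1) (hlow : ∀ t ∈ Icc a b, ∀ r, 0 ≤ r → ε0 ≤ Ω t r)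
    (hfar : ∀ t ∈ Icc a b, ∀ r, r1 ≤ r → M ≤ Ω t r)
    (hstart : ∀ y x, y ≤ x → ∫ z in y..x, v a z ≤ Ω a (x - y))
    (hdr : ∀ t ∈ Ico a b, ∀ r, 0 < r → HasDerivAt (Ω t) (Ωr t r) r)
    (hdrr : ∀ t ∈ Ico a b, ∀ r, 0 < r → HasDerivAt (Ωr t) (Ωrr t r) r)
    (hdt : ∀ t ∈ Ico a b, ∀ r, 0 < r → ∀ ε, 0 < ε → ∀ᶠ z in 𝓝[>] (0:ℝ) ×ˢ 𝓝 r,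
      z.1 * (Ωt t r - ε) ≤ Ω (t + z.1) z.2 - Ω t z.2)
    (hineq : ∀ t ∈ Ico a b, ∀ r, 0 < r → Ω t r ≤ M → 2 * μ * Ωrr t r + 2 * B * |Ωr t r| < Ωt t r) :
    ∀ t ∈ Icc a b, ∀ y x, y ≤ x → ∫ z in y..x, v t z ≤ Ω t (x - y) := by
  obtain ⟨R, hR, htight⟩ := h.tight hε0
  set P : Set (ℝ × ℝ) := {p | p.1 ≤ p.2} with hP
  set K : Set (ℝ × ℝ) := P ∩ (Icc (-R-r1) R ×ˢ Icc (-R) (R+r1)) with hK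
  have hPc : IsClosed P := isClosed_le continuous_fst continuous_snd
  have hKc : IsCompact K := (isCompact_Icc.prod isCompact_Icc).inter_left hPc
  set Z : ℝ → ℝ × ℝ → ℝ := fun t p => (∫ z in p.1..p.2, v t z) - Ω t (p.2 - p.1) with hZ
  have hZc : ContinuousOn (Function.uncurry Z) (Icc a b ×ˢ univ) := by
    apply h.cont.sub
    exact hΩc.comp (f := fun z : ℝ × ℝ × ℝ => (z.1, z.2.2 - z.2.1)) (by fun_prop) (fun z hz => ⟨hz.1, mem_univ _⟩)
  have main := bar (P := P) (K := K) (Z := Z) (a := a) (b := b) hKc hZc ?_ ?_ inter_subset_left ?_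
  · intro t ht y x hyx
    have := main t ht (y, x) hyx
    simp only [hZ] at this
    linarith
  · rintro ⟨y, x⟩ hp
    have hp : y ≤ x := hp
    simp only [hZ]
    linarith [hstart y x hp]
  · rintro t ht ⟨y, x⟩ hp hpK
    have hp : y ≤ x := hp
    simp only [hZ]
    rcases le_or_gt r1 (x - y) with hc | hc
    · linarith [h.bd t ht y x hp, hfar t ht (x-y) hc]
    · have : R ≤ y ∨ x ≤ -R := by
        by_contra hn
        push Not at hn
        apply hpK
        refine ⟨hp, ⟨?_, ?_⟩, ?_, ?_⟩ <;> simp only <;> linarith [hn.1, hn.2]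
      linarith [htight t ht y x hp this, hlow t ht (x-y) (by linarith)]
  · rintro t ht hle ⟨y, x⟩ hpK h0
    have htI : t ∈ Icc a b := ⟨ht.1, ht.2.le⟩
    have hyx : y ≤ x := hpK.1
    simp only [hZ] at h0
    have hlt : y < x := by
      rcases hyx.lt_or_eq with h' | h'
      · exact h'
      · exfalso
        subst h'
        rw [intervalIntegral.integral_same, sub_self] at h0
        linarith [hlow t htI 0 le_rfl]
    have hle' : ∀ y' x', y' ≤ x' → ∫ z in y'..x', v t z ≤ Ω t (x' - y') := by
      intro y' x' hh
      have := hle (y', x') hh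
      simp only [hZ] at this
      linarith
    set r := x - y with hr
    have hr0 : 0 < r := by rw [hr]; linarith
    have hI : ∫ z in y..x, v t z = Ω t r := by linarith
    have hvi := h.vi t htI
    have hvC : Continuous (v t) := (h.vd t htI).continuous
    have hvd : ∀ z, HasDerivAt (v t) (deriv (v t) z) z := fun z =>
      ((h.vd t htI).differentiable (by norm_num) z).hasDerivAt
    -- derivative in x
    have hx := snd_max (φ := fun x' => (∫ z in y..x', v t z) - Ω t (x' - y)) (φ' := fun x' => v t x' - Ωr t (x' - y))
      (c := deriv (v t) x - Ωrr t r) (x0 := x) ?_ ?_ ?_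
    rotate_left
    · filter_upwards [lt_mem_nhds hlt] with x' hx'
      have := hle' y x' hx'.le
      linarith
    · filter_upwards [lt_mem_nhds hlt] with x' hx'
      have d1 : HasDerivAt (fun x' => ∫ z in y..x', v t z) (v t x') x' :=
        intervalIntegral.integral_hasDerivAt_right hvi.intervalIntegrable
          (hvC.stronglyMeasurableAtFilter _ _) hvC.continuousAt
      have d2 := (hdr t ht (x' - y) (by linarith)).comp_sub_const x' y
      exact d1.sub d2
    · exact (hvd x).sub ((hdrr t ht (x - y) hr0).comp_sub_const x y)
    have hy := snd_max (φ := fun y' => (∫ z in y'..x, v t z) - Ω t (x - y')) (φ' := fun y' => - v t y' + Ωr t (x - y'))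
      (c := - deriv (v t) y - Ωrr t r) (x0 := y) ?_ ?_ ?_
    rotate_left
    · filter_upwards [gt_mem_nhds hlt] with y' hy'
      have := hle' y' x hy'.le
      linarith
    · filter_upwards [gt_mem_nhds hlt] with y' hy'
      have d1 : HasDerivAt (fun y' => ∫ z in y'..x, v t z) (- v t y') y' :=
        intervalIntegral.integral_hasDerivAt_left hvi.intervalIntegrable
          (hvC.stronglyMeasurableAtFilter _ _) hvC.continuousAt
      have d2 := (hdr t ht (x - y') (by linarith)).comp_const_sub x y'
      have := d1.sub d2
      rw [sub_neg_eq_add] at this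
      exact this
    · have := (hvd y).neg.add ((hdrr t ht (x - y) hr0).comp_const_sub x y)
      exact this
    have vx : v t x = Ωr t r := by linarith [hx.1]
    have vy : v t y = Ωr t r := by linarith [hy.1]
    have fx := h.flx t htI x y (by rw [vx, vy])
    rw [vx] at fx
    have eqn := h.eq t htI y x hyx (fun z => by
      rw [hI]
      have := hle' (y - z) (x - z) (by linarith)
      rwa [sub_sub_sub_cancel_right] at this)
    have ineq := hineq t ht r hr0 (by rw [← hI]; exact h.bd t htI y x hyx)
    have hG : ∫ w in y..x, g t w < Ωt t r := by
      have l1 := neg_abs_le (fl t x - fl t y)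
      have l2 : μ * (deriv (v t) x - deriv (v t) y) ≤ μ * (2 * Ωrr t r) :=
        mul_le_mul_of_nonneg_left (by linarith [hx.2, hy.2]) hμ.le
      linarith
    set G0 := ∫ w in y..x, g t w with hG0
    set ε := (Ωt t r - G0) / 3 with hε
    have hεp : 0 < ε := by rw [hε]; linarith
    -- localisation window
    set R' := max |y| |x| + 1 with hR'
    have hR'0 : 0 < R' := by positivity
    have hyR : |y| < R' := by rw [hR']; linarith [le_max_left |y| |x|]
    have hxR : |x| < R' := by rw [hR']; linarith [le_max_right |y| |x|]
    set gg : ℝ → ℝ := (Ioc (-R') R').indicator (g t) with hgg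
    have hggi : Integrable gg := (integrable_indicator_iff measurableSet_Ioc).2 (h.gi t htI R')
    have hgeq : ∀ y' x', |y'| < R' → |x'| < R' → ∫ w in y'..x', g t w = ∫ w in y'..x', gg w := by
      intro y' x' h1 h2
      apply intervalIntegral.integral_congr_ae
      refine Eventually.of_forall fun w hw => ?_
      rw [hgg, indicator_of_mem]
      rw [abs_lt] at h1 h2
      rcases le_total y' x' with hh | hh
      · rw [uIoc_of_le hh] at hw; exact ⟨by linarith [hw.1], by linarith [hw.2]⟩
      · rw [uIoc_of_ge hh] at hw; exact ⟨by linarith [hw.1], by linarith [hw.2]⟩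
    have eG : ∀ᶠ p : ℝ × ℝ in 𝓝 (y, x), ∫ w in p.1..p.2, gg w < G0 + ε := by
      apply ((prim_cont hggi).tendsto (y, x)).eventually (gt_mem_nhds _)
      simp only
      rw [← hgeq y x hyR hxR]; linarith
    have ey : ∀ᶠ p : ℝ × ℝ in 𝓝 (y, x), |p.1| < R' :=
      ((continuous_fst.abs).tendsto (y, x)).eventually (gt_mem_nhds hyR)
    have ex : ∀ᶠ p : ℝ × ℝ in 𝓝 (y, x), |p.2| < R' :=
      ((continuous_snd.abs).tendsto (y, x)).eventually (gt_mem_nhds hxR)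
    have ep : ∀ᶠ p : ℝ × ℝ in 𝓝 (y, x), p.1 < p.2 :=
      (isOpen_lt continuous_fst continuous_snd).mem_nhds hlt
    have ed := h.gr t ht R' hR'0 ε hεp
    have eo := hdt t ht r hr0 ε hεp
    have tr : Tendsto (fun p : ℝ × ℝ => p.2 - p.1) (𝓝 (y, x)) (𝓝 r) := by
      have : Continuous fun p : ℝ × ℝ => p.2 - p.1 := by fun_prop
      exact this.tendsto (y, x)
    have eo' := ((tendsto_id (x := 𝓝[>] (0:ℝ))).prodMap tr).eventually eo
    have eb : ∀ᶠ d in 𝓝[>] (0:ℝ), d ∈ Ioo 0 (b - t) := Ioo_mem_nhdsGT (by linarith [ht.2])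
    filter_upwards [eo', (ed.and eb).prod_mk (eG.and (ey.and (ex.and ep)))] with z k1 k2
    obtain ⟨⟨k2, kb⟩, k3, k4, k5, k6⟩ := k2
    obtain ⟨d, y', x'⟩ := z
    simp only [Prod.map, id] at k1 k2 kb k3 k4 k5 k6
    simp only [hZ]
    have htd : t + d ∈ Icc a b := ⟨by linarith [ht.1, kb.1], by linarith [kb.2]⟩
    have hle2 := hle' y' x' k6.le
    have sub1 : Ioc y' x' ⊆ Ioc (-R') R' := fun w hw => by
      rw [abs_lt] at k4 k5
      exact ⟨by linarith [hw.1], by linarith [hw.2]⟩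
    have ig := h.gi t htI R'
    have i0 : IntegrableOn (fun w => v (t+d) w - v t w - d * g t w) (Ioc (-R') R') :=
      ((h.vi _ htd).integrableOn.sub (h.vi _ htI).integrableOn).sub (ig.const_mul d)
    have b1 : ∫ w in y'..x', (v (t+d) w - v t w - d * g t w) ≤ ε * d := by
      refine le_trans ?_ k2
      rw [intervalIntegral.integral_of_le k6.le]
      refine (le_abs_self _).trans ((abs_integral_le_integral_abs).trans ?_)
      exact setIntegral_mono_set i0.abs (Eventually.of_forall fun _ => abs_nonneg _) sub1.eventuallyLE
    have ig' : IntervalIntegrable (g t) volume y' x' :=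
      (intervalIntegrable_iff_integrableOn_Ioc_of_le k6.le).2 (ig.mono_set sub1)
    rw [intervalIntegral.integral_sub ((h.vi _ htd).intervalIntegrable.sub hvi.intervalIntegrable) (ig'.const_mul d),
      intervalIntegral.integral_sub (h.vi _ htd).intervalIntegrable hvi.intervalIntegrable,
      intervalIntegral.integral_const_mul, hgeq y' x' k4 k5] at b1
    have hd0 := kb.1
    have : d * (∫ w in y'..x', gg w) ≤ d * (G0 + ε) := mul_le_mul_of_nonneg_left k3.le hd0.le
    have e3 : Ωt t r = G0 + 3 * ε := by rw [hε]; ring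
    rw [e3] at k1
    nlinarith

end
end KS

namespace KS
open Set Topology

theorem hdt_of {Ω Ωt : ℝ → ℝ → ℝ} {t r0 : ℝ} (hd : ∀ s, t ≤ s → ∀ r, HasDerivAt (fun s => Ω s r) (Ωt s r) s)
    (hc : ContinuousAt (Function.uncurry Ωt) (t, r0)) {ε : ℝ} (hε : 0 < ε) :
    ∀ᶠ z in 𝓝[>] (0:ℝ) ×ˢ 𝓝 r0, z.1 * (Ωt t r0 - ε) ≤ Ω (t + z.1) z.2 - Ω t z.2 := by
  have e := hc.eventually (lt_mem_nhds (by simp only [Function.uncurry]; linarith : Ωt t r0 - ε < Function.uncurry Ωt (t, r0)))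
  rw [nhds_prod_eq, eventually_prod_iff] at e
  obtain ⟨p, hp, p', hp', hpp⟩ := e
  obtain ⟨δ, hδ, hball⟩ := Metric.eventually_nhds_iff.1 hp
  have ev : ∀ᶠ d in 𝓝[>] (0:ℝ), d ∈ Ioo 0 δ := Ioo_mem_nhdsGT hδ
  filter_upwards [ev.prod_mk hp'] with z hz
  obtain ⟨c, hc1, hc2⟩ := exists_hasDerivAt_eq_slope (fun s => Ω s z.2) (fun s => Ωt s z.2) (by linarith [hz.1.1] : t < t + z.1)
    (fun s hs => (hd s hs.1 z.2).continuousAt.continuousWithinAt) (fun s hs => hd s hs.1.le z.2)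
  have k := hpp (x := c) (hball (by rw [Real.dist_eq, abs_of_pos (by linarith [hc1.1])]; linarith [hc1.2, hz.1.2])) hz.2
  simp only [Function.uncurry] at k
  rw [hc2, add_sub_cancel_left, lt_div_iff₀ hz.1.1] at k
  linarith

theorem le_of_int {w : ℝ → ℝ} (hw : Continuous w) {c : ℝ} (h : ∀ y x, y ≤ x → ∫ z in y..x, w z ≤ c * (x - y)) (x : ℝ) : w x ≤ c := by
  by_contra hn
  push Not at hn
  have e := (hw.tendsto x).eventually (lt_mem_nhds (by linarith : (c + w x)/2 < w x))
  obtain ⟨δ, hδ, hball⟩ := Metric.eventually_nhds_iff.1 e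
  have k := h x (x + δ/2) (by linarith)
  have := intervalIntegral.integral_mono_on (a := x) (b := x + δ/2) (f := fun _ => (c + w x)/2) (g := w) (μ := volume) (by linarith)
    intervalIntegrable_const (hw.intervalIntegrable _ _) (fun z hz => (hball (by
      rw [Real.dist_eq, abs_of_nonneg (by linarith [hz.1])]; linarith [hz.2])).le)
  rw [intervalIntegral.integral_const, smul_eq_mul] at this
  nlinarith

theorem abs_cont {w : ℝ → ℝ} (hw : Integrable w) {ε : ℝ} (hε : 0 < ε) :
    ∃ r0 > 0, ∀ y x, y ≤ x → x - y < r0 → ∫ z in y..x, w z ≤ ε := by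
  obtain ⟨δ, hδ, hs⟩ := exists_pos_setLIntegral_lt_of_measure_lt (μ := volume) (f := fun x => ‖w x‖ₑ) hw.2.ne (ε := ENNReal.ofReal ε) (by simpa using hε)
  obtain ⟨r0, hr0, hr1⟩ : ∃ r0 : ℝ, 0 < r0 ∧ ENNReal.ofReal r0 < δ := by
    rcases eq_or_ne δ ∞ with h | h
    · exact ⟨1, one_pos, by rw [h]; exact ENNReal.ofReal_lt_top⟩
    · have := ENNReal.toReal_pos hδ.ne' h
      refine ⟨δ.toReal / 2, half_pos this, ?_⟩
      rw [ENNReal.ofReal_lt_iff_lt_toReal (by linarith) h]; linarith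
  refine ⟨r0, hr0, fun y x hyx hlt => ?_⟩
  have h1 := hs (Ioc y x) (by
    rw [Real.volume_Ioc]
    exact (ENNReal.ofReal_le_ofReal hlt.le).trans_lt hr1)
  rw [intervalIntegral.integral_of_le hyx]
  rw [← ofReal_integral_norm_eq_lintegral_enorm hw.integrableOn] at h1
  have := ((ENNReal.ofReal_lt_ofReal_iff hε).1 h1).le
  exact (le_abs_self _).trans ((abs_integral_le_integral_abs).trans this)

section
variable {μ B M a b : ℝ} {v g fl : ℝ → ℝ → ℝ}

theorem Lin.max_princ (h : Lin μ 0 M a b v g fl) (hμ : 0 < μ) {S : ℝ} (hS : 0 ≤ S)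
    (hstart : ∀ y x, y ≤ x → ∫ z in y..x, v a z ≤ S) :
    ∀ t ∈ Icc a b, ∀ y x, y ≤ x → ∫ z in y..x, v t z ≤ S := by
  intro t ht y x hyx
  have key : ∀ ε > 0, ∫ z in y..x, v t z ≤ S + ε * (1 + (t - a) + (x - y)) := by
    intro ε hε
    refine h.barrier hμ (Ω := fun t r => S + ε * (1 + (t - a) + r)) (Ωr := fun _ _ => ε) (Ωrr := fun _ _ => 0) (Ωt := fun _ _ => ε)
      (ε0 := ε) (r1 := max (M/ε) 1) ?_ hε (by positivity) ?_ ?_ ?_ ?_ ?_ ?_ ?_ t ht y x hyx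
    · apply Continuous.continuousOn; unfold Function.uncurry; fun_prop
    · intro t ht r hr
      nlinarith [ht.1, mul_nonneg hε.le (by linarith [ht.1] : 0 ≤ t - a), mul_nonneg hε.le hr]
    · intro t ht r hr
      have := (le_max_left _ _).trans hr
      rw [div_le_iff₀ hε] at this
      nlinarith [mul_nonneg hε.le (by linarith [ht.1] : 0 ≤ t - a)]
    · intro y x hyx
      have := hstart y x hyx
      nlinarith [mul_nonneg hε.le (by linarith : 0 ≤ x - y)]
    · intro t _ r _
      have := (((hasDerivAt_id r).const_add (1 + (t - a))).const_mul ε).const_add S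
      simpa using this
    · intro t _ r _; exact hasDerivAt_const _ _
    · intro t _ r _ e he
      apply hdt_of (Ω := fun t r => S + ε * (1 + (t - a) + r)) (Ωt := fun _ _ => ε) _ _ he
      · intro s _ r
        have := ((((hasDerivAt_id s).sub_const a).const_add 1).add_const r).const_mul ε |>.const_add S
        simpa using this
      · exact continuousAt_const
    · intro t _ r _ _; simpa using hε
  have lim : Tendsto (fun ε : ℝ => S + ε * (1 + (t - a) + (x - y))) (𝓝[>] 0) (𝓝 (S + 0 * (1 + (t - a) + (x - y)))) := by
    apply Tendsto.mono_left _ nhdsWithin_le_nhds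
    exact (by fun_prop : Continuous fun ε : ℝ => S + ε * (1 + (t - a) + (x - y))).tendsto 0
  rw [zero_mul, add_zero] at lim
  exact ge_of_tendsto lim (by filter_upwards [self_mem_nhdsWithin] with ε hε; exact key ε hε)

noncomputable def mkap (μ β s : ℝ) : ℝ := (Real.sqrt (μ * s + β))⁻¹

theorem mkap_hd {μ β s : ℝ} (h : 0 < μ * s + β) : HasDerivAt (mkap μ β) (-(μ/2) * (mkap μ β s)^3) s := by
  have h1 : HasDerivAt (fun s => μ * s + β) μ s := by simpa using ((hasDerivAt_id s).const_mul μ).add_const β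
  have sp : 0 < Real.sqrt (μ * s + β) := Real.sqrt_pos.2 h
  have h2 := (h1.sqrt h.ne').fun_inv sp.ne'
  refine HasDerivAt.congr_deriv (f := mkap μ β) h2 ?_
  unfold mkap
  field_simp

theorem Lin.sup (h : Lin μ B M a b v g fl) (hμ : 0 < μ) (hB : 0 ≤ B) (hM : 0 < M) (hBs : 4 * B^2 * (b - a) < μ) :
    ∀ t ∈ Ioc a b, ∀ x, v t x ≤ 2 * M * (Real.sqrt (μ * (t - a)))⁻¹ := by
  intro t ht
  have htI : t ∈ Icc a b := Ioc_subset_Icc_self ht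
  have hab : a ≤ b := htI.1.trans htI.2
  apply le_of_int (h.vd t htI).continuous
  intro y x hyx
  have st : 0 < Real.sqrt (μ * (t - a)) := Real.sqrt_pos.2 (mul_pos hμ (by linarith [ht.1]))
  have key : ∀ ε > 0, ∫ z in y..x, v t z ≤ ε + 2 * M * (Real.sqrt (μ * (t - a)))⁻¹ * (x - y) := by
    intro ε hε
    obtain ⟨r0, hr0, habs⟩ := abs_cont (h.vi a ⟨le_rfl, hab⟩) hε
    set δ := μ * (μ - 4 * B^2 * (b - a)) with hδ
    have hδp : 0 < δ := mul_pos hμ (by linarith)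
    set β := min (r0^2) (δ / (4 * B^2 + 1)) with hβ
    have hβp : 0 < β := by positivity
    have hβ1 : β ≤ r0^2 := min_le_left _ _
    have hβ2 : 4 * B^2 * β ≤ δ := by
      have : β ≤ δ / (4 * B^2 + 1) := min_le_right _ _
      rw [le_div_iff₀ (by positivity)] at this
      nlinarith
    have pos : ∀ s, a ≤ s → 0 < μ * (s - a) + β := fun s hs => by
      have := mul_nonneg hμ.le (sub_nonneg.2 hs); linarith
    set m : ℝ → ℝ := fun s => mkap μ β (s - a) with hm
    have mpos : ∀ s, a ≤ s → 0 < m s := fun s hs => inv_pos.2 (Real.sqrt_pos.2 (pos s hs))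
    have mhd : ∀ s, a ≤ s → HasDerivAt m (-(μ/2) * (m s)^3) s := fun s hs => by
      have := mkap_hd (pos s hs)
      exact this.comp_sub_const s a
    have mc : ∀ s, a ≤ s → ContinuousAt m s := fun s hs => (mhd s hs).continuousAt
    have half : ∀ z : ℝ, 1 ≤ z → Real.exp (-z) ≤ 1/2 := by
      intro z hz
      have h1 : Real.exp (-z) ≤ Real.exp (-1) := Real.exp_le_exp.2 (by linarith)
      have h2 : Real.exp (-1) * Real.exp 1 = 1 := by rw [← Real.exp_add]; simp
      have h3 := Real.add_one_le_exp 1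
      nlinarith [Real.exp_pos (-1)]
    have mlow : ∀ s ∈ Icc a b, 2 * B ≤ μ * m s := by
      intro s hs
      have sp := Real.sqrt_pos.2 (pos s hs.1)
      simp only [hm, mkap]
      rw [← div_eq_mul_inv, le_div_iff₀ sp]
      apply abs_le_of_sq_le_sq' _ hμ.le |>.2
      rw [mul_pow, Real.sq_sqrt (pos s hs.1).le]
      have : 4 * B^2 * (μ * (s - a)) ≤ 4 * B^2 * (μ * (b - a)) := by
        apply mul_le_mul_of_nonneg_left _ (by positivity)
        apply mul_le_mul_of_nonneg_left _ hμ.le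
        linarith [hs.2]
      nlinarith
    have bar := h.barrier hμ (Ω := fun s r => ε + 2 * M * (1 - Real.exp (-(r * m s))))
      (Ωr := fun s r => 2 * M * (m s * Real.exp (-(r * m s)))) (Ωrr := fun s r => 2 * M * (-(m s)^2 * Real.exp (-(r * m s))))
      (Ωt := fun s r => 2 * M * (r * (-(μ/2) * (m s)^3) * Real.exp (-(r * m s))))
      (ε0 := ε) (r1 := max (Real.sqrt (μ * (b - a) + β)) 1) ?_ hε (by positivity) ?_ ?_ ?_ ?_ ?_ ?_ ?_ t htI y x hyx
    · refine bar.trans ?_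
      have e1 : 1 - Real.exp (-((x-y) * m t)) ≤ (x - y) * m t := by
        have := Real.add_one_le_exp (-((x-y) * m t)); linarith
      have e2 : m t ≤ (Real.sqrt (μ * (t - a)))⁻¹ := by
        simp only [hm, mkap]
        apply inv_anti₀ st
        apply Real.sqrt_le_sqrt; linarith
      have e3 : (x - y) * m t ≤ (x - y) * (Real.sqrt (μ * (t - a)))⁻¹ := mul_le_mul_of_nonneg_left e2 (by linarith)
      have : 2 * M * (1 - Real.exp (-((x-y) * m t))) ≤ 2 * M * ((x - y) * (Real.sqrt (μ * (t - a)))⁻¹) :=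
        mul_le_mul_of_nonneg_left (e1.trans e3) (by linarith)
      linarith
    · rintro ⟨s, r⟩ ⟨hs, -⟩
      apply ContinuousAt.continuousWithinAt
      have c1 : ContinuousAt (fun z : ℝ × ℝ => m z.1) (s, r) := ContinuousAt.comp (g := m) (f := Prod.fst) (mc s hs.1) continuousAt_fst
      have c2 : ContinuousAt (fun z : ℝ × ℝ => Real.exp (-(z.2 * m z.1))) (s, r) := (continuousAt_snd.mul c1).neg.rexp
      exact continuousAt_const.add (continuousAt_const.mul (continuousAt_const.sub c2))
    · intro s hs r hr
      have := Real.exp_le_one_iff.2 (by have := mul_nonneg hr (mpos s hs.1).le; linarith : -(r * m s) ≤ 0)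
      nlinarith
    · intro s hs r hr
      have h1 := (le_max_left _ _).trans hr
      have : 1 ≤ r * m s := by
        have sp := Real.sqrt_pos.2 (pos s hs.1)
        simp only [hm, mkap]
        rw [← div_eq_mul_inv, le_div_iff₀ sp, one_mul]
        refine le_trans (Real.sqrt_le_sqrt ?_) h1
        have := mul_le_mul_of_nonneg_left (by linarith [hs.2] : s - a ≤ b - a) hμ.le
        linarith
      have := half _ this
      nlinarith
    · intro y x hyx
      rcases lt_or_ge (x - y) r0 with hc | hc
      · have h1 := habs y x hyx hc
        have := Real.exp_le_one_iff.2 (by have := mul_nonneg (by linarith : 0 ≤ x - y) (mpos a le_rfl).le; linarith : -((x-y) * m a) ≤ 0)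
        nlinarith
      · have h1 := h.bd a ⟨le_rfl, hab⟩ y x hyx
        have : 1 ≤ (x - y) * m a := by
          simp only [hm, mkap]
          rw [sub_self, mul_zero, zero_add, ← div_eq_mul_inv, le_div_iff₀ (Real.sqrt_pos.2 hβp), one_mul]
          refine le_trans ?_ hc
          rw [Real.sqrt_le_left hr0.le]; exact hβ1
        have := half _ this
        nlinarith
    · intro s hs r hr
      have h1 : HasDerivAt (fun r => -(r * m s)) (-(m s)) r := ((hasDerivAt_id r).mul_const (m s)).fun_neg.congr_deriv (by simp)
      have := ((h1.exp.const_sub 1).const_mul (2*M)).const_add ε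
      exact this.congr_deriv (by ring)
    · intro s hs r hr
      have h1 : HasDerivAt (fun r => -(r * m s)) (-(m s)) r := ((hasDerivAt_id r).mul_const (m s)).fun_neg.congr_deriv (by simp)
      have := ((h1.exp.const_mul (m s)).const_mul (2*M))
      exact this.congr_deriv (by ring)
    · intro s hs r hr e he
      apply hdt_of (Ω := fun s r => ε + 2 * M * (1 - Real.exp (-(r * m s))))
        (Ωt := fun s r => 2 * M * (r * (-(μ/2) * (m s)^3) * Real.exp (-(r * m s)))) _ _ he
      · intro s' hs' r'
        have h1 : HasDerivAt (fun s => -(r' * m s)) (-(r' * (-(μ/2) * (m s')^3))) s' := ((mhd s' (hs.1.trans hs')).const_mul r').fun_neg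
        have := ((h1.exp.const_sub 1).const_mul (2*M)).const_add ε
        exact this.congr_deriv (by ring)
      · have c1 : ContinuousAt (fun z : ℝ × ℝ => m z.1) (s, r) := ContinuousAt.comp (g := m) (f := Prod.fst) (mc s hs.1) continuousAt_fst
        have c2 : ContinuousAt (fun z : ℝ × ℝ => Real.exp (-(z.2 * m z.1))) (s, r) := (continuousAt_snd.mul c1).neg.rexp
        exact continuousAt_const.mul ((continuousAt_snd.mul (continuousAt_const.mul (c1.pow 3))).mul c2)
    · intro s hs r hr hle
      have hmp := mpos s hs.1
      have rm : r * m s < 1 := by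
        by_contra hn
        push Not at hn
        have := half _ hn
        nlinarith
      have hml := mlow s ⟨hs.1, hs.2.le⟩
      have ep := Real.exp_pos (-(r * m s))
      rw [abs_of_pos (by positivity)]
      set E := Real.exp (-(r * m s))
      set n := m s
      have : 2 * M * (r * (-(μ/2) * n^3) * E) - (2 * μ * (2 * M * (-n^2 * E)) + 2 * B * (2 * M * (n * E)))
        = (M * n * E) * (μ * n * (4 - r * n) - 4 * B) := by ring
      have p2 : 0 < μ * n * (4 - r * n) - 4 * B := by
        have : 0 < μ * n := mul_pos hμ hmp
        nlinarith
      have : 0 < (M * n * E) * (μ * n * (4 - r * n) - 4 * B) := by positivity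
      linarith
  have lim : Tendsto (fun ε : ℝ => ε + 2 * M * (Real.sqrt (μ * (t - a)))⁻¹ * (x - y)) (𝓝[>] 0) (𝓝 (0 + 2 * M * (Real.sqrt (μ * (t - a)))⁻¹ * (x - y))) := by
    apply Tendsto.mono_left _ nhdsWithin_le_nhds
    exact (by fun_prop : Continuous fun ε : ℝ => ε + 2 * M * (Real.sqrt (μ * (t - a)))⁻¹ * (x - y)).tendsto 0
  rw [zero_add] at lim
  exact ge_of_tendsto lim (by filter_upwards [self_mem_nhdsWithin] with ε hε; exact key ε hε)

end
end KS

namespace KS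
open Set Topology

structure Ker (k : ℝ → ℝ) : Prop where
  k0 : ∀ x, 0 ≤ k x
  ki : Integrable k
  k1 : ∫ x, k x = 1

/-- convolution -/
noncomputable def cv (k w : ℝ → ℝ) (x : ℝ) : ℝ := ∫ z, k z * w (x - z)

noncomputable def NL (k w : ℝ → ℝ) (y x : ℝ) : ℝ := (∫ z, k z * ∫ t in (y-z)..(x-z), w t) - ∫ t in y..x, w t

section
variable {k w w' : ℝ → ℝ}

theorem cv_prod (hk : Integrable k) (hw : Integrable w) :
    Integrable (fun p : ℝ × ℝ => k p.2 * w (p.1 - p.2)) (volume.prod volume) :=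
  hk.convolution_integrand (ContinuousLinearMap.mul ℝ ℝ) hw

theorem cv_int (hk : Integrable k) (hw : Integrable w) : Integrable (cv k w) :=
  (cv_prod hk hw).integral_prod_left

theorem cv_ae (hk : Integrable k) (hw : Integrable w) : ∀ᵐ x, Integrable fun z => k z * w (x - z) :=
  (cv_prod hk hw).prod_right_ae

theorem cv_bd (hk : Ker k) (hw : Integrable w) : ∫ x, |cv k w x| ≤ ∫ x, |w x| := by
  have h1 : ∫ x, cv k (fun x => |w x|) x = ∫ x, |w x| := by
    have := integral_convolution (ContinuousLinearMap.mul ℝ ℝ) (μ := volume) (ν := volume) hk.ki hw.abs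
    rw [hk.k1] at this
    simpa [cv, convolution] using this
  rw [← h1]
  apply integral_mono (cv_int hk.ki hw).abs (cv_int hk.ki hw.abs)
  intro x
  refine (abs_integral_le_integral_abs).trans (le_of_eq ?_)
  unfold cv
  congr 1; ext z
  rw [abs_mul, abs_of_nonneg (hk.k0 z)]

theorem NL_ii (hk : Integrable k) (hw : Integrable w) (y x : ℝ) :
    Integrable fun z => k z * ∫ t in (y-z)..(x-z), w t := by
  apply (hk.abs.mul_const (∫ x, |w x|)).mono'
  · apply hk.aestronglyMeasurable.mul
    have : Continuous fun z : ℝ => ∫ t in (y-z)..(x-z), w t :=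
      (prim_cont hw).comp (by fun_prop : Continuous fun z : ℝ => (y - z, x - z))
    exact this.aestronglyMeasurable
  · refine Eventually.of_forall fun z => ?_
    rw [norm_mul, Real.norm_eq_abs, Real.norm_eq_abs]
    exact mul_le_mul_of_nonneg_left (ii_abs_le hw _ _) (abs_nonneg _)

theorem cv_fub (hk : Integrable k) (hw : Integrable w) {y x : ℝ} (hyx : y ≤ x) :
    ∫ t in y..x, (cv k w t - w t) = NL k w y x := by
  rw [intervalIntegral.integral_sub (cv_int hk hw).intervalIntegrable hw.intervalIntegrable]
  unfold NL
  congr 1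
  rw [intervalIntegral.integral_of_le hyx]
  unfold cv
  rw [integral_integral_swap (f := fun t z => k z * w (t - z))]
  · congr 1; ext z
    rw [integral_const_mul, ← intervalIntegral.integral_of_le hyx, intervalIntegral.integral_comp_sub_right]
  · refine (cv_prod hk hw).mono_measure ?_
    exact Measure.prod_mono Measure.restrict_le_self le_rfl

theorem NL_nonpos (hk : Ker k) (hw : Integrable w) {y x : ℝ}
    (h : ∀ z, ∫ t in (y-z)..(x-z), w t ≤ ∫ t in y..x, w t) : NL k w y x ≤ 0 := by
  have := integral_mono (NL_ii hk.ki hw y x) (hk.ki.mul_const (∫ t in y..x, w t))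
    (fun z => mul_le_mul_of_nonneg_left (h z) (hk.k0 z))
  rw [integral_mul_const, hk.k1, one_mul] at this
  unfold NL; linarith

theorem NL_smul (c : ℝ) (y x : ℝ) : NL k (fun t => c * w t) y x = c * NL k w y x := by
  unfold NL
  simp only [intervalIntegral.integral_const_mul]
  rw [mul_sub, ← integral_const_mul]
  congr 2; ext z; ring

theorem NL_sub (hk : Integrable k) (hw : Integrable w) (hw' : Integrable w') (y x : ℝ) :
    NL k (fun t => w t - w' t) y x = NL k w y x - NL k w' y x := by
  unfold NL
  have : ∀ y x, ∫ t in y..x, (w t - w' t) = (∫ t in y..x, w t) - ∫ t in y..x, w' t := fun y x =>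
    intervalIntegral.integral_sub hw.intervalIntegrable hw'.intervalIntegrable
  simp only [this, mul_sub]
  rw [integral_sub (NL_ii hk hw y x) (NL_ii hk hw' y x)]
  ring

theorem NL_shift (r y x : ℝ) : NL k (fun t => w (t + r)) y x = NL k w (y+r) (x+r) := by
  unfold NL
  simp only [intervalIntegral.integral_comp_add_right (f := w)]
  congr 2; ext z; congr 2 <;> ring
end

structure KSol (q μ c0 : ℝ) (k : ℝ → ℝ) (u : ℝ → ℝ → ℝ) : Prop where
  hk : Ker k
  hc : 0 < c0
  sol : Sol q μ u (fun t x => c0 * (cv k (u t) x - u t x))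

section
variable {q μ c0 : ℝ} {k : ℝ → ℝ} {u : ℝ → ℝ → ℝ}

theorem KSol.eq (h : KSol q μ c0 k u) {t : ℝ} (ht : 0 < t) {y x : ℝ} (hyx : y ≤ x) :
    ∫ w in y..x, gt u t w = -(Hf q (u t x) - Hf q (u t y)) + μ * (deriv (u t) x - deriv (u t) y) + c0 * NL k (u t) y x := by
  have S := h.sol
  have U := S.ux t ht
  have e : gt u t = fun x => (- (|u t x| ^ (q - 1) * deriv (u t) x) + μ * deriv (deriv (u t)) x) + c0 * (cv k (u t) x - u t x) := by
    ext x; exact S.pde t ht x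
  have c1 : Continuous fun x => |u t x| ^ (q - 1) * deriv (u t) x :=
    ((F_continuous S.hq).comp U.continuous).mul (c2_cont1 U)
  rw [e, intervalIntegral.integral_add, intervalIntegral.integral_add, intervalIntegral.integral_const_mul,
    intervalIntegral.integral_const_mul, cv_fub h.hk.ki (S.ui t ht) hyx, intervalIntegral.integral_neg]
  · congr 2
    · congr 1
      apply intervalIntegral.integral_eq_sub_of_hasDerivAt (f := fun x => Hf q (u t x))
      · intro z _; exact (Hf_hasDerivAt S.hq (u t z)).comp z (c2_hd U z)
      · exact c1.intervalIntegrable _ _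
    · congr 1
      apply intervalIntegral.integral_eq_sub_of_hasDerivAt
      · intro z _; exact c2_hd2 U z
      · exact (c2_cont2 U).intervalIntegrable _ _
  · exact c1.neg.intervalIntegrable _ _
  · exact ((c2_cont2 U).const_mul μ).intervalIntegrable _ _
  · exact (c1.neg.add ((c2_cont2 U).const_mul μ)).intervalIntegrable _ _
  · exact (((cv_int h.hk.ki (S.ui t ht)).sub (S.ui t ht)).const_mul c0).intervalIntegrable

theorem KSol.mk' (hk : Ker k) (hc : 0 < c0) (hq : 1 < q) (hμ : 0 < μ) (ui : ∀ t, 0 < t → Integrable (u t))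
    (uc : ∀ t₀, 0 < t₀ → Tendsto (fun t => ∫ x, |u t x - u t₀ x|) (𝓝 t₀) (𝓝 0))
    (ux : ∀ t, 0 < t → ContDiff ℝ 2 (u t)) (ut : ∀ x, ContDiffOn ℝ 1 (fun s => u s x) (Ioi 0))
    (pde : ∀ t, 0 < t → ∀ x, deriv (fun s => u s x) t + |u t x| ^ (q - 1) * deriv (u t) x
      = c0 * ((∫ y, k (x - y) * u t y) - u t x) + μ * deriv (deriv (u t)) x) : KSol q μ c0 k u where
  hk := hk
  hc := hc
  sol := {
    hq := hq
    hμ := hμ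
    ui := ui
    uc := uc
    fi := fun t ht => ((cv_int hk.ki (ui t ht)).sub (ui t ht)).const_mul c0
    fc := by
      intro t₀ ht₀
      have lim : Tendsto (fun t => c0 * (2 * ∫ x, |u t x - u t₀ x|)) (𝓝 t₀) (𝓝 0) := by
        simpa using ((uc t₀ ht₀).const_mul 2).const_mul c0
      refine tendsto_of_tendsto_of_tendsto_of_le_of_le' tendsto_const_nhds lim
        (Eventually.of_forall fun t => integral_nonneg fun x => abs_nonneg _) ?_
      filter_upwards [Ioi_mem_nhds ht₀] with t ht
      have hd : Integrable (fun x => u t x - u t₀ x) := (ui t ht).sub (ui t₀ ht₀)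
      have e : (fun x => |c0 * (cv k (u t) x - u t x) - c0 * (cv k (u t₀) x - u t₀ x)|) =ᵐ[volume]
          fun x => c0 * |cv k (fun x => u t x - u t₀ x) x - (u t x - u t₀ x)| := by
        filter_upwards [cv_ae hk.ki (ui t ht), cv_ae hk.ki (ui t₀ ht₀)] with x h1 h2
        have : cv k (fun x => u t x - u t₀ x) x = cv k (u t) x - cv k (u t₀) x := by
          unfold cv; rw [← integral_sub h1 h2]; simp only [mul_sub]
        rw [this, ← abs_of_pos hc, ← abs_mul, abs_of_pos hc]
        congr 1; ring
      rw [integral_congr_ae e, integral_const_mul]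
      apply mul_le_mul_of_nonneg_left _ hc.le
      have := cv_bd hk hd
      calc _ ≤ ∫ x, (|cv k (fun x => u t x - u t₀ x) x| + |u t x - u t₀ x|) := by
            apply integral_mono ((cv_int hk.ki hd).sub hd).abs ((cv_int hk.ki hd).abs.add hd.abs)
            intro x; exact abs_sub _ _
        _ = (∫ x, |cv k (fun x => u t x - u t₀ x) x|) + ∫ x, |u t x - u t₀ x| := integral_add (cv_int hk.ki hd).abs hd.abs
        _ ≤ _ := by linarith
    ux := ux
    ut := ut
    pde := by
      intro t ht x
      have e : cv k (u t) x = ∫ y, k (x - y) * u t y := by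
        unfold cv
        rw [← integral_sub_left_eq_self (fun y => k (x - y) * u t y) volume x]
        simp
      have := pde t ht x
      rw [← e] at this
      first | linarith | (unfold gt; linarith) }
end
end KS

namespace KS
open Set Topology

section
variable {q μ c0 : ℝ} {k : ℝ → ℝ} {u : ℝ → ℝ → ℝ}

theorem KSol.neg (h : KSol q μ c0 k u) : KSol q μ c0 k (fun t x => - u t x) where
  hk := h.hk
  hc := h.hc
  sol := by
    have := h.sol.neg
    have e : (fun t x => -(c0 * (cv k (u t) x - u t x))) = fun t x => c0 * (cv k (fun x => - u t x) x - - u t x) := by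
      ext t x
      have : cv k (fun x => - u t x) x = - cv k (u t) x := by
        unfold cv; rw [← integral_neg]; simp only [mul_neg]
      rw [this]; ring
    rw [e] at this
    exact this

theorem KSol.massbd (h : KSol q μ c0 k u) {a b : ℝ} (ha : 0 < a) : ∃ M > 0, ∀ t ∈ Icc a b, ∫ x, |u t x| ≤ M := by
  have c : ContinuousOn (fun t => ∫ x, |u t x|) (Icc a b) := by
    intro t₀ ht₀
    have h0 : 0 < t₀ := ha.trans_le ht₀.1
    apply ContinuousAt.continuousWithinAt
    rw [ContinuousAt, tendsto_iff_dist_tendsto_zero]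
    refine tendsto_of_tendsto_of_tendsto_of_le_of_le' tendsto_const_nhds (h.sol.uc t₀ h0)
      (Eventually.of_forall fun t => dist_nonneg) ?_
    filter_upwards [Ioi_mem_nhds h0] with t ht
    rw [Real.dist_eq, ← integral_sub (h.sol.ui t ht).abs (h.sol.ui t₀ h0).abs]
    refine abs_integral_le_integral_abs.trans ?_
    apply integral_mono ((h.sol.ui t ht).abs.sub (h.sol.ui t₀ h0).abs).abs ((h.sol.ui t ht).sub (h.sol.ui t₀ h0)).abs
    intro x; exact abs_abs_sub_abs_le_abs_sub _ _
  obtain ⟨M, hM⟩ := (isCompact_Icc.image_of_continuousOn c).bddAbove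
  exact ⟨max M 1, by positivity, fun t ht => (hM (mem_image_of_mem _ ht)).trans (le_max_left _ _)⟩

theorem KSol.linU (h : KSol q μ c0 k u) {a b M : ℝ} (ha : 0 < a) (hM : ∀ t ∈ Icc a b, ∫ x, |u t x| ≤ M) :
    Lin μ 0 M a b u (gt u) (fun t x => Hf q (u t x)) where
  vi := fun t ht => h.sol.ui t (ha.trans_le ht.1)
  vc := fun t ht => (h.sol.uc t (ha.trans_le ht.1)).mono_left nhdsWithin_le_nhds
  vd := fun t ht => (h.sol.ux t (ha.trans_le ht.1)).of_le (by norm_num)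
  gi := fun t ht R => h.sol.gint (ha.trans_le ht.1) R
  gr := fun t ht R hR ε hε => h.sol.right hR (ha.trans_le ht.1) hε
  eq := by
    intro t ht y x hyx hz
    have t0 := ha.trans_le ht.1
    rw [h.eq t0 hyx]
    have := NL_nonpos h.hk (h.sol.ui t t0) hz
    have := mul_nonpos_of_nonneg_of_nonpos h.hc.le this
    linarith
  flx := by intro t ht x y e; simp [e]
  bd := fun t ht y x hyx => (le_abs_self _).trans ((ii_abs_le (h.sol.ui t (ha.trans_le ht.1)) y x).trans (hM t ht))

theorem KSol.linD (h : KSol q μ c0 k u) {a b B r : ℝ} (ha : 0 < a) (hr : 0 < r) (hB : ∀ t ∈ Icc a b, ∀ x, |u t x| ≤ B) :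
    Lin μ (B^(q-1)) (2*B) a b (fun t x => r⁻¹ * (u t (x+r) - u t x)) (fun t x => r⁻¹ * (gt u t (x+r) - gt u t x))
      (fun t x => r⁻¹ * (Hf q (u t (x+r)) - Hf q (u t x))) where
  vi := fun t ht => by
    have := h.sol.ui t (ha.trans_le ht.1)
    exact ((this.comp_add_right r).sub this).const_mul _
  vc := by
    intro t₀ ht₀
    have t0 := ha.trans_le ht₀.1
    have lim : Tendsto (fun t => r⁻¹ * (2 * ∫ x, |u t x - u t₀ x|)) (𝓝[Icc a b] t₀) (𝓝 0) := by
      simpa using (((h.sol.uc t₀ t0).mono_left nhdsWithin_le_nhds).const_mul 2).const_mul r⁻¹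
    refine tendsto_of_tendsto_of_tendsto_of_le_of_le' tendsto_const_nhds lim
        (Eventually.of_forall fun t => integral_nonneg fun x => abs_nonneg _) ?_
    filter_upwards [self_mem_nhdsWithin] with t ht
    have hd : Integrable (fun x => u t x - u t₀ x) := (h.sol.ui t (ha.trans_le ht.1)).sub (h.sol.ui t₀ t0)
    have hd' := hd.comp_add_right r
    calc _ = ∫ x, r⁻¹ * |(u t (x+r) - u t₀ (x+r)) - (u t x - u t₀ x)| := by
          congr 1; ext x
          rw [← abs_of_pos (inv_pos.2 hr), ← abs_mul, abs_of_pos (inv_pos.2 hr)]; congr 1; ring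
      _ = r⁻¹ * ∫ x, |(u t (x+r) - u t₀ (x+r)) - (u t x - u t₀ x)| := integral_const_mul _ _
      _ ≤ r⁻¹ * ∫ x, (|u t (x+r) - u t₀ (x+r)| + |u t x - u t₀ x|) := by
          apply mul_le_mul_of_nonneg_left _ (inv_pos.2 hr).le
          apply integral_mono (hd'.sub hd).abs (hd'.abs.add hd.abs)
          intro x; exact abs_sub _ _
      _ = _ := by
          rw [integral_add hd'.abs hd.abs, integral_add_right_eq_self (fun x => |u t x - u t₀ x|) r]; ring
  vd := fun t ht => by
    have := (h.sol.ux t (ha.trans_le ht.1)).of_le (m := 1) (by norm_num)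
    exact contDiff_const.mul ((this.comp (contDiff_id.add contDiff_const)).sub this)
  gi := by
    intro t ht R
    have t0 := ha.trans_le ht.1
    rcases le_or_gt R 0 with hR | hR
    · rw [Ioc_eq_empty (by linarith)]; exact integrableOn_empty
    have g1 := h.sol.gint t0 (R + r)
    refine ((?_ : IntegrableOn (fun x => gt u t (x + r)) (Ioc (-R) R)).sub (h.sol.gint t0 R)).const_mul _
    have : IntegrableOn (gt u t) (Ioc (-R + r) (R + r)) := g1.mono_set (Ioc_subset_Ioc (by linarith) le_rfl)
    rw [← intervalIntegrable_iff_integrableOn_Ioc_of_le (by linarith)] at this ⊢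
    have := this.comp_add_right r
    simpa using this
  gr := by
    intro t ht R hR ε hε
    have t0 := ha.trans_le ht.1
    filter_upwards [h.sol.right (by linarith : 0 < R + r) t0 (by positivity : 0 < ε * r / 2), self_mem_nhdsWithin] with d hd hdp
    have td : 0 < t + d := by have : 0 < d := hdp; linarith
    set E : ℝ → ℝ := fun x => u (t+d) x - u t x - d * gt u t x with hE
    have Ei : ∀ A, IntegrableOn E (Ioc (-A) A) := fun A =>
      ((h.sol.ui _ td).integrableOn.sub (h.sol.ui t t0).integrableOn).sub ((h.sol.gint t0 A).const_mul d)
    have Ei1 : IntegrableOn E (Ioc (-R + r) (R + r)) := (Ei (R+r)).mono_set (Ioc_subset_Ioc (by linarith) le_rfl)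
    have Ei2 : IntegrableOn (fun x => E (x + r)) (Ioc (-R) R) := by
      rw [← intervalIntegrable_iff_integrableOn_Ioc_of_le (by linarith)] at Ei1 ⊢
      have := Ei1.comp_add_right r
      simpa using this
    have s1 : ∫ x in Ioc (-R) R, |E (x + r)| ≤ ∫ x in Ioc (-(R+r)) (R+r), |E x| := by
      rw [← intervalIntegral.integral_of_le (by linarith), intervalIntegral.integral_comp_add_right (fun x => |E x|),
        intervalIntegral.integral_of_le (by linarith)]
      exact setIntegral_mono_set (Ei _).abs (Eventually.of_forall fun _ => abs_nonneg _)
        (Ioc_subset_Ioc (by linarith) le_rfl).eventuallyLE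
    have s2 : ∫ x in Ioc (-R) R, |E x| ≤ ∫ x in Ioc (-(R+r)) (R+r), |E x| :=
      setIntegral_mono_set (Ei _).abs (Eventually.of_forall fun _ => abs_nonneg _)
        (Ioc_subset_Ioc (by linarith) (by linarith)).eventuallyLE
    calc _ = ∫ x in Ioc (-R) R, r⁻¹ * |E (x+r) - E x| := by
          congr 1; ext x
          rw [← abs_of_pos (inv_pos.2 hr), ← abs_mul, abs_of_pos (inv_pos.2 hr)]; congr 1; simp only [hE]; ring
      _ = r⁻¹ * ∫ x in Ioc (-R) R, |E (x+r) - E x| := integral_const_mul _ _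
      _ ≤ r⁻¹ * ∫ x in Ioc (-R) R, (|E (x+r)| + |E x|) := by
          apply mul_le_mul_of_nonneg_left _ (inv_pos.2 hr).le
          apply integral_mono (Ei2.sub (Ei R)).abs (Ei2.abs.add (Ei R).abs)
          intro x; exact abs_sub _ _
      _ = r⁻¹ * ((∫ x in Ioc (-R) R, |E (x+r)|) + ∫ x in Ioc (-R) R, |E x|) := by
          rw [integral_add Ei2.abs (Ei R).abs]
      _ ≤ r⁻¹ * (ε * r / 2 * d + ε * r / 2 * d) := by
          apply mul_le_mul_of_nonneg_left _ (inv_pos.2 hr).le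
          linarith
      _ = _ := by field_simp; ring
  eq := by
    intro t ht y x hyx hz
    have t0 := ha.trans_le ht.1
    have ui := h.sol.ui t t0
    have gii : ∀ y x, IntervalIntegrable (gt u t) volume y x := fun y x => by
      have := h.sol.gint t0 (|y| + |x| + 1)
      rw [intervalIntegrable_iff]
      refine this.mono_set (Ioc_subset_Ioc (le_min ?_ ?_) (max_le ?_ ?_)) <;>
        linarith [abs_nonneg x, abs_nonneg y, neg_abs_le x, neg_abs_le y, le_abs_self x, le_abs_self y]
    have e1 : ∫ w in y..x, r⁻¹ * (gt u t (w+r) - gt u t w) = r⁻¹ * ((∫ w in (y+r)..(x+r), gt u t w) - ∫ w in y..x, gt u t w) := by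
      rw [intervalIntegral.integral_const_mul, intervalIntegral.integral_sub _ (gii _ _),
        intervalIntegral.integral_comp_add_right (fun x => gt u t x)]
      have := (gii (y+r) (x+r)).comp_add_right r
      simpa using this
    rw [e1, h.eq t0 hyx, h.eq t0 (by linarith : y + r ≤ x + r)]
    have n := NL_nonpos h.hk (((ui.comp_add_right r).sub ui).const_mul r⁻¹) hz
    have e2 := NL_smul (k := k) (w := fun x => u t (x+r) - u t x) r⁻¹ y x
    rw [NL_sub h.hk.ki (ui.comp_add_right r) ui, NL_shift] at e2
    have n' : r⁻¹ * (NL k (u t) (y + r) (x + r) - NL k (u t) y x) ≤ 0 := by rw [← e2]; exact n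
    have n3 := mul_nonpos_of_nonneg_of_nonpos h.hc.le n'
    have hdv : ∀ x, deriv (fun x => r⁻¹ * (u t (x+r) - u t x)) x = r⁻¹ * (deriv (u t) (x+r) - deriv (u t) x) := fun x =>
      ((((c2_hd (h.sol.ux t t0) (x+r)).comp_add_const x r).sub (c2_hd (h.sol.ux t t0) x)).const_mul r⁻¹).deriv
    rw [hdv, hdv]
    linarith
  flx := by
    intro t ht x y e
    have key : ∀ x, |r⁻¹ * (Hf q (u t (x+r)) - Hf q (u t x))| ≤ B^(q-1) * |r⁻¹ * (u t (x+r) - u t x)| := by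
      intro x
      rw [abs_mul, abs_mul]
      have := Hf_lip h.sol.hq (hB t ht (x+r)) (hB t ht x)
      have := mul_le_mul_of_nonneg_left this (abs_nonneg r⁻¹)
      linarith
    have k1 := key x
    have k2 := key y
    rw [← e] at k2
    refine (abs_sub _ _).trans ?_
    linarith
  bd := by
    intro t ht y x hyx
    have t0 := ha.trans_le ht.1
    have ui := h.sol.ui t t0
    have uii : ∀ y x, IntervalIntegrable (u t) volume y x := fun y x => ui.intervalIntegrable
    rw [intervalIntegral.integral_const_mul, intervalIntegral.integral_sub (ui.comp_add_right r).intervalIntegrable (uii _ _),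
        intervalIntegral.integral_comp_add_right (fun x => u t x)]
    have e : (∫ w in (y+r)..(x+r), u t w) - ∫ w in y..x, u t w = (∫ w in x..(x+r), u t w) - ∫ w in y..(y+r), u t w := by
      have := intervalIntegral.integral_add_adjacent_intervals (uii y x) (uii x (x+r))
      have := intervalIntegral.integral_add_adjacent_intervals (uii y (y+r)) (uii (y+r) (x+r))
      linarith
    rw [e]
    have bb : ∀ z, |∫ w in z..(z+r), u t w| ≤ B * r := by
      intro z
      have := intervalIntegral.norm_integral_le_of_norm_le_const (a := z) (b := z + r) (f := u t) (C := B) (fun w _ => hB t ht w)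
      simpa [abs_of_pos hr] using this
    have b1 := (abs_le.1 (bb x)).2
    have b2 := (abs_le.1 (bb y)).1
    rw [inv_mul_le_iff₀ hr]
    linarith
end
end KS

namespace KS
open Set Topology

section
variable {q μ c0 : ℝ} {k : ℝ → ℝ} {u : ℝ → ℝ → ℝ}

theorem KSol.supbd1 (h : KSol q μ c0 k u) {a b : ℝ} (ha : 0 < a) : ∃ B > 0, ∀ t ∈ Icc a b, ∀ x, u t x ≤ B := by
  obtain ⟨M, hM0, hM⟩ := h.massbd (a := a/2) (b := b) (half_pos ha)
  have hμ := h.sol.hμ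
  have sp : 0 < Real.sqrt (μ * (a/2)) := Real.sqrt_pos.2 (by positivity)
  refine ⟨2 * M * (Real.sqrt (μ * (a/2)))⁻¹, by positivity, fun t ht x => ?_⟩
  refine ((h.linU (half_pos ha) hM).sup hμ le_rfl hM0 (by simpa using hμ) t ⟨by linarith [ht.1], ht.2⟩ x).trans ?_
  apply mul_le_mul_of_nonneg_left _ (by positivity)
  apply inv_anti₀ sp
  apply Real.sqrt_le_sqrt
  apply mul_le_mul_of_nonneg_left _ hμ.le
  linarith [ht.1]

theorem KSol.supbd (h : KSol q μ c0 k u) {a b : ℝ} (ha : 0 < a) : ∃ B > 0, ∀ t ∈ Icc a b, ∀ x, |u t x| ≤ B := by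
  obtain ⟨B1, h1, hB1⟩ := h.supbd1 (b := b) ha
  obtain ⟨B2, h2, hB2⟩ := h.neg.supbd1 (b := b) ha
  refine ⟨B1 + B2, by positivity, fun t ht x => abs_le.2 ⟨?_, ?_⟩⟩
  · linarith [hB2 t ht x]
  · linarith [hB1 t ht x]

theorem KSol.lip1 (h : KSol q μ c0 k u) {a b : ℝ} (ha : 0 < a) :
    ∃ L > 0, ∀ t ∈ Icc a b, ∀ x r, 0 < r → u t (x + r) - u t x ≤ L * r := by
  obtain ⟨B, hB0, hB⟩ := h.supbd (b := b) (half_pos ha)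
  have hμ := h.sol.hμ
  set B' := B^(q-1) with hB'
  have hB'0 : 0 < B' := Real.rpow_pos_of_pos hB0 _
  set s0 := min (a/2) (μ / (8 * B'^2)) with hs0
  have s0p : 0 < s0 := lt_min (half_pos ha) (by positivity)
  have sp : 0 < Real.sqrt (μ * s0) := Real.sqrt_pos.2 (by positivity)
  have hs : 4 * B'^2 * s0 < μ := by
    have : s0 ≤ μ / (8 * B'^2) := min_le_right _ _
    rw [le_div_iff₀ (by positivity)] at this
    nlinarith
  refine ⟨2 * (2 * B) * (Real.sqrt (μ * s0))⁻¹, by positivity, fun t ht x r hr => ?_⟩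
  have s1 : s0 ≤ a/2 := min_le_left _ _
  have := (h.linD (a := t - s0) (b := t) (B := B) (by linarith [ht.1]) hr
    (fun τ hτ x => hB τ ⟨by linarith [hτ.1, ht.1], hτ.2.trans ht.2⟩ x)).sup hμ hB'0.le (by linarith)
    (by simpa using hs) t ⟨by linarith, le_rfl⟩ x
  rw [_root_.sub_sub_cancel, inv_mul_le_iff₀ hr] at this
  linarith

theorem KSol.lip (h : KSol q μ c0 k u) {a b : ℝ} (ha : 0 < a) :
    ∃ L > 0, ∀ t ∈ Icc a b, ∀ x y, |u t x - u t y| ≤ L * |x - y| := by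
  obtain ⟨L1, h1, hL1⟩ := h.lip1 (b := b) ha
  obtain ⟨L2, h2, hL2⟩ := h.neg.lip1 (b := b) ha
  refine ⟨L1 + L2, by positivity, fun t ht => ?_⟩
  have key : ∀ x y, y < x → |u t x - u t y| ≤ (L1 + L2) * |x - y| := by
    intro x y hyx
    have e1 := hL1 t ht y (x - y) (by linarith)
    have e2 := hL2 t ht y (x - y) (by linarith)
    rw [add_sub_cancel] at e1 e2
    rw [abs_of_pos (by linarith : 0 < x - y), abs_le]
    have := mul_pos h1 (by linarith : 0 < x - y)
    have := mul_pos h2 (by linarith : 0 < x - y)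
    constructor <;> nlinarith
  intro x y
  rcases lt_trichotomy x y with hc | hc | hc
  · rw [abs_sub_comm, abs_sub_comm x]; exact key _ _ hc
  · simp [hc]
  · exact key _ _ hc

theorem KSol.jcont (h : KSol q μ c0 k u) {t₀ : ℝ} (ht : 0 < t₀) (x₀ : ℝ) : ContinuousAt (Function.uncurry u) (t₀, x₀) := by
  obtain ⟨L, hL, hLip⟩ := h.lip (a := t₀/2) (b := t₀ + 1) (half_pos ht)
  have c1 : ContinuousAt (fun t => u t x₀) t₀ := (h.sol.hd ht x₀).continuousAt
  rw [ContinuousAt, tendsto_iff_dist_tendsto_zero]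
  have lim : Tendsto (fun p : ℝ × ℝ => L * |p.2 - x₀| + |u p.1 x₀ - u t₀ x₀|) (𝓝 (t₀, x₀)) (𝓝 0) := by
    have a1 : ContinuousAt (fun p : ℝ × ℝ => L * |p.2 - x₀|) (t₀, x₀) := by fun_prop
    have a2 : ContinuousAt (fun p : ℝ × ℝ => |u p.1 x₀ - u t₀ x₀|) (t₀, x₀) :=
      ((ContinuousAt.comp (g := fun t => u t x₀) (f := Prod.fst) c1 continuousAt_fst).sub continuousAt_const).abs
    have := (a1.add a2).tendsto
    simp only [sub_self, abs_zero, mul_zero, add_zero, Pi.add_def] at this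
    exact this
  refine tendsto_of_tendsto_of_tendsto_of_le_of_le' tendsto_const_nhds lim (Eventually.of_forall fun t => dist_nonneg) ?_
  have ev : ∀ᶠ p : ℝ × ℝ in 𝓝 (t₀, x₀), p.1 ∈ Icc (t₀/2) (t₀+1) :=
    continuousAt_fst.eventually (Icc_mem_nhds (by simp only; linarith) (by simp only; linarith))
  filter_upwards [ev] with p hp
  rw [Real.dist_eq]
  simp only [Function.uncurry]
  have := hLip p.1 hp p.2 x₀
  calc _ ≤ |u p.1 p.2 - u p.1 x₀| + |u p.1 x₀ - u t₀ x₀| := abs_sub_le _ _ _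
    _ ≤ _ := by linarith

theorem KSol.decay (h : KSol q μ c0 k u) {a b η : ℝ} (ha : 0 < a) (hη : 0 < η) :
    ∃ R > 0, ∀ t ∈ Icc a b, ∀ x, R ≤ |x| → u t x ≤ η := by
  obtain ⟨L, hL, hLip⟩ := h.lip (b := b) ha
  obtain ⟨M, hM0, hM⟩ := h.massbd (b := b) ha
  set δ := η / (2 * L) with hδ
  have δ0 : 0 < δ := by positivity
  obtain ⟨R, hR, hRt⟩ := (h.linU ha hM).tight (ε := δ * η / 4) (by positivity)
  refine ⟨R, hR, fun t ht x hx => ?_⟩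
  by_contra hn
  push Not at hn
  have uc : Continuous (u t) := (h.sol.ux t (ha.trans_le ht.1)).continuous
  have low : ∀ y, |y - x| ≤ δ → η / 2 ≤ u t y := by
    intro y hy
    have := (abs_le.1 (hLip t ht y x)).1
    have : L * |y - x| ≤ L * δ := mul_le_mul_of_nonneg_left hy hL.le
    have : L * δ = η / 2 := by rw [hδ]; field_simp
    linarith
  have ib : ∀ y, (∀ z ∈ Icc y (y + δ), |z - x| ≤ δ) → δ * (η / 2) ≤ ∫ z in y..(y+δ), u t z := by
    intro y hy
    have := intervalIntegral.integral_mono_on (a := y) (b := y + δ) (f := fun _ => η/2) (g := u t) (μ := volume) (by linarith)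
      intervalIntegrable_const (uc.intervalIntegrable _ _) (fun z hz => low z (hy z hz))
    rw [intervalIntegral.integral_const, smul_eq_mul] at this
    linarith
  have pp : 0 < δ * η := by positivity
  rcases le_abs.1 hx with hc | hc
  · have := hRt t ht x (x + δ) (by linarith) (Or.inl hc)
    have := ib x (fun z hz => abs_le.2 ⟨by linarith [hz.1], by linarith [hz.2]⟩)
    linarith
  · have := hRt t ht (x - δ) x (by linarith) (Or.inr (by linarith))
    have := ib (x - δ) (fun z hz => abs_le.2 ⟨by linarith [hz.1], by linarith [hz.2]⟩)
    rw [sub_add_cancel] at this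
    linarith

theorem KSol.init_le (h : KSol q μ c0 k u) {w : ℝ → ℝ} (hw : Integrable w)
    (uc0 : Tendsto (fun t => ∫ x, |u t x - w x|) (𝓝[>] 0) (𝓝 0)) {S : ℝ} (hS : 0 ≤ S)
    (hS1 : ∀ y x, y ≤ x → ∫ z in y..x, w z ≤ S) {t : ℝ} (ht : 0 < t) {y x : ℝ} (hyx : y ≤ x) :
    ∫ z in y..x, u t z ≤ S := by
  apply _root_.le_of_forall_pos_le_add
  intro ε hε
  obtain ⟨a, ha1, ha2⟩ := ((uc0.eventually (gt_mem_nhds hε)).and (Ioo_mem_nhdsGT ht)).exists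
  obtain ⟨M, hM0, hM⟩ := h.massbd (b := t) ha2.1
  refine (h.linU ha2.1 hM).max_princ h.sol.hμ (by linarith : 0 ≤ S + ε) ?_ t ⟨ha2.2.le, le_rfl⟩ y x hyx
  intro y x hyx
  have ui := h.sol.ui a ha2.1
  have e := (abs_le.1 ((ii_abs_le (ui.sub hw) y x))).2
  have e' : ∫ z in y..x, (u a - w) z = (∫ z in y..x, u a z) - ∫ z in y..x, w z :=
    intervalIntegral.integral_sub ui.intervalIntegrable hw.intervalIntegrable
  rw [e'] at e
  have := hS1 y x hyx
  simp only [Pi.sub_apply] at e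
  linarith

theorem KSol.nonneg (h : KSol q μ c0 k u) {w : ℝ → ℝ} (hw : Integrable w)
    (uc0 : Tendsto (fun t => ∫ x, |u t x - w x|) (𝓝[>] 0) (𝓝 0)) (hw0 : 0 ≤ᵐ[volume] w) {t : ℝ} (ht : 0 < t) (x : ℝ) :
    0 ≤ u t x := by
  have := le_of_int (w := fun x => - u t x) (h.sol.ux t ht).continuous.neg (c := 0) (fun y x hyx => by
    rw [zero_mul]
    refine h.neg.init_le (w := fun x => - w x) hw.neg ?_ le_rfl ?_ ht hyx
    · refine uc0.congr fun t => ?_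
      congr 1; ext x
      rw [← abs_neg]; congr 1; ring
    · intro y x hyx
      rw [intervalIntegral.integral_neg, intervalIntegral.integral_of_le hyx]
      have := setIntegral_nonneg_of_ae (s := Ioc y x) hw0
      linarith) x
  linarith
end
end KS

namespace KS
open Set Topology

theorem nl_alg {s X X' Y Y' : ℝ} (hs0 : 0 < s) (hs1 : s < 1) (hX : 0 < X) (hX' : 0 < X') (hY : 0 < Y) (hY' : 0 < Y')
    (hYX : Y ≤ X) (h : X'^s - Y'^s ≤ X^s - Y^s) : X^(s-1) * (X' - X) ≤ Y^(s-1) * (Y' - Y) := by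
  have e : ∀ X X' : ℝ, 0 < X → X^(s-1) * (X' - X) = X^s * (X'/X) - X^s := by
    intro X X' hX
    rw [Real.rpow_sub_one hX.ne']; field_simp
  rw [e X X' hX, e Y Y' hY]
  have e2 : ∀ X X' : ℝ, 0 < X → 0 < X' → X'/X = (X'^s/X^s)^(1/s) := by
    intro X X' hX hX'
    rw [← Real.div_rpow hX'.le hX.le, ← Real.rpow_mul (by positivity), mul_one_div_cancel hs0.ne', Real.rpow_one]
  rw [e2 X X' hX hX', e2 Y Y' hY hY']
  have W0 : 0 < X^s := Real.rpow_pos_of_pos hX _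
  have A0 : 0 < X'^s := Real.rpow_pos_of_pos hX' _
  have b0 : 0 < Y^s := Real.rpow_pos_of_pos hY _
  have a0 : 0 < Y'^s := Real.rpow_pos_of_pos hY' _
  have bW : Y^s ≤ X^s := Real.rpow_le_rpow hY.le hYX hs0.le
  generalize X^s = W at *
  generalize X'^s = A at *
  generalize Y^s = b at *
  generalize Y'^s = c at *
  have hp : 1 ≤ 1/s := by rw [le_div_iff₀ hs0]; linarith
  have h1 : (A/W)^(1/s) ≤ ((b/W) * (c/b) + ((W-b)/W) * 1)^(1/s) := by
    apply Real.rpow_le_rpow (by positivity) _ (by positivity)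
    rw [div_le_iff₀ W0]
    field_simp
    linarith
  have h2 := (convexOn_rpow hp).2 (mem_Ici.2 (by positivity : 0 ≤ c/b)) (mem_Ici.2 (zero_le_one (α := ℝ)))
    (by positivity : 0 ≤ b/W) (div_nonneg (by linarith) W0.le : 0 ≤ (W-b)/W) (by field_simp; ring)
  simp only [smul_eq_mul, Real.one_rpow, mul_one] at h2
  have h3 : W * (A/W)^(1/s) ≤ W * ((b/W) * (c/b)^(1/s) + (W-b)/W) := by
    apply mul_le_mul_of_nonneg_left _ W0.le
    rw [mul_one] at h1
    exact h1.trans h2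
  have h4 : W * ((b/W) * (c/b)^(1/s) + (W-b)/W) = b * (c/b)^(1/s) + (W - b) := by field_simp
  linarith

theorem F_alg {s ε v w : ℝ} (hs0 : 0 < s) (hs1 : s < 1) (hε : 0 < ε) (hv : 0 ≤ v) (hvw : v ≤ w) :
    (w + ε)^s - (v+ε)^s ≤ w^s - v^s := by
  have mono : MonotoneOn (fun v : ℝ => v^s - (v+ε)^s) (Ici 0) := by
    apply monotoneOn_of_deriv_nonneg (convex_Ici 0)
    · apply ContinuousOn.sub
      · exact (Real.continuous_rpow_const hs0.le).continuousOn
      · exact ((Real.continuous_rpow_const hs0.le).comp (continuous_add_const ε)).continuousOn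
    · intro x hx
      rw [interior_Ici] at hx
      have hx : 0 < x := hx
      exact (((hasDerivAt_id x).rpow_const (p := s) (Or.inl hx.ne')).sub
        (((hasDerivAt_id x).add_const ε).rpow_const (p := s) (Or.inl (by simp; linarith)))).differentiableAt.differentiableWithinAt
    · intro x hx
      rw [interior_Ici] at hx
      have hx : 0 < x := hx
      have := (((hasDerivAt_id x).rpow_const (p := s) (Or.inl hx.ne')).sub
        (((hasDerivAt_id x).add_const ε).rpow_const (p := s) (Or.inl (by simp; linarith)))).deriv
      have e : deriv (fun v : ℝ => v^s - (v+ε)^s) x = 1 * s * x^(s-1) - 1 * s * (x+ε)^(s-1) := this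
      rw [e]
      have := Real.rpow_le_rpow_of_nonpos hx (by linarith : x ≤ x + ε) (by linarith : s - 1 ≤ 0)
      nlinarith
  have := mono (mem_Ici.2 hv) (mem_Ici.2 (hv.trans hvw)) hvw
  simp only at this
  linarith

theorem ol_alg {s X Y ux1 uy1 ux2 uy2 utx uty τ μ c0 D Fx Fy Nx Ny : ℝ} (hs0 : 0 < s) (hs1 : s < 1) (hX : 0 < X) (hY : 0 < Y)
    (hYX : Y ≤ X) (hτ : 0 < τ) (hμ : 0 < μ) (hc : 0 < c0)
    (x1 : ux1 * s * X^(s-1) = 1/τ) (y1 : uy1 * s * Y^(s-1) = 1/τ)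
    (x2 : ux2 * s * X^(s-1) + ux1 * s * (ux1 * (s-1) * X^(s-1-1)) ≤ 0)
    (y2 : 0 ≤ uy2 * s * Y^(s-1) + uy1 * s * (uy1 * (s-1) * Y^(s-1-1)))
    (tt : 0 ≤ utx * s * X^(s-1) - uty * s * Y^(s-1) + D/τ^2)
    (px : utx = -(Fx * ux1) + μ * ux2 + c0 * Nx) (py : uty = -(Fy * uy1) + μ * uy2 + c0 * Ny)
    (hN : X^(s-1) * Nx ≤ Y^(s-1) * Ny) (hF : X^s - Y^s ≤ Fx - Fy) (hZ : D/τ < X^s - Y^s) : False := by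
  have e : ∀ X u : ℝ, 0 < X → u * s * X^(s-1) = 1/τ → u * s * (u * (s-1) * X^(s-1-1)) = -((1-s)/(s*τ^2)) * (X^s)⁻¹ := by
    intro X u hX h
    have p1 : 0 < X^(s-1) := Real.rpow_pos_of_pos hX _
    have hu : u = (τ * s * X^(s-1))⁻¹ := by
      field_simp; field_simp at h; linarith
    have h2 : X^(s-1-1) = X^(s-1) * X^(s-1) * (X^s)⁻¹ := by
      rw [← Real.rpow_neg hX.le, ← Real.rpow_add hX, ← Real.rpow_add hX]; congr 1; ring
    rw [h2, hu]
    field_simp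
    ring
  rw [e X ux1 hX x1] at x2
  rw [e Y uy1 hY y1] at y2
  have Ws : Y^s ≤ X^s := Real.rpow_le_rpow hY.le hYX hs0.le
  have hi : (X^s)⁻¹ ≤ (Y^s)⁻¹ := inv_anti₀ (Real.rpow_pos_of_pos hY _) Ws
  have hκ : 0 ≤ (1-s)/(s*τ^2) := div_nonneg (by linarith) (by positivity)
  have hi2 := mul_le_mul_of_nonneg_left hi hκ
  have v : μ * (ux2 * s * X^(s-1)) ≤ μ * (uy2 * s * Y^(s-1)) := by
    apply mul_le_mul_of_nonneg_left _ hμ.le; linarith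
  have n : c0 * s * (X^(s-1) * Nx) ≤ c0 * s * (Y^(s-1) * Ny) := mul_le_mul_of_nonneg_left hN (by positivity)
  have f1 : utx * s * X^(s-1) = - Fx * (ux1 * s * X^(s-1)) + μ * (ux2 * s * X^(s-1)) + c0 * s * (X^(s-1) * Nx) := by rw [px]; ring
  have f2 : uty * s * Y^(s-1) = - Fy * (uy1 * s * Y^(s-1)) + μ * (uy2 * s * Y^(s-1)) + c0 * s * (Y^(s-1) * Ny) := by rw [py]; ring
  rw [x1] at f1
  rw [y1] at f2
  have z : D/τ * (1/τ) < (Fx - Fy) * (1/τ) := mul_lt_mul_of_pos_right (by linarith) (by positivity)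
  have z2 : D/τ * (1/τ) = D/τ^2 := by field_simp
  linarith

theorem left_max {g : ℝ → ℝ} {g' a t : ℝ} (hat : a < t) (hg : HasDerivAt g g' t) (hm : ∀ s ∈ Icc a t, g s ≤ g t) : 0 ≤ g' := by
  have := (hasDerivWithinAt_iff_tendsto_slope' (s := Iio t) (by simp)).1 hg.hasDerivWithinAt
  refine ge_of_tendsto this ?_
  filter_upwards [Ioo_mem_nhdsLT hat] with s hs
  rw [slope_def_field]
  exact div_nonneg_of_nonpos (by linarith [hm s ⟨hs.1.le, hs.2.le⟩]) (by linarith [hs.2])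
end KS

namespace KS
open Set Topology

section
variable {q μ c0 : ℝ} {k : ℝ → ℝ} {u : ℝ → ℝ → ℝ}

theorem rpow_lip {s ε X Y : ℝ} (hs0 : 0 < s) (hs1 : s < 1) (hε : 0 < ε) (hX : ε ≤ X) (hY : ε ≤ Y) :
    |X^s - Y^s| ≤ s * ε^(s-1) * |X - Y| := by
  have := (convex_Ici ε).norm_image_sub_le_of_norm_hasDerivWithin_le (f := fun x : ℝ => x^s) (f' := fun x => s * x^(s-1))
    (C := s * ε^(s-1)) (fun x hx => (Real.hasDerivAt_rpow_const (Or.inl (hε.trans_le hx).ne')).hasDerivWithinAt) ?_ (mem_Ici.2 hY) (mem_Ici.2 hX)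
  · simpa [Real.norm_eq_abs] using this
  · intro x hx
    have hx : ε ≤ x := hx
    have p : 0 < x^(s-1) := Real.rpow_pos_of_pos (hε.trans_le hx) _
    rw [Real.norm_eq_abs, abs_of_pos (by positivity)]
    exact mul_le_mul_of_nonneg_left (Real.rpow_le_rpow_of_nonpos hε hx (by linarith)) hs0.le

theorem KSol.cv_ii (h : KSol q μ c0 k u) {t : ℝ} (ht : 0 < t) (x : ℝ) : Integrable fun z => k z * u t (x - z) := by
  obtain ⟨B, hB0, hB⟩ := h.supbd (b := t) ht
  apply (h.hk.ki.abs.mul_const B).mono'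
  · apply h.hk.ki.aestronglyMeasurable.mul
    exact ((h.sol.ux t ht).continuous.comp (continuous_const.sub continuous_id)).aestronglyMeasurable
  · refine Eventually.of_forall fun z => ?_
    rw [norm_mul, Real.norm_eq_abs, Real.norm_eq_abs]
    exact mul_le_mul_of_nonneg_left (hB t ⟨le_rfl, le_rfl⟩ _) (abs_nonneg _)

theorem KSol.cv_sub (h : KSol q μ c0 k u) {t : ℝ} (ht : 0 < t) (x : ℝ) :
    (Integrable fun z => k z * (u t (x - z) - u t x)) ∧ cv k (u t) x - u t x = ∫ z, k z * (u t (x - z) - u t x) := by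
  have i1 := h.cv_ii ht x
  have i2 := h.hk.ki.mul_const (u t x)
  simp only [mul_sub]
  refine ⟨i1.sub i2, ?_⟩
  rw [integral_sub i1 i2, integral_mul_const, h.hk.k1, one_mul]; rfl

theorem KSol.olei0 (h : KSol q μ c0 k u) (hq2 : q < 2) (hu : ∀ t, 0 < t → ∀ x, 0 ≤ u t x) {a b ε η β L : ℝ} (ha : 0 < a)
    (hε : 0 < ε) (hη : 0 < η) (hβ : 0 < β) (hL : ∀ x y, |u a x - u a y| ≤ L * |x - y|)
    (hβL : (q-1) * ε^(q-1-1) * L ≤ 1/β) :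
    ∀ t ∈ Icc a b, ∀ y x, y ≤ x → (u t x + ε)^(q-1) - (u t y + ε)^(q-1) - (x - y)/(t - a + β) - η ≤ 0 := by
  have hq := h.sol.hq
  set s := q - 1 with hs
  have hs0 : 0 < s := by linarith
  have hs1 : s < 1 := by linarith
  have pos : ∀ t x, 0 < t → 0 < u t x + ε := fun t x ht => by linarith [hu t ht x]
  set Z : ℝ × ℝ × ℝ → ℝ := fun p => (u p.1 p.2.2 + ε)^s - (u p.1 p.2.1 + ε)^s - (p.2.2 - p.2.1)/(p.1 - a + β) - η with hZ
  by_contra hcon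
  push Not at hcon
  obtain ⟨t1, ht1, y1, x1, hyx1, hpos1⟩ := hcon
  have hab : a ≤ b := ht1.1.trans ht1.2
  obtain ⟨B, hB0, hB⟩ := h.supbd (b := b) ha
  -- decay
  obtain ⟨δ, hδ, hδ0⟩ : ∃ δ : ℝ, (δ + ε)^s < ε^s + η ∧ 0 < δ := by
    have c : Continuous fun δ : ℝ => (δ + ε)^s := (Real.continuous_rpow_const hs0.le).comp (continuous_add_const ε)
    have := (c.tendsto 0).eventually (gt_mem_nhds (by rw [zero_add]; linarith : (0 + ε)^s < ε^s + η))
    exact ((this.filter_mono nhdsWithin_le_nhds).and (self_mem_nhdsWithin : Ioi (0:ℝ) ∈ 𝓝[>] 0)).exists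
  obtain ⟨R0, hR0, hdec⟩ := h.decay (b := b) ha hδ0
  have T0 : 0 < b - a + β := by linarith
  set R := R0 + (B + ε)^s * (b - a + β) + 1 with hR
  have PB : 0 < (B + ε)^s := Real.rpow_pos_of_pos (by linarith) _
  have PBT := mul_pos PB T0
  -- outside
  have out : ∀ t ∈ Icc a b, ∀ y x, y ≤ x → 0 < Z (t, y, x) → x ∈ Icc (-R) R ∧ y ∈ Icc (-R) R := by
    intro t ht y x hyx hz
    have t0 := ha.trans_le ht.1
    have τ0 : 0 < t - a + β := by linarith [ht.1]
    simp only [hZ] at hz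
    have yl : ε^s ≤ (u t y + ε)^s := Real.rpow_le_rpow hε.le (by linarith [hu t t0 y]) hs0.le
    have lin : 0 ≤ (x - y)/(t - a + β) := div_nonneg (by linarith) τ0.le
    have hx : |x| < R0 := by
      by_contra hn
      push Not at hn
      have := Real.rpow_le_rpow (pos t x t0).le (by linarith [hdec t ht x hn] : u t x + ε ≤ δ + ε) hs0.le
      linarith
    have hx' := abs_lt.1 hx
    have hy : -R ≤ y := by
      by_contra hn
      push Not at hn
      have xb := Real.rpow_le_rpow (pos t x t0).le (by linarith [(abs_le.1 (hB t ht x)).2] : u t x + ε ≤ B + ε) hs0.le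
      have e0 : 0 < ε^s := Real.rpow_pos_of_pos hε _
      have : (B + ε)^s ≤ (x - y)/(t - a + β) := by
        rw [le_div_iff₀ τ0]
        have : (B + ε)^s * (t - a + β) ≤ (B + ε)^s * (b - a + β) := mul_le_mul_of_nonneg_left (by linarith [ht.2]) PB.le
        linarith
      linarith
    exact ⟨⟨by linarith, by linarith⟩, hy, by linarith⟩
  -- compactness
  set K : Set (ℝ × ℝ × ℝ) := (Icc a b ×ˢ (Icc (-R) R ×ˢ Icc (-R) R)) ∩ {p | p.2.1 ≤ p.2.2} with hK
  have Kc : IsCompact K := (isCompact_Icc.prod (isCompact_Icc.prod isCompact_Icc)).inter_right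
    (isClosed_le (by fun_prop) (by fun_prop))
  have Zc : ContinuousOn Z K := by
    rintro ⟨t, y, x⟩ ⟨⟨ht, -⟩, -⟩
    apply ContinuousAt.continuousWithinAt
    have t0 : 0 < t := ha.trans_le ht.1
    have τ0 : t - a + β ≠ 0 := by have := ht.1; simp only at this; linarith
    have ux : ContinuousAt (fun p : ℝ × ℝ × ℝ => u p.1 p.2.2) (t, y, x) :=
      ContinuousAt.comp (g := Function.uncurry u) (f := fun p : ℝ × ℝ × ℝ => (p.1, p.2.2)) (h.jcont t0 x) (by fun_prop)
    have uy : ContinuousAt (fun p : ℝ × ℝ × ℝ => u p.1 p.2.1) (t, y, x) :=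
      ContinuousAt.comp (g := Function.uncurry u) (f := fun p : ℝ × ℝ × ℝ => (p.1, p.2.1)) (h.jcont t0 y) (by fun_prop)
    have l : ContinuousAt (fun p : ℝ × ℝ × ℝ => (p.2.2 - p.2.1)/(p.1 - a + β)) (t, y, x) :=
      ContinuousAt.div (by fun_prop) (by fun_prop) τ0
    exact ((((ux.add continuousAt_const).rpow_const (Or.inr hs0.le)).sub
      ((uy.add continuousAt_const).rpow_const (Or.inr hs0.le))).sub l).sub continuousAt_const
  have in1 : (t1, y1, x1) ∈ K := by
    have := out t1 ht1 y1 x1 hyx1 hpos1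
    exact ⟨⟨ht1, this.2, this.1⟩, hyx1⟩
  obtain ⟨⟨t, y, x⟩, ⟨⟨ht, -⟩, hyx⟩, hmax⟩ := Kc.exists_isMaxOn ⟨_, in1⟩ Zc
  simp only [Set.mem_ofPred_eq] at ht hyx
  have Zpos : 0 < Z (t, y, x) := lt_of_lt_of_le hpos1 (hmax in1)
  have gmax : ∀ t' ∈ Icc a b, ∀ y' x', y' ≤ x' → Z (t', y', x') ≤ Z (t, y, x) := by
    intro t' ht' y' x' hyx'
    by_cases hz : 0 < Z (t', y', x')
    · have := out t' ht' y' x' hyx' hz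
      exact hmax (show (t', y', x') ∈ K from ⟨⟨ht', this.2, this.1⟩, hyx'⟩)
    · linarith
  have t0 : 0 < t := ha.trans_le ht.1
  have τ0 : 0 < t - a + β := by linarith [ht.1]
  have hlt : y < x := by
    rcases hyx.lt_or_eq with hc | hc
    · exact hc
    · exfalso; simp only [hZ, hc] at Zpos; simp at Zpos; linarith
  have hat : a < t := by
    rcases ht.1.lt_or_eq with hc | hc
    · exact hc
    · exfalso
      rw [← hc] at Zpos
      simp only [hZ, sub_self, zero_add] at Zpos
      have e1 := (abs_le.1 (rpow_lip hs0 hs1 hε (by linarith [hu a ha x] : ε ≤ u a x + ε) (by linarith [hu a ha y] : ε ≤ u a y + ε))).2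
      have e2 := hL x y
      rw [abs_of_pos (by linarith : 0 < x - y)] at e2
      have e3 : |u a x + ε - (u a y + ε)| = |u a x - u a y| := by congr 1; ring
      rw [e3] at e1
      have c0 : 0 < s * ε^(s-1) := mul_pos hs0 (Real.rpow_pos_of_pos hε _)
      have e4 := mul_le_mul_of_nonneg_left e2 c0.le
      have e5 := mul_le_mul_of_nonneg_right hβL (by linarith : 0 ≤ x - y)
      have e6 : 1/β * (x - y) = (x - y)/β := by ring
      linarith
  have U := h.sol.ux t t0
  set τ := t - a + β with hτ
  have hdw : ∀ z, HasDerivAt (fun z => (u t z + ε)^s) (deriv (u t) z * s * (u t z + ε)^(s-1)) z := fun z =>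
    ((c2_hd U z).add_const ε).rpow_const (Or.inl (pos t z t0).ne')
  have hdw2 : ∀ z, HasDerivAt (fun z => deriv (u t) z * s * (u t z + ε)^(s-1))
      (deriv (deriv (u t)) z * s * (u t z + ε)^(s-1) + deriv (u t) z * s * (deriv (u t) z * (s-1) * (u t z + ε)^(s-1-1))) z := fun z =>
    ((c2_hd2 U z).mul_const s).mul (((c2_hd U z).add_const ε).rpow_const (Or.inl (pos t z t0).ne'))
  have sx : deriv (u t) x * s * (u t x + ε)^(s-1) - 1/τ = 0 ∧
      deriv (deriv (u t)) x * s * (u t x + ε)^(s-1) + deriv (u t) x * s * (deriv (u t) x * (s-1) * (u t x + ε)^(s-1-1)) ≤ 0 := by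
    refine snd_max (φ := fun z => (u t z + ε)^s - z/τ) (φ' := fun z => deriv (u t) z * s * (u t z + ε)^(s-1) - 1/τ) ?_
      (Eventually.of_forall fun z => (hdw z).sub ((hasDerivAt_id z).div_const τ)) ((hdw2 x).sub_const _)
    filter_upwards [Ioi_mem_nhds hlt] with z hz
    have := gmax t ht y z (le_of_lt hz)
    simp only [hZ] at this
    rw [← hτ, sub_div, sub_div] at this
    linarith
  have sy : -(deriv (u t) y * s * (u t y + ε)^(s-1)) + 1/τ = 0 ∧
      -(deriv (deriv (u t)) y * s * (u t y + ε)^(s-1) + deriv (u t) y * s * (deriv (u t) y * (s-1) * (u t y + ε)^(s-1-1))) ≤ 0 := by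
    refine snd_max (φ := fun z => -(u t z + ε)^s + z/τ) (φ' := fun z => -(deriv (u t) z * s * (u t z + ε)^(s-1)) + 1/τ) ?_
      (Eventually.of_forall fun z => (hdw z).fun_neg.add ((hasDerivAt_id z).div_const τ)) ((hdw2 y).fun_neg.add_const _)
    filter_upwards [Iio_mem_nhds hlt] with z hz
    have := gmax t ht z x (le_of_lt hz)
    simp only [hZ] at this
    rw [← hτ, sub_div, sub_div] at this
    linarith
  have tx : ∀ z, HasDerivAt (fun r => (u r z + ε)^s) (gt u t z * s * (u t z + ε)^(s-1)) t := fun z =>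
    ((h.sol.hd t0 z).add_const ε).rpow_const (Or.inl (pos t z t0).ne')
  have st : 0 ≤ gt u t x * s * (u t x + ε)^(s-1) - gt u t y * s * (u t y + ε)^(s-1) + (x - y)/τ^2 := by
    have hl : HasDerivAt (fun r => (x - y)/(r - a + β)) (-(x - y)/τ^2) t := by
      have := (hasDerivAt_const t (x-y)).fun_div (((hasDerivAt_id t).sub_const a).add_const β) (by simpa using τ0.ne')
      exact this.congr_deriv (by simp [hτ])
    have hd := (((tx x).sub (tx y)).sub hl).sub_const η
    have := left_max (g := fun r => Z (r, y, x)) hat hd (fun r hr => gmax r ⟨hr.1, hr.2.trans ht.2⟩ y x hyx)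
    rw [neg_div] at this
    linarith
  have Zp := Zpos
  simp only [hZ, ← hτ] at Zp
  have ln : 0 < (x - y)/τ := div_pos (by linarith) τ0
  have hw : (u t y + ε)^s < (u t x + ε)^s := by linarith
  have hXY : u t y + ε ≤ u t x + ε := by
    by_contra hn
    push Not at hn
    have := Real.rpow_le_rpow (pos t x t0).le hn.le hs0.le
    linarith
  have px := h.sol.pde t t0 x
  have py := h.sol.pde t t0 y
  refine ol_alg (X := u t x + ε) (Y := u t y + ε) (utx := gt u t x) (uty := gt u t y) (D := x - y) hs0 hs1 (pos t x t0) (pos t y t0)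
    hXY τ0 h.sol.hμ h.hc (by linarith [sx.1]) (by linarith [sy.1]) sx.2 (by linarith [sy.2]) st px py ?_ ?_ ?_
  · obtain ⟨i1, e1⟩ := h.cv_sub t0 x
    obtain ⟨i2, e2⟩ := h.cv_sub t0 y
    rw [e1, e2, ← integral_const_mul, ← integral_const_mul]
    apply integral_mono (i1.const_mul _) (i2.const_mul _)
    intro z
    have g := gmax t ht (y - z) (x - z) (by linarith)
    simp only [hZ] at g
    rw [sub_sub_sub_cancel_right] at g
    have := nl_alg hs0 hs1 (pos t x t0) (pos t (x-z) t0) (pos t y t0) (pos t (y-z) t0) hXY (by linarith)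
    rw [add_sub_add_right_eq_sub, add_sub_add_right_eq_sub] at this
    have := mul_le_mul_of_nonneg_left this (h.hk.k0 z)
    simp only
    linarith
  · rw [abs_of_nonneg (hu t t0 x), abs_of_nonneg (hu t t0 y)]
    exact F_alg hs0 hs1 hε (hu t t0 y) (by linarith)
  · linarith

theorem KSol.olei (h : KSol q μ c0 k u) (hq2 : q < 2) (hu : ∀ t, 0 < t → ∀ x, 0 ≤ u t x) {t : ℝ} (ht : 0 < t) {y x : ℝ} (hyx : y ≤ x) :
    (u t x)^(q-1) ≤ (u t y)^(q-1) + (x - y)/t := by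
  have hs0 : 0 < q - 1 := by linarith [h.sol.hq]
  have key : ∀ ε, 0 < ε → ∀ a ∈ Ioo 0 t, (u t x + ε)^(q-1) ≤ (u t y + ε)^(q-1) + (x - y)/(t - a) := by
    intro ε hε a ha
    obtain ⟨L, hL0, hL⟩ := h.lip (b := a) ha.1
    have c : 0 < (q-1) * ε^(q-1-1) * L := mul_pos (mul_pos hs0 (Real.rpow_pos_of_pos hε _)) hL0
    apply _root_.le_of_forall_pos_le_add
    intro η hη
    have := h.olei0 hq2 hu (b := t) ha.1 hε hη (β := 1/((q-1) * ε^(q-1-1) * L)) (by positivity) (hL a ⟨le_rfl, le_rfl⟩)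
      (by rw [one_div_one_div]) t ⟨ha.2.le, le_rfl⟩ y x hyx
    have ta : 0 < t - a := by linarith [ha.2]
    have d : (x - y)/(t - a + 1/((q-1) * ε^(q-1-1) * L)) ≤ (x - y)/(t - a) :=
      div_le_div_of_nonneg_left (by linarith) ta (by have : 0 < 1/((q-1) * ε^(q-1-1) * L) := by positivity
                                                     linarith)
    linarith
  have k2 : ∀ ε, 0 < ε → (u t x + ε)^(q-1) ≤ (u t y + ε)^(q-1) + (x - y)/t := by
    intro ε hε
    have c : ContinuousAt (fun a => (u t y + ε)^(q-1) + (x - y)/(t - a)) 0 :=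
      continuousAt_const.add (ContinuousAt.div continuousAt_const (by fun_prop) (by simpa using ht.ne'))
    have l := c.tendsto.mono_left (nhdsWithin_le_nhds (s := Ioi 0))
    simp only [sub_zero] at l
    refine ge_of_tendsto l ?_
    filter_upwards [Ioo_mem_nhdsGT ht] with a ha
    exact key ε hε a ha
  have cc : ∀ v : ℝ, Tendsto (fun ε : ℝ => (v + ε)^(q-1)) (𝓝[>] 0) (𝓝 (v^(q-1))) := by
    intro v
    have c : Continuous fun ε : ℝ => (v + ε)^(q-1) := (Real.continuous_rpow_const hs0.le).comp (continuous_const_add v)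
    have := (c.tendsto 0).mono_left (nhdsWithin_le_nhds (s := Ioi 0))
    simpa using this
  refine le_of_tendsto_of_tendsto (cc _) ((cc _).add_const _) ?_
  filter_upwards [self_mem_nhdsWithin] with ε hε
  exact k2 ε hε
end
end KS

namespace KS
open Set Topology

/-- a function satisfying the one-sided estimate and a mass bound is bounded -/
theorem sup_of_olei {q K t : ℝ} (hq : 1 < q) (ht : 0 < t) {U : ℝ → ℝ} (hc : Continuous U) (h0 : ∀ x, 0 ≤ U x)
    (hK : ∀ y x, y ≤ x → ∫ z in y..x, U z ≤ K)
    (ho : ∀ y x, y ≤ x → (U x)^(q-1) ≤ (U y)^(q-1) + (x - y)/t) (x : ℝ) :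
    U x ≤ ((2:ℝ)^(q/(q-1)) * K)^(1/q) * t^(-(1/q)) := by
  have hs0 : 0 < q - 1 := by linarith
  have q0 : 0 < q := by linarith
  have hK0 : 0 ≤ K := by have := hK x x le_rfl; simpa using this
  rcases (h0 x).eq_or_lt with hz | hz
  · rw [← hz]; positivity
  set M := (U x)^(q-1) with hM
  have M0 : 0 < M := Real.rpow_pos_of_pos hz _
  have low : ∀ y ∈ Icc (x - M * t/2) x, (M/2)^(1/(q-1)) ≤ U y := by
    intro y hy
    have := ho y x hy.2
    have d : (x - y)/t ≤ M/2 := by rw [div_le_iff₀ ht]; linarith [hy.1]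
    have e : M/2 ≤ (U y)^(q-1) := by linarith
    have := Real.rpow_le_rpow (by positivity) e (by positivity : 0 ≤ 1/(q-1))
    rwa [← Real.rpow_mul (h0 y), mul_one_div_cancel hs0.ne', Real.rpow_one] at this
  have I := intervalIntegral.integral_mono_on (a := x - M*t/2) (b := x) (f := fun _ => (M/2)^(1/(q-1))) (g := U) (μ := volume)
    (by have := mul_pos M0 ht; linarith) intervalIntegrable_const (hc.intervalIntegrable _ _) low
  rw [intervalIntegral.integral_const, smul_eq_mul] at I
  have I2 := I.trans (hK _ x (by have := mul_pos M0 ht; linarith))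
  have e1 : (x - (x - M*t/2)) * (M/2)^(1/(q-1)) = t * (M/2)^(q/(q-1)) := by
    have : q/(q-1) = 1/(q-1) + 1 := by field_simp; ring
    rw [this, Real.rpow_add (by positivity), Real.rpow_one]; ring
  have e2 : (M/2)^(q/(q-1)) = (U x)^q / (2:ℝ)^(q/(q-1)) := by
    rw [Real.div_rpow M0.le (by norm_num), hM, ← Real.rpow_mul hz.le]
    congr 2; field_simp
  rw [e1, e2] at I2
  have P2 : 0 < (2:ℝ)^(q/(q-1)) := by positivity
  have I3 : (U x)^q ≤ (2:ℝ)^(q/(q-1)) * K * t⁻¹ := by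
    rw [← div_eq_mul_inv, le_div_iff₀ ht]
    have := mul_le_mul_of_nonneg_left I2 P2.le
    field_simp at this
    linarith
  have I4 := Real.rpow_le_rpow (by positivity) I3 (by positivity : 0 ≤ 1/q)
  rw [← Real.rpow_mul hz.le, mul_one_div_cancel q0.ne', Real.rpow_one, Real.mul_rpow (by positivity) (by positivity),
    Real.inv_rpow ht.le, ← Real.rpow_neg ht.le] at I4
  exact I4

theorem diff_bd {s V v S d : ℝ} (hs0 : 0 < s) (hs1 : s < 1) (hV : 0 ≤ V) (hv : 0 ≤ v) (hVS : V ≤ S) (hd : 0 ≤ d)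
    (h : V^s ≤ v^s + d) : V - v ≤ 1/s * S^(1-s) * d := by
  have am := Real.geom_mean_le_arith_mean2_weighted (by linarith : 0 ≤ 1 - s) hs0.le hV hv (by ring)
  have Vp : 0 ≤ V^(1-s) := Real.rpow_nonneg hV _
  have e : V^(1-s) * V^s = V := by
    rw [← Real.rpow_add_of_nonneg hV (by linarith) hs0.le]; simp
  have m1 := mul_le_mul_of_nonneg_left h Vp
  have m2 : V^(1-s) * d ≤ S^(1-s) * d := mul_le_mul_of_nonneg_right (Real.rpow_le_rpow hV hVS (by linarith)) hd
  have : s * (V - v) ≤ S^(1-s) * d := by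
    rw [e] at m1
    nlinarith
  calc V - v = 1/s * (s * (V - v)) := by field_simp
    _ ≤ 1/s * (S^(1-s) * d) := mul_le_mul_of_nonneg_left this (by positivity)
    _ = _ := by ring

theorem final_bd {q K t : ℝ} (hq : 1 < q) (hq2 : q < 2) (ht : 0 < t) {U : ℝ → ℝ} (hc : Continuous U) (h0 : ∀ x, 0 ≤ U x)
    (hK : ∀ y x, y ≤ x → ∫ z in y..x, U z ≤ K)
    (ho : ∀ y x, y ≤ x → (U x)^(q-1) ≤ (U y)^(q-1) + (x - y)/t) {R h C1 : ℝ} (hR : 0 < R) (hh : 0 < h)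
    (hC1 : C1 = ((2:ℝ)^(q/(q-1)) * K)^(1/q)) :
    ∫ x in Icc (-R) R, |U (x + h) - U x| ≤ (4 * (1/(q-1)) * C1^(2-q) + C1 + 1) * (R * h * t^(-(2/q)) + h * t^(-(1/q))) := by
  have hs0 : 0 < q - 1 := by linarith
  have q0 : 0 < q := by linarith
  have hK0 : 0 ≤ K := by have := hK 0 0 le_rfl; simpa using this
  have C10 : 0 ≤ C1 := by rw [hC1]; positivity
  have sup : ∀ x, U x ≤ C1 * t^(-(1/q)) := fun x => by rw [hC1]; exact sup_of_olei hq ht hc h0 hK ho x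
  set S := C1 * t^(-(1/q)) with hS
  set A := 1/(q-1) * C1^(2-q) * t^(-(2/q)) with hA
  have A0 : 0 ≤ A := by positivity
  have df : ∀ x, U (x + h) - U x ≤ A * h := by
    intro x
    have o := ho x (x + h) (by linarith)
    rw [add_sub_cancel_left] at o
    have := diff_bd hs0 (by linarith) (h0 _) (h0 x) (sup (x+h)) (by positivity : 0 ≤ h/t) o
    refine this.trans (le_of_eq ?_)
    have e1 : (1 - (q-1)) = 2 - q := by ring
    rw [e1, hS, Real.mul_rpow C10 (by positivity), ← Real.rpow_mul ht.le, hA]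
    have e2 : t^(-(2/q)) = t^(-(1/q) * (2-q)) * t⁻¹ := by
      rw [← Real.rpow_neg_one t, ← Real.rpow_add ht]
      congr 1; field_simp; ring
    rw [e2]; ring
  have cs : Continuous fun x => U (x + h) := hc.comp (continuous_add_const h)
  have ii : ∀ y x, IntervalIntegrable U volume y x := fun y x => hc.intervalIntegrable _ _
  rw [integral_Icc_eq_integral_Ioc, ← intervalIntegral.integral_of_le (by linarith)]
  have I1 : ∫ x in (-R)..R, |U (x + h) - U x| ≤ ∫ x in (-R)..R, (2 * A * h - (U (x+h) - U x)) := by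
    apply intervalIntegral.integral_mono_on (by linarith)
    · exact (cs.sub hc).abs.intervalIntegrable _ _
    · exact (continuous_const.sub (cs.sub hc)).intervalIntegrable _ _
    · intro x _
      have := df x
      have := mul_nonneg A0 hh.le
      rw [abs_le]; constructor <;> linarith
  have I2 : ∫ x in (-R)..R, (2 * A * h - (U (x+h) - U x)) = 2 * R * (2 * A * h) - ((∫ x in (-R+h)..(R+h), U x) - ∫ x in (-R)..R, U x) := by
    have csub : Continuous fun x => U (x + h) - U x := cs.sub hc
    rw [intervalIntegral.integral_sub (f := fun _ => 2 * A * h) (g := fun x => U (x + h) - U x) intervalIntegrable_const (csub.intervalIntegrable _ _),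
      intervalIntegral.integral_sub (cs.intervalIntegrable _ _) (ii _ _), intervalIntegral.integral_comp_add_right (fun x => U x),
      intervalIntegral.integral_const, smul_eq_mul]
    ring
  have e1 := intervalIntegral.integral_add_adjacent_intervals (ii (-R) R) (ii R (R+h))
  have e2 := intervalIntegral.integral_add_adjacent_intervals (ii (-R) (-R+h)) (ii (-R+h) (R+h))
  have p1 : 0 ≤ ∫ x in R..(R+h), U x := intervalIntegral.integral_nonneg (by linarith) fun x _ => h0 x
  have p2 : ∫ x in (-R)..(-R+h), U x ≤ h * S := by
    have := intervalIntegral.integral_mono_on (a := -R) (b := -R+h) (f := U) (g := fun _ => S) (μ := volume)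
      (by linarith) (ii _ _) intervalIntegrable_const (fun z _ => sup z)
    rw [intervalIntegral.integral_const, smul_eq_mul] at this
    linarith
  have T : ∫ x in (-R)..R, |U (x + h) - U x| ≤ 4 * R * A * h + h * S := by linarith
  refine T.trans ?_
  have P0 : 0 ≤ R * h * t^(-(2/q)) := by positivity
  have Q0 : 0 ≤ h * t^(-(1/q)) := by positivity
  have D0 : 0 ≤ 4 * (1/(q-1)) * C1^(2-q) := by positivity
  have r1 : 4 * R * A * h + h * S = 4 * (1/(q-1)) * C1^(2-q) * (R * h * t^(-(2/q))) + C1 * (h * t^(-(1/q))) := by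
    rw [hA, hS]; ring
  rw [r1]
  nlinarith [mul_nonneg D0 Q0, mul_nonneg C10 P0]
end KS

theorem stmt18
    (J : ℝ → ℝ) (hJpos : ∀ x, 0 ≤ J x) (hJeven : ∀ x, J (-x) = J x)
    (hJint : Integrable J) (hJmass : ∫ x, J x = 1)
    (q K : ℝ) (hq1 : 1 < q) (hq2 : q < 2) (hK : 0 ≤ K) :
    -- a constant C(‖φ‖₁, q), independent of λ and μ
    ∃ C : ℝ, 0 < C ∧
      ∀ (φ : ℝ → ℝ) (lam μ : ℝ) (u : ℝ → ℝ → ℝ),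
        0 < lam → 0 < μ → Integrable φ → (∀ x, 0 ≤ φ x) → (∫ y, |φ y|) = K →
        IsRescaledSol J q lam μ φ u →
        ∀ t R h : ℝ, 0 < t → 0 < R → 0 < h → h < 1 →
          (∫ x in Set.Icc (-R) R, |u t (x + h) - u t x|)
            ≤ C * (R * h * t ^ (-(2 / q)) + h * t ^ (-(1 / q))) := by
  have hs0 : 0 < q - 1 := by linarith
  set C1 : ℝ := ((2:ℝ)^(q/(q-1)) * K)^(1/q) with hC1
  have C10 : 0 ≤ C1 := by positivity
  refine ⟨4 * (1/(q-1)) * C1^(2-q) + C1 + 1, by positivity, ?_⟩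
  rintro φ lam μ u hlam hμ hφ hφ0 hφK ⟨ui, uc, ux, ut, pde, u0⟩ t R h ht hR hh -
  have scale : ∀ f : ℝ → ℝ, ∫ x, lam * f (lam * x) = ∫ x, f x := by
    intro f
    rw [integral_const_mul, Measure.integral_comp_mul_left f lam, abs_of_pos (inv_pos.2 hlam), smul_eq_mul, mul_inv_cancel_left₀ hlam.ne']
  have ker : KS.Ker (fun x => lam * J (lam * x)) :=
    ⟨fun x => mul_nonneg hlam.le (hJpos _), (hJint.comp_mul_left' hlam.ne').const_mul lam, by rw [scale, hJmass]⟩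
  have S : KS.KSol q μ (lam^q) (fun x => lam * J (lam * x)) u := by
    apply KS.KSol.mk' ker (Real.rpow_pos_of_pos hlam _) hq1 hμ (fun t ht => ui t ht.le) _ ux ut pde
    intro t₀ ht₀
    have := uc t₀ ht₀.le
    rwa [nhdsWithin_eq_nhds.2 (Ici_mem_nhds ht₀)] at this
  have uc0 : Tendsto (fun t => ∫ x, |u t x - u 0 x|) (nhdsWithin 0 (Set.Ioi 0)) (nhds 0) :=
    (uc 0 le_rfl).mono_left (nhdsWithin_mono _ Set.Ioi_subset_Ici_self)
  have w0 : 0 ≤ᵐ[volume] u 0 := by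
    filter_upwards [u0] with x hx
    rw [hx]; exact mul_nonneg hlam.le (hφ0 _)
  have mass : ∫ x, u 0 x = K := by
    rw [integral_congr_ae u0, scale, ← hφK]
    congr 1; ext x; rw [abs_of_nonneg (hφ0 x)]
  have hu : ∀ t, 0 < t → ∀ x, 0 ≤ u t x := fun t ht x => S.nonneg (ui 0 le_rfl) uc0 w0 ht x
  refine KS.final_bd hq1 hq2 ht (ux t ht).continuous (hu t ht) (K := K) ?_ (fun y x hyx => S.olei hq2 hu ht hyx) hR hh hC1
  intro y x hyx
  refine S.init_le (ui 0 le_rfl) uc0 hK ?_ ht hyx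
  intro y x hyx
  rw [intervalIntegral.integral_of_le hyx, ← mass]
  exact setIntegral_le_integral (ui 0 le_rfl) w0
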